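/- The inequality N2(2,4,m) > N2(0,4,m) holds for every non-negative integer m with m ≡ 6 (mod 8), for every m ≥ 48 with m ≡ 0 (mod 8), for every m ≥ 27 with m ≡ 3 (mod 8), and for every m ≥ 13 with m ≡ 5 (mod 8). -/

import Mathlib

open scoped Classical

/-- The M2-rank of a partition: ⌈ℓ/2⌉ − s, where ℓ is the largest part
(0 for the empty partition) and s is the number of parts. -/
def m2Rank {n : ℕ} (P : n.Partition) : ℤ :=
  (((P.parts.sup + 1) / 2 : ℕ) : ℤ) - (Multiset.card P.parts : ℤ)

/-- A partition has no repeated odd parts. -/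
def NoRepeatedOddParts {n : ℕ} (P : n.Partition) : Prop :=
  ∀ j : ℕ, Odd j → P.parts.count j ≤ 1

/-- `N2 r m n` is the number of partitions of `n` without repeated odd parts whose
M2-rank is congruent to `r` modulo `m`. -/
noncomputable def N2 (r : ℤ) (m n : ℕ) : ℕ :=
  Nat.card {P : n.Partition // NoRepeatedOddParts P ∧ m2Rank P ≡ r [ZMOD (m : ℤ)]}

section helpers

def NRO (s : Multiset ℕ) : Prop := 0 ∉ s ∧ ∀ j, Odd j → s.count j ≤ 1
def rk (s : Multiset ℕ) : ℤ := (((s.sup + 1) / 2 : ℕ) : ℤ) - (Multiset.card s : ℤ)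
def low (s : Multiset ℕ) : Multiset ℕ := (s.map (fun a => a - 2)).filter (fun a => 0 < a)

lemma ms_sup_mem (s : Multiset ℕ) (h : s ≠ 0) : s.sup ∈ s := by
  induction s using Multiset.induction with
  | empty => exact absurd rfl h
  | cons a s ih =>
    rw [Multiset.sup_cons]
    by_cases hs : s = 0
    · subst hs; simp
    · have := ih hs
      rcases le_total a s.sup with h1 | h1
      · rw [sup_eq_right.2 h1]; exact Multiset.mem_cons_of_mem this
      · rw [sup_eq_left.2 h1]; exact Multiset.mem_cons_self a s

lemma low_cons (a : ℕ) (s : Multiset ℕ) :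
    low (a ::ₘ s) = (if 2 < a then {a - 2} else 0) + low s := by
  unfold low
  rw [Multiset.map_cons, Multiset.filter_cons]
  congr 1
  by_cases h : 2 < a
  · rw [if_pos h, if_pos (by omega)]
  · rw [if_neg h, if_neg (by omega)]

lemma count_low (s : Multiset ℕ) (a : ℕ) (ha : 0 < a) : (low s).count a = s.count (a + 2) := by
  induction s using Multiset.induction with
  | empty => simp [low]
  | cons b s ih =>
    rw [low_cons, Multiset.count_add, ih, Multiset.count_cons]
    by_cases h : 2 < b
    · rw [if_pos h, Multiset.count_singleton]
      by_cases h2 : a + 2 = b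
      · rw [if_pos h2, if_pos (by omega)]; omega
      · rw [if_neg h2, if_neg (by omega)]; omega
    · rw [if_neg h, if_neg (by omega)]; simp

lemma zero_not_mem_low (s : Multiset ℕ) : 0 ∉ low s := by
  unfold low; simp

lemma card_low (s : Multiset ℕ) (h : 0 ∉ s) :
    Multiset.card (low s) + s.count 1 + s.count 2 = Multiset.card s := by
  induction s using Multiset.induction with
  | empty => simp [low]
  | cons b s ih =>
    have h1 : b ≠ 0 := by rintro rfl; simp at h
    have h2 : 0 ∉ s := fun hh => h (Multiset.mem_cons_of_mem hh)
    have := ih h2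
    rw [low_cons, Multiset.card_add, Multiset.count_cons, Multiset.count_cons, Multiset.card_cons]
    split_ifs <;> simp <;> omega

lemma sum_low (s : Multiset ℕ) (h : 0 ∉ s) :
    (low s).sum + 2 * Multiset.card s = s.sum + s.count 1 := by
  induction s using Multiset.induction with
  | empty => simp [low]
  | cons b s ih =>
    have h1 : b ≠ 0 := by rintro rfl; simp at h
    have h2 : 0 ∉ s := fun hh => h (Multiset.mem_cons_of_mem hh)
    have := ih h2
    rw [low_cons, Multiset.sum_add, Multiset.count_cons, Multiset.sum_cons, Multiset.card_cons]
    split_ifs <;> simp <;> omega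

lemma mem_low (s : Multiset ℕ) (a : ℕ) (h : a ∈ low s) : a + 2 ∈ s := by
  have h0 : 0 < a := by
    rcases Nat.eq_zero_or_pos a with h1 | h1
    · subst h1; exact absurd h (zero_not_mem_low s)
    · exact h1
  rw [← Multiset.one_le_count_iff_mem] at h ⊢
  rwa [count_low s a h0] at h

/-- subtracting step -/
noncomputable def phi (m : ℤ) (s : Multiset ℕ) : Multiset ℕ :=
  (if 2 * ((Multiset.card s : ℤ) + m) + 1 - (s.count 1 : ℤ) ≤ 0 then 0
    else {(2 * ((Multiset.card s : ℤ) + m) + 1 - (s.count 1 : ℤ)).toNat}) + low s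

noncomputable def psi (m : ℤ) (t : Multiset ℕ) : Multiset ℕ :=
  (t.erase t.sup).map (fun a => a + 2) + (if Even t.sup then {1} else 0) +
    Multiset.replicate (((t.sup / 2 : ℕ) : ℤ) - m - Multiset.card (t.erase t.sup)
      - (if Even t.sup then 1 else 0)).toNat 2

def T1 (m : ℤ) : Set (Multiset ℕ) := {s | NRO s ∧ rk s ≤ m + 1 ∧ ¬ (m = -1 ∧ s = 0)}
def T2 (m : ℤ) : Set (Multiset ℕ) := {s | NRO s ∧ m ≤ rk s ∧ ¬ (m = 0 ∧ s = 0)}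

lemma sup_le_rk (s : Multiset ℕ) (m : ℤ) : rk s ≤ m + 1 ↔ (s.sup : ℤ) ≤ 2 * (Multiset.card s + m) + 2 := by
  unfold rk; omega

/-- structure of phi -/
lemma phi_spec (m : ℤ) (s : Multiset ℕ) (hs : s ∈ T1 m) :
    ∃ L : ℕ, (L : ℤ) = 2 * ((Multiset.card s : ℤ) + m) + 1 - (s.count 1 : ℤ) ∧
      ((L = 0 ∧ low s = 0 ∧ phi m s = 0) ∨ (0 < L ∧ phi m s = L ::ₘ low s)) ∧
      (∀ a ∈ low s, a ≤ L) ∧ (Odd L → ∀ a ∈ low s, a < L) ∧ (Even L ↔ s.count 1 = 1) ∧ s.count 1 ≤ 1 := by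
  obtain ⟨⟨h0, h1⟩, h2, h3⟩ := hs
  rw [sup_le_rk] at h2
  have hc := h1 1 (by decide)
  have hlow : ∀ a ∈ low s, (a : ℤ) ≤ 2 * (Multiset.card s + m) := by
    intro a ha
    have := Multiset.le_sup (mem_low s a ha)
    omega
  have hL : 0 ≤ 2 * ((Multiset.card s : ℤ) + m) + 1 - (s.count 1 : ℤ) := by
    by_cases hz : s = 0
    · subst hz
      simp at h2 h3 ⊢
      omega
    · have h4 := ms_sup_mem s hz
      have h5 : s.sup ≠ 0 := fun h => h0 (h ▸ h4)
      omega
  obtain ⟨L, hLL⟩ := Int.eq_ofNat_of_zero_le hL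
  refine ⟨L, hLL.symm, ?_, ?_, ?_, ?_, hc⟩
  · rcases Nat.eq_zero_or_pos L with hz | hz
    · left
      have : low s = 0 := by
        rw [Multiset.eq_zero_iff_forall_notMem]
        intro a ha
        have := hlow a ha
        have h6 : a ≠ 0 := fun h => zero_not_mem_low s (h ▸ ha)
        omega
      refine ⟨hz, this, ?_⟩
      unfold phi
      rw [if_pos (by omega), this]; rfl
    · right
      refine ⟨hz, ?_⟩
      unfold phi
      rw [if_neg (by omega), hLL]; simp
  · intro a ha
    have := hlow a ha
    omega
  · intro ho a ha
    have := hlow a ha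
    obtain ⟨k, hk⟩ := ho
    omega
  · rw [Nat.even_iff]; omega

lemma phi_sup (m : ℤ) (s : Multiset ℕ) (hs : s ∈ T1 m) :
    ((phi m s).sup : ℤ) = 2 * ((Multiset.card s : ℤ) + m) + 1 - (s.count 1 : ℤ) ∧
    (phi m s).erase (phi m s).sup = low s ∧ (Even (phi m s).sup ↔ s.count 1 = 1) := by
  obtain ⟨L, hL, h1, h2, h3, h4, h5⟩ := phi_spec m s hs
  have : (phi m s).sup = L := by
    rcases h1 with ⟨a, b, c⟩ | ⟨a, b⟩
    · rw [c, a]; rfl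
    · rw [b, Multiset.sup_cons]
      apply sup_eq_left.2
      exact Multiset.sup_le.2 h2
  refine ⟨by rw [this, hL], ?_, by rw [this]; exact h4⟩
  rw [this]
  rcases h1 with ⟨a, b, c⟩ | ⟨a, b⟩
  · rw [c, b]; simp
  · rw [b]; simp

lemma phi_sum (m : ℤ) (s : Multiset ℕ) (hs : s ∈ T1 m) :
    ((phi m s).sum : ℤ) = s.sum + 2 * m + 1 := by
  obtain ⟨L, hL, h1, h2, h3, h4, h5⟩ := phi_spec m s hs
  have := sum_low s hs.1.1
  rcases h1 with ⟨a, b, c⟩ | ⟨a, b⟩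
  · have e : (phi m s).sum = 0 := by rw [c]; rfl
    have e2 : (low s).sum = 0 := by rw [b]; rfl
    omega
  · have e : (phi m s).sum = L + (low s).sum := by rw [b, Multiset.sum_cons]
    omega

lemma phi_mem (m : ℤ) (s : Multiset ℕ) (hs : s ∈ T1 m) : phi m s ∈ T2 m := by
  have hsup := (phi_sup m s hs).1
  obtain ⟨L, hL, h1, h2, h3, h4, h5⟩ := phi_spec m s hs
  have hcard := card_low s hs.1.1
  obtain ⟨⟨h6, h7⟩, h8, h9⟩ := hs
  rcases h1 with ⟨a, b, c⟩ | ⟨a, b⟩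
  · rw [c]
    refine ⟨⟨by simp, by simp⟩, ?_, ?_⟩
    · unfold rk; simp; omega
    · rintro ⟨rfl, -⟩
      omega
  · refine ⟨⟨?_, ?_⟩, ?_, ?_⟩
    · rw [b, Multiset.mem_cons]
      rintro (h | h)
      · omega
      · exact zero_not_mem_low s h
    · intro j hj
      rw [b, Multiset.count_cons]
      have hj0 : 0 < j := hj.pos
      rw [count_low s j hj0]
      have := h7 (j + 2) (by rw [Nat.odd_add]; simp [hj])
      split_ifs with hh
      · subst hh
        have : j ∉ low s := fun h => lt_irrefl _ (h3 hj j h)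
        rw [← Multiset.count_eq_zero, count_low s j hj0] at this
        omega
      · omega
    · unfold rk
      rw [b] at hsup ⊢
      rw [Multiset.card_cons]
      push_cast
      omega
    · rintro ⟨-, h⟩
      rw [b] at h
      simp at h

lemma psi_spec (m : ℤ) (t : Multiset ℕ) (ht : t ∈ T2 m) :
    (Multiset.card (psi m t) : ℤ) = ((t.sup / 2 : ℕ) : ℤ) - m ∧
    (psi m t).count 1 = (if Even t.sup then 1 else 0) ∧
    low (psi m t) = t.erase t.sup ∧ 0 ∉ psi m t ∧ (∀ a, (psi m t).count (a+3) = (t.erase t.sup).count (a+1)) := by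
  obtain ⟨⟨h0, h1⟩, h2, h3⟩ := ht
  have hz : 0 ∉ t.erase t.sup := fun h => h0 (Multiset.mem_of_mem_erase h)
  have hcnt : ∀ a, (psi m t).count (a+3) = (t.erase t.sup).count (a+1) := by
    intro a
    unfold psi
    rw [Multiset.count_add, Multiset.count_add, Multiset.count_replicate,
      if_neg (show ¬ (2 = a + 3) by omega)]
    have : (Multiset.map (fun a => a + 2) (t.erase t.sup)).count (a+3) = (t.erase t.sup).count (a+1) :=
      Multiset.count_map_eq_count' (fun a => a + 2) _ (fun x y h => by simpa using h) (a+1)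
    rw [this]
    split_ifs <;> simp
  have hzero : 0 ∉ psi m t := by
    unfold psi
    simp only [Multiset.mem_add, Multiset.mem_map, Multiset.mem_replicate]
    rintro ((⟨a, -, h⟩ | h) | h)
    · omega
    · split_ifs at h <;> simp at h
    · omega
  refine ⟨?_, ?_, ?_, hzero, hcnt⟩
  · unfold psi
    have key : 0 ≤ ((t.sup / 2 : ℕ) : ℤ) - m - Multiset.card (t.erase t.sup)
      - (if Even t.sup then 1 else 0) := by
      unfold rk at h2
      by_cases hh : t = 0
      · subst hh
        simp at h2 h3 ⊢
        omega
      · have h4 := ms_sup_mem t hh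
        have h5 := Multiset.card_erase_add_one h4
        rcases Nat.even_or_odd t.sup with h6 | h6
        · rw [if_pos h6]
          obtain ⟨k, hk⟩ := h6
          omega
        · rw [if_neg (by simpa using h6)]
          obtain ⟨k, hk⟩ := h6
          omega
    rw [Multiset.card_add, Multiset.card_add, Multiset.card_map, Multiset.card_replicate]
    rw [Nat.cast_add, Nat.cast_add, Int.toNat_of_nonneg key]
    split_ifs <;> simp
  · unfold psi
    rw [Multiset.count_add, Multiset.count_add, Multiset.count_replicate,
      if_neg (show ¬ (2 = 1) by omega)]
    have : Multiset.count 1 (Multiset.map (fun a => a + 2) (t.erase t.sup)) = 0 := by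
      rw [Multiset.count_eq_zero]; simp
    rw [this]
    split_ifs <;> simp
  · ext a
    rcases a with _ | a
    · rw [Multiset.count_eq_zero.2 (zero_not_mem_low _), Multiset.count_eq_zero.2 hz]
    · rw [count_low _ _ (by omega), hcnt]

lemma psi_mem (m : ℤ) (t : Multiset ℕ) (ht : t ∈ T2 m) : psi m t ∈ T1 m := by
  obtain ⟨h1, h2, h3, h4, h5⟩ := psi_spec m t ht
  obtain ⟨⟨h6, h7⟩, h8, h9⟩ := ht
  refine ⟨⟨h4, ?_⟩, ?_, ?_⟩
  · intro j hj
    rcases j with _ | _ | _ | j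
    · simp at hj
    · rw [h2]; split_ifs <;> omega
    · exact absurd hj (by decide)
    · rw [h5]
      have h11 : Odd (j + 1) := by
        rw [Nat.odd_iff] at hj ⊢; omega
      exact (Multiset.count_le_of_le _ (Multiset.erase_le _ _)).trans (h7 _ h11)
  · rw [sup_le_rk, h1]
    have : (psi m t).sup ≤ t.sup + 2 - (if Even t.sup then 0 else 1) := by
      apply Multiset.sup_le.2
      intro b hb
      rcases b with _ | _ | _ | b
      · omega
      · split_ifs <;> omega
      · have : ¬ Even t.sup → 0 < t.sup := by
          intro h
          rcases Nat.eq_zero_or_pos t.sup with h | h'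
          · simp_all
          · exact h'
        split_ifs with h
        · omega
        · have := this h; omega
      · have hb' : b + 1 ∈ t.erase t.sup := by
          rw [← Multiset.one_le_count_iff_mem] at hb ⊢
          rwa [← h5]
        have hb2 := Multiset.le_sup (Multiset.mem_of_mem_erase hb')
        split_ifs with h
        · omega
        · have : b + 1 ≠ t.sup := by
            intro hh
            have h10 := h7 t.sup (by simpa using h)
            rw [← Multiset.one_le_count_iff_mem, hh, Multiset.count_erase_self] at hb'
            omega
          omega
    rcases Nat.even_or_odd t.sup with h6 | h6
    · rw [if_pos h6] at this
      obtain ⟨k, hk⟩ := h6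
      omega
    · rw [if_neg (by simpa using h6)] at this
      obtain ⟨k, hk⟩ := h6
      omega
  · rintro ⟨rfl, h⟩
    rw [h] at h1
    simp at h1
    omega

lemma ms_eq_of (s t : Multiset ℕ) (hs : 0 ∉ s) (ht : 0 ∉ t) (h1 : s.count 1 = t.count 1)
    (hl : low s = low t) (hc : Multiset.card s = Multiset.card t) : s = t := by
  ext a
  rcases a with _ | _ | _ | a
  · rw [Multiset.count_eq_zero.2 hs, Multiset.count_eq_zero.2 ht]
  · exact h1
  · have := card_low s hs
    have := card_low t ht
    rw [hl] at *
    simp at *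
    omega
  · have := count_low s (a+1) (by omega)
    rw [hl, count_low t (a+1) (by omega)] at this
    exact this.symm

lemma psi_phi (m : ℤ) (s : Multiset ℕ) (hs : s ∈ T1 m) : psi m (phi m s) = s := by
  obtain ⟨h1, h2, h3, h4, h5⟩ := psi_spec m _ (phi_mem m s hs)
  obtain ⟨a1, a2, a3⟩ := phi_sup m s hs
  have hc := hs.1.2 1 (by decide)
  apply ms_eq_of _ _ h4 hs.1.1
  · rw [h2]
    split_ifs with h
    · exact (a3.1 h).symm
    · have : ¬ s.count 1 = 1 := fun hh => h (a3.2 hh)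
      omega
  · rw [h3, a2]
  · omega

lemma phi_psi (m : ℤ) (t : Multiset ℕ) (ht : t ∈ T2 m) : phi m (psi m t) = t := by
  obtain ⟨h1, h2, h3, h4, h5⟩ := psi_spec m t ht
  have hm := psi_mem m t ht
  obtain ⟨a1, a2, a3⟩ := phi_sup m _ hm
  obtain ⟨L, hL, b1, -⟩ := phi_spec m _ hm
  have hsup : t.sup = L := by
    rw [h2, h1] at hL
    rcases Nat.even_or_odd t.sup with h6 | h6
    · rw [if_pos h6] at hL
      obtain ⟨k, hk⟩ := h6
      omega
    · rw [if_neg (by simpa using h6)] at hL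
      obtain ⟨k, hk⟩ := h6
      omega
  by_cases hz : t = 0
  · rcases b1 with ⟨c1, c2, c3⟩ | ⟨c1, c2⟩
    · rw [c3, hz]
    · rw [hz] at hsup; simp at hsup; omega
  · have hmem := ms_sup_mem t hz
    have hpos : t.sup ≠ 0 := fun h => ht.1.1 (h ▸ hmem)
    rcases b1 with ⟨c1, c2, c3⟩ | ⟨c1, c2⟩
    · omega
    · rw [c2, h3, ← hsup, Multiset.cons_erase hmem]

lemma T_card (m : ℤ) (n n' : ℕ) (h : (n' : ℤ) = n + 2 * m + 1) :
    (T1 m ∩ {s | s.sum = n}).ncard = (T2 m ∩ {s | s.sum = n'}).ncard := by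
  apply Set.ncard_congr (fun s _ => phi m s)
  · rintro s ⟨h1, h2⟩
    refine ⟨phi_mem m s h1, ?_⟩
    have := phi_sum m s h1
    simp at h2 ⊢
    omega
  · rintro s t ⟨h1, h2⟩ ⟨h3, h4⟩ h5
    rw [← psi_phi m s h1, ← psi_phi m t h3, h5]
  · rintro t ⟨h1, h2⟩
    refine ⟨psi m t, ⟨psi_mem m t h1, ?_⟩, phi_psi m t h1⟩
    have := phi_sum m _ (psi_mem m t h1)
    rw [phi_psi m t h1] at this
    simp at h2 ⊢
    omega

lemma T1_sum_nonneg (m : ℤ) (s : Multiset ℕ) (hs : s ∈ T1 m) : 0 ≤ (s.sum : ℤ) + 2 * m + 1 := by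
  rw [← phi_sum m s hs]; positivity
lemma T2_sum_nonneg (m : ℤ) (t : Multiset ℕ) (ht : t ∈ T2 m) : 0 ≤ (t.sum : ℤ) - 2 * m - 1 := by
  have := phi_sum m _ (psi_mem m t ht)
  rw [phi_psi m t ht] at this
  omega

open scoped PowerSeries.WithPiTopology
open PowerSeries

/-- monomial with integer exponent -/
noncomputable def mz (e w : ℤ) : PowerSeries ℤ := PowerSeries.monomial e.toNat w

/-- admissible families: finite fibres and non-negative exponents -/
structure Adm {ι : Type*} (e w : ι → ℤ) : Prop where
  nonneg : ∀ i, w i ≠ 0 → 0 ≤ e i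
  fin : ∀ n : ℤ, {i | w i ≠ 0 ∧ e i ≤ n}.Finite

lemma mz_zero (e : ℤ) : mz e 0 = 0 := by simp [mz]

lemma Adm.summable {ι : Type*} {e w : ι → ℤ} (h : Adm e w) : Summable (fun i => mz (e i) (w i)) := by
  rw [PowerSeries.WithPiTopology.summable_iff_summable_coeff]
  intro n
  apply summable_of_hasFiniteSupport
  apply (h.fin n).subset
  intro i hi
  rw [Function.mem_support, mz, PowerSeries.coeff_monomial] at hi
  split_ifs at hi with h1
  · have := h.nonneg i hi
    exact ⟨hi, by omega⟩
  · exact absurd rfl hi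

lemma Adm.mul {ι κ : Type*} {e w : ι → ℤ} {e' w' : κ → ℤ} (h : Adm e w) (h' : Adm e' w') :
    Adm (fun x : ι × κ => e x.1 + e' x.2) (fun x => w x.1 * w' x.2) := by
  constructor
  · intro x hx
    have := h.nonneg x.1 (left_ne_zero_of_mul hx)
    have := h'.nonneg x.2 (right_ne_zero_of_mul hx)
    omega
  · intro n
    apply ((h.fin n).prod (h'.fin n)).subset
    rintro x ⟨hx, hn⟩
    have a := h.nonneg x.1 (left_ne_zero_of_mul hx)
    have b := h'.nonneg x.2 (right_ne_zero_of_mul hx)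
    refine ⟨⟨left_ne_zero_of_mul hx, ?_⟩, ⟨right_ne_zero_of_mul hx, ?_⟩⟩ <;> omega

/-- `GS e w f`: the family `w i X^(e i)` is admissible with sum `f`. -/
structure GS {ι : Type*} (e w : ι → ℤ) (f : PowerSeries ℤ) : Prop where
  adm : Adm e w
  hs : HasSum (fun i => mz (e i) (w i)) f

lemma Adm.gs {ι : Type*} {e w : ι → ℤ} (h : Adm e w) : GS e w (∑' i, mz (e i) (w i)) :=
  ⟨h, h.summable.hasSum⟩

lemma GS.unique {ι : Type*} {e w : ι → ℤ} {f g : PowerSeries ℤ} (h : GS e w f) (h' : GS e w g) : f = g :=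
  h.hs.unique h'.hs

lemma hasSum_mul_ps {ι κ : Type*} {F : ι → PowerSeries ℤ} {G : κ → PowerSeries ℤ} {f g : PowerSeries ℤ}
    (hf : HasSum F f) (hg : HasSum G g) (h : Summable fun x : ι × κ => F x.1 * G x.2) :
    HasSum (fun x : ι × κ => F x.1 * G x.2) (f * g) := by
  have := h.hasSum.prod_fiberwise (fun i => hg.mul_left (F i))
  have h2 := hf.mul_right g
  rw [h2.unique this]
  exact h.hasSum

lemma mz_mul_mz {ι κ : Type*} {e w : ι → ℤ} {e' w' : κ → ℤ} (h : Adm e w) (h' : Adm e' w') (x : ι × κ) :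
    mz (e x.1 + e' x.2) (w x.1 * w' x.2) = mz (e x.1) (w x.1) * mz (e' x.2) (w' x.2) := by
  by_cases h1 : w x.1 = 0
  · rw [h1, zero_mul, mz_zero, mz_zero, zero_mul]
  by_cases h2 : w' x.2 = 0
  · rw [h2, mul_zero, mz_zero, mz_zero, mul_zero]
  have a := h.nonneg _ h1
  have b := h'.nonneg _ h2
  rw [mz, mz, mz, PowerSeries.monomial_mul_monomial, Int.toNat_add a b]

lemma GS.mul {ι κ : Type*} {e w : ι → ℤ} {e' w' : κ → ℤ} {f g : PowerSeries ℤ}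
    (h : GS e w f) (h' : GS e' w' g) :
    GS (fun x : ι × κ => e x.1 + e' x.2) (fun x => w x.1 * w' x.2) (f * g) := by
  have ha := h.adm.mul h'.adm
  refine ⟨ha, ?_⟩
  have key := funext (mz_mul_mz h.adm h'.adm)
  have hsum := ha.summable
  have h1 : Summable (fun x : ι × κ => mz (e x.1) (w x.1) * mz (e' x.2) (w' x.2)) := by
    rw [← key]; exact hsum
  have h2 := hasSum_mul_ps h.hs h'.hs h1
  rw [← key] at h2
  exact h2

lemma GS.congr {ι : Type*} {e w e' w' : ι → ℤ} {f : PowerSeries ℤ} (h : GS e w f)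
    (hw : ∀ i, w' i = w i) (he : ∀ i, w i ≠ 0 → e' i = e i) : GS e' w' f := by
  refine ⟨⟨?_, ?_⟩, ?_⟩
  · intro i hi
    rw [hw] at hi
    rw [he i hi]; exact h.adm.nonneg i hi
  · intro n
    apply (h.adm.fin n).subset
    rintro i ⟨hi, hn⟩
    rw [hw] at hi
    exact ⟨hi, by rw [← he i hi]; exact hn⟩
  · convert h.hs using 2 with i
    rw [hw]
    by_cases hi : w i = 0
    · simp [hi, mz_zero]
    · rw [he i hi]

lemma GS.equiv {ι κ : Type*} {e w : ι → ℤ} {f : PowerSeries ℤ} (h : GS e w f) (σ : κ ≃ ι) :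
    GS (fun k => e (σ k)) (fun k => w (σ k)) f := by
  refine ⟨⟨fun k => h.adm.nonneg _, fun n => ?_⟩, ?_⟩
  · exact (h.adm.fin n).preimage (σ.injective.injOn)
  · exact (σ.hasSum_iff (f := fun i => mz (e i) (w i))).2 h.hs

lemma GS.add {ι : Type*} {e w w' : ι → ℤ} {f g : PowerSeries ℤ} (h : GS e w f) (h' : GS e w' g) :
    GS e (fun i => w i + w' i) (f + g) := by
  have hne : ∀ i, w i + w' i ≠ 0 → w i ≠ 0 ∨ w' i ≠ 0 := by
    intro i hi
    by_contra hh
    push Not at hh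
    omega
  refine ⟨⟨?_, ?_⟩, ?_⟩
  · intro i hi
    rcases hne i hi with h1 | h1
    · exact h.adm.nonneg i h1
    · exact h'.adm.nonneg i h1
  · intro n
    apply ((h.adm.fin n).union (h'.adm.fin n)).subset
    rintro i ⟨hi, hn⟩
    rcases hne i hi with h1 | h1
    · exact Or.inl ⟨h1, hn⟩
    · exact Or.inr ⟨h1, hn⟩
  · convert h.hs.add h'.hs using 2 with i
    simp [mz]

lemma GS.smul {ι : Type*} {e w : ι → ℤ} {f : PowerSeries ℤ} (h : GS e w f) (c : ℤ) :
    GS e (fun i => c * w i) (c * f) := by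
  refine ⟨⟨?_, ?_⟩, ?_⟩
  · intro i hi
    exact h.adm.nonneg i (right_ne_zero_of_mul hi)
  · intro n
    apply (h.adm.fin n).subset
    rintro i ⟨hi, hn⟩
    exact ⟨right_ne_zero_of_mul hi, hn⟩
  · have key : (fun i => mz (e i) (c * w i)) = fun i => (c : PowerSeries ℤ) * mz (e i) (w i) := by
      funext i
      rw [mz, mz, ← smul_eq_mul, map_smul, zsmul_eq_mul]
    rw [key]
    exact h.hs.mul_left (c : PowerSeries ℤ)

lemma GS.neg {ι : Type*} {e w : ι → ℤ} {f : PowerSeries ℤ} (h : GS e w f) :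
    GS e (fun i => - w i) (- f) := by
  have := h.smul (-1)
  simpa using this

lemma GS.sub {ι : Type*} {e w w' : ι → ℤ} {f g : PowerSeries ℤ} (h : GS e w f) (h' : GS e w' g) :
    GS e (fun i => w i - w' i) (f - g) := by
  have := h.add h'.neg
  simpa [sub_eq_add_neg] using this

/-- sign reversing bijection -/
lemma GS.eq_zero {ι : Type*} {e w : ι → ℤ} {f : PowerSeries ℤ} (h : GS e w f) (σ : ι ≃ ι)
    (hw : ∀ i, w (σ i) = - w i) (he : ∀ i, e (σ i) = e i) : f = 0 := by
  have h1 := (h.equiv σ)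
  have h2 : GS e w (-f) := by
    have := h1.neg
    refine this.congr (fun i => ?_) (fun i _ => ?_)
    · rw [hw]; ring
    · rw [he]
  have h3 := h.unique h2
  have : (2 : PowerSeries ℤ) * f = 0 := by linear_combination h3
  rcases mul_eq_zero.1 this with h4 | h4
  · exfalso
    have := congrArg (PowerSeries.coeff 0) h4
    have h5 : (2 : PowerSeries ℤ) = PowerSeries.C 2 := by simp
    rw [h5, PowerSeries.coeff_zero_C] at this
    simp at this
  · exact h4

/-- restriction to / extension from the range of an injective map -/
lemma GS.inj {ι κ : Type*} {e w : ι → ℤ} {f : PowerSeries ℤ} (h : GS e w f) (σ : κ → ι)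
    (hσ : Function.Injective σ) (hr : ∀ i, w i ≠ 0 → i ∈ Set.range σ) :
    GS (fun k => e (σ k)) (fun k => w (σ k)) f := by
  refine ⟨⟨fun k => h.adm.nonneg _, fun n => ?_⟩, ?_⟩
  · exact (h.adm.fin n).preimage (hσ.injOn)
  · refine (hσ.hasSum_iff (f := fun i => mz (e i) (w i)) ?_).2 h.hs
    intro i hi
    have : w i = 0 := by
      by_contra h1
      exact hi (hr i h1)
    simp [this, mz_zero]

lemma GS.ext {ι κ : Type*} {e w : ι → ℤ} {f : PowerSeries ℤ} (σ : κ → ι)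
    (hσ : Function.Injective σ) (h : GS (fun k => e (σ k)) (fun k => w (σ k)) f)
    (hr : ∀ i, w i ≠ 0 → i ∈ Set.range σ) : GS e w f := by
  refine ⟨⟨fun i hi => ?_, fun n => ?_⟩, ?_⟩
  · obtain ⟨k, rfl⟩ := hr i hi
    exact h.adm.nonneg k hi
  · apply ((h.adm.fin n).image σ).subset
    rintro i ⟨hi, hn⟩
    obtain ⟨k, rfl⟩ := hr i hi
    exact ⟨k, ⟨hi, hn⟩, rfl⟩
  · refine (hσ.hasSum_iff (f := fun i => mz (e i) (w i)) ?_).1 h.hs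
    intro i hi
    have : w i = 0 := by
      by_contra h1
      exact hi (hr i h1)
    simp [this, mz_zero]

lemma GS.zero {ι : Type*} (e : ι → ℤ) : GS e (fun _ => 0) 0 := by
  refine ⟨⟨fun i hi => absurd rfl hi, fun n => ?_⟩, ?_⟩
  · convert Set.finite_empty
    ext i; simp
  · simp only [mz_zero]; exact hasSum_zero

/-- coefficient formula -/
lemma GS.coeff {ι : Type*} {e w : ι → ℤ} {f : PowerSeries ℤ} (h : GS e w f) (n : ℕ) :
    HasSum (fun i => if e i = n then w i else 0) (PowerSeries.coeff n f) := by
  have := ((PowerSeries.WithPiTopology.hasSum_iff_hasSum_coeff ℤ).1 h.hs) n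
  have key : (fun i => if e i = n then w i else 0) = fun i => (PowerSeries.coeff n) (mz (e i) (w i)) := by
    funext i
    rw [mz, PowerSeries.coeff_monomial]
    by_cases hw : w i = 0
    · simp [hw]
    · have := h.adm.nonneg i hw
      by_cases h2 : e i = n
      · rw [if_pos h2, if_pos (by omega)]
      · rw [if_neg h2, if_neg (by omega)]
  rw [key]
  exact this

/-- multiplication by a power of X -/
lemma GS.shift {ι : Type*} {e w : ι → ℤ} {f : PowerSeries ℤ} (h : GS e w f) (k : ℕ) :
    GS (fun i => e i + k) w (X ^ k * f) := by
  refine ⟨⟨fun i hi => ?_, fun n => ?_⟩, ?_⟩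
  · have := h.adm.nonneg i hi; omega
  · apply (h.adm.fin n).subset
    rintro i ⟨hi, hn⟩
    exact ⟨hi, by omega⟩
  · have key : (fun i => mz (e i + k) (w i)) = fun i => (X ^ k : PowerSeries ℤ) * mz (e i) (w i) := by
      funext i
      by_cases hw : w i = 0
      · simp [hw, mz_zero]
      · have := h.adm.nonneg i hw
        rw [mz, mz, PowerSeries.X_pow_eq, PowerSeries.monomial_mul_monomial, one_mul]
        have : (e i + k).toNat = k + (e i).toNat := by omega
        rw [this]
    rw [key]
    exact h.hs.mul_left (X ^ k : PowerSeries ℤ)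

/-- substitution X -> -X -/
lemma GS.evalNeg {ι : Type*} {e w : ι → ℤ} {f : PowerSeries ℤ} (h : GS e w f) :
    GS e (fun i => w i * (-1) ^ (e i).toNat) (PowerSeries.rescale (-1 : ℤ) f) := by
  have hne : ∀ i, w i * (-1) ^ (e i).toNat ≠ 0 → w i ≠ 0 := fun i hi => left_ne_zero_of_mul hi
  refine ⟨⟨fun i hi => h.adm.nonneg i (hne i hi), fun n => ?_⟩, ?_⟩
  · apply (h.adm.fin n).subset
    rintro i ⟨hi, hn⟩
    exact ⟨hne i hi, hn⟩
  · rw [PowerSeries.WithPiTopology.hasSum_iff_hasSum_coeff]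
    intro n
    have := (((PowerSeries.WithPiTopology.hasSum_iff_hasSum_coeff ℤ).1 h.hs) n).mul_left ((-1)^n)
    rw [PowerSeries.coeff_rescale]
    have key : (fun i => (PowerSeries.coeff n) (mz (e i) (w i * (-1) ^ (e i).toNat)))
        = fun i => (-1) ^ n * (PowerSeries.coeff n) (mz (e i) (w i)) := by
      funext i
      rw [mz, mz, PowerSeries.coeff_monomial, PowerSeries.coeff_monomial]
      split_ifs with h1
      · rw [h1]; ring
      · simp
    rw [key]
    exact this

/-- union of two index sets -/
lemma GS.sum {ι κ : Type*} {e w : ι → ℤ} {e' w' : κ → ℤ} {f g : PowerSeries ℤ}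
    (h : GS e w f) (h' : GS e' w' g) : GS (Sum.elim e e') (Sum.elim w w') (f + g) := by
  refine ⟨⟨?_, ?_⟩, ?_⟩
  · rintro (i | i) hi
    · exact h.adm.nonneg i hi
    · exact h'.adm.nonneg i hi
  · intro n
    apply (((h.adm.fin n).image Sum.inl).union ((h'.adm.fin n).image Sum.inr)).subset
    rintro (i | i) hi
    · exact Or.inl ⟨i, hi, rfl⟩
    · exact Or.inr ⟨i, hi, rfl⟩
  · refine HasSum.sum ?_ ?_
    · exact h.hs
    · exact h'.hs

/-- summing over the second index -/
lemma GS.fiber {ι κ : Type*} {e w : ι × κ → ℤ} {f : PowerSeries ℤ} (h : GS e w f)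
    (g : ι → PowerSeries ℤ) (hg : ∀ i, GS (fun k => e (i, k)) (fun k => w (i, k)) (g i)) :
    HasSum g f := h.hs.prod_fiberwise (fun i => (hg i).hs)

lemma all_finite (n : ℕ) : {s : Multiset ℕ | NRO s ∧ s.sum = n}.Finite := by
  apply (Set.finite_range (fun P : n.Partition => P.parts)).subset
  rintro s ⟨⟨h1, h2⟩, h3⟩
  exact ⟨⟨s, fun {i} hi => Nat.pos_of_ne_zero (fun h => h1 (h ▸ hi)), h3⟩, rfl⟩

noncomputable def All (n : ℕ) : Finset (Multiset ℕ) := (all_finite n).toFinset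

lemma mem_All (n : ℕ) (s : Multiset ℕ) : s ∈ All n ↔ NRO s ∧ s.sum = n := by simp [All]

noncomputable def cnt (p : ℤ → Prop) (n : ℕ) : ℕ := ((All n).filter (fun s => p (rk s))).card

noncomputable def gf (p : ℤ → Prop) : PowerSeries ℤ := PowerSeries.mk (fun n => (cnt p n : ℤ))

lemma cnt_eq_sum (p : ℤ → Prop) (n : ℕ) : (cnt p n : ℤ) = ∑ s ∈ All n, if p (rk s) then 1 else 0 := by
  unfold cnt; simp

lemma gf_add (p q r : ℤ → Prop) (h1 : ∀ x, r x ↔ p x ∨ q x) (h2 : ∀ x, ¬ (p x ∧ q x)) :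
    gf r = gf p + gf q := by
  ext n
  simp only [gf, PowerSeries.coeff_mk, map_add, cnt_eq_sum, ← Finset.sum_add_distrib]
  apply Finset.sum_congr rfl
  intro s _
  have a := h1 (rk s)
  have b := h2 (rk s)
  by_cases hp : p (rk s) <;> by_cases hq : q (rk s) <;> simp_all

lemma ncard_T1 (m : ℤ) (n : ℕ) : ((T1 m ∩ {s | s.sum = n}).ncard : ℤ) =
    cnt (fun r => r ≤ m + 1) n - (if m = -1 ∧ n = 0 then 1 else 0) := by
  have hset : T1 m ∩ {s | s.sum = n} =
      (((All n).filter (fun s => rk s ≤ m + 1)).filter (fun s => ¬ (m = -1 ∧ s = 0)) : Finset (Multiset ℕ)) := by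
    ext s
    simp [T1, mem_All]
    tauto
  rw [hset, Set.ncard_coe_finset]
  have := Finset.card_filter_add_card_filter_not (s := (All n).filter (fun s => rk s ≤ m + 1))
    (fun s => (m = -1 ∧ s = 0))
  have h2 : (((All n).filter (fun s => rk s ≤ m + 1)).filter (fun s => (m = -1 ∧ s = 0))).card
      = if m = -1 ∧ n = 0 then 1 else 0 := by
    split_ifs with h
    · obtain ⟨rfl, rfl⟩ := h
      rw [Finset.card_eq_one]
      refine ⟨0, ?_⟩
      ext s
      simp only [Finset.mem_filter, mem_All, Finset.mem_singleton]
      constructor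
      · rintro ⟨-, -, h⟩; exact h
      · rintro rfl
        simp [NRO, rk]
    · rw [Finset.card_eq_zero]
      ext s
      simp only [Finset.mem_filter, mem_All]
      constructor
      · rintro ⟨⟨⟨-, h3⟩, -⟩, h1, rfl⟩
        simp at h3
        exact absurd ⟨h1, h3.symm⟩ h
      · simp
  have e : cnt (fun r => r ≤ m + 1) n = ((All n).filter (fun s => rk s ≤ m + 1)).card := by
    unfold cnt; congr!
  rw [e]
  split_ifs at h2 ⊢ <;> omega

lemma ncard_T2 (m : ℤ) (n : ℕ) : ((T2 m ∩ {s | s.sum = n}).ncard : ℤ) =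
    cnt (fun r => m ≤ r) n - (if m = 0 ∧ n = 0 then 1 else 0) := by
  have hset : T2 m ∩ {s | s.sum = n} =
      (((All n).filter (fun s => m ≤ rk s)).filter (fun s => ¬ (m = 0 ∧ s = 0)) : Finset (Multiset ℕ)) := by
    ext s
    simp [T2, mem_All]
    tauto
  rw [hset, Set.ncard_coe_finset]
  have := Finset.card_filter_add_card_filter_not (s := (All n).filter (fun s => m ≤ rk s))
    (fun s => (m = 0 ∧ s = 0))
  have h2 : (((All n).filter (fun s => m ≤ rk s)).filter (fun s => (m = 0 ∧ s = 0))).card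
      = if m = 0 ∧ n = 0 then 1 else 0 := by
    split_ifs with h
    · obtain ⟨rfl, rfl⟩ := h
      rw [Finset.card_eq_one]
      refine ⟨0, ?_⟩
      ext s
      simp only [Finset.mem_filter, mem_All, Finset.mem_singleton]
      constructor
      · rintro ⟨-, -, h⟩; exact h
      · rintro rfl
        simp [NRO, rk]
    · rw [Finset.card_eq_zero]
      ext s
      simp only [Finset.mem_filter, mem_All]
      constructor
      · rintro ⟨⟨⟨-, h3⟩, -⟩, h1, rfl⟩
        simp at h3
        exact absurd ⟨h1, h3.symm⟩ h
      · simp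
  have e : cnt (fun r => m ≤ r) n = ((All n).filter (fun s => m ≤ rk s)).card := by
    unfold cnt; congr!
  rw [e]
  split_ifs at h2 ⊢ <;> omega

lemma key1 (m : ℕ) : gf (fun r => (m : ℤ) ≤ r) - (if m = 0 then 1 else 0)
    = X ^ (2 * m + 1) * gf (fun r => r ≤ (m : ℤ) + 1) := by
  ext n
  rw [PowerSeries.coeff_X_pow_mul', map_sub]
  have h2 := ncard_T2 m n
  have e : (PowerSeries.coeff n) (if m = 0 then (1 : PowerSeries ℤ) else 0)
      = if (m : ℤ) = 0 ∧ n = 0 then 1 else 0 := by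
    by_cases hm : m = 0
    · simp [hm, PowerSeries.coeff_one]
    · simp [hm]
  rw [e, gf, PowerSeries.coeff_mk, ← h2]
  split_ifs with h
  · rw [gf, PowerSeries.coeff_mk]
    have h1 := ncard_T1 m (n - (2 * m + 1))
    rw [if_neg (by omega)] at h1
    rw [← T_card m (n - (2 * m + 1)) n (by omega), h1]
    simp
  · have : T2 m ∩ {s | s.sum = n} = ∅ := by
      ext t
      simp only [Set.mem_inter_iff, Set.mem_ofPred_eq, Set.mem_empty_iff_false, iff_false]
      rintro ⟨h3, h4⟩
      have := T2_sum_nonneg m t h3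
      omega
    rw [this]; simp

lemma key2 (j : ℕ) : gf (fun r => r ≤ -(j : ℤ)) - (if j = 0 then 1 else 0)
    = X ^ (2 * j + 1) * gf (fun r => -(j : ℤ) - 1 ≤ r) := by
  ext n
  rw [PowerSeries.coeff_X_pow_mul', map_sub]
  have h2 := ncard_T1 (-(j:ℤ) - 1) n
  have e : (PowerSeries.coeff n) (if j = 0 then (1 : PowerSeries ℤ) else 0)
      = if (-(j : ℤ) - 1) = -1 ∧ n = 0 then 1 else 0 := by
    by_cases hm : j = 0
    · simp [hm, PowerSeries.coeff_one]
    · have : ¬ (-(j : ℤ) - 1 = -1) := by omega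
      simp [hm, this]
  rw [sub_add_cancel] at h2
  rw [e, gf, PowerSeries.coeff_mk, ← h2]
  split_ifs with h
  · rw [gf, PowerSeries.coeff_mk]
    have h1 := ncard_T2 (-(j:ℤ) - 1) (n - (2 * j + 1))
    rw [if_neg (by omega)] at h1
    rw [T_card (-(j:ℤ) - 1) n (n - (2 * j + 1)) (by omega), h1]
    simp
  · have : T1 (-(j:ℤ) - 1) ∩ {s | s.sum = n} = ∅ := by
      ext t
      simp only [Set.mem_inter_iff, Set.mem_ofPred_eq, Set.mem_empty_iff_false, iff_false]
      rintro ⟨h3, h4⟩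
      have := T1_sum_nonneg _ t h3
      omega
    rw [this]; simp

/-- partial theta s_j -/
noncomputable def se (j : ℕ) (n : ℕ) : ℤ := 2 * ((n : ℤ) + 1) ^ 2 - (n + 1) + 2 * j * (n + 1)
lemma adm_se (j : ℕ) : Adm (se j) (fun n => (-1) ^ n) := by
  have hb : ∀ n : ℕ, (n : ℤ) ≤ se j n := by
    intro n; unfold se
    have : (0:ℤ) ≤ 2 * j * (n + 1) := by positivity
    nlinarith
  refine ⟨fun i _ => le_trans (by positivity) (hb i), fun n => ?_⟩
  apply (Set.finite_Iic n.toNat).subset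
  rintro i ⟨-, hi⟩
  have := hb i
  simp only [Set.mem_Iic]; omega
noncomputable def sS (j : ℕ) : PowerSeries ℤ := ∑' n, mz (se j n) ((-1) ^ n)
lemma gs_sS (j : ℕ) : GS (se j) (fun n => (-1) ^ n) (sS j) := (adm_se j).gs

lemma sS_rec1 (j : ℕ) : HasSum (fun n : ℕ => mz (se j (n + 1)) ((-1) ^ (n + 1)))
    (-(X ^ (2 * j + 1) * sS (j + 2))) := by
  have h1 := ((gs_sS (j + 2)).shift (2 * j + 1)).neg
  have h2 : GS (fun n => se j (n+1)) (fun n => (-1)^(n+1)) (-(X ^ (2 * j + 1) * sS (j + 2))) := by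
    apply h1.congr
    · intro i; ring
    · intro i _; simp only [se]; push_cast; ring
  exact h2.hs

lemma mz_nat (k : ℕ) (e : ℤ) (h : e = k) : mz e 1 = X ^ k := by
  subst h
  rw [PowerSeries.X_pow_eq, mz]; simp

lemma sS_rec (j : ℕ) : sS j = X ^ (2 * j + 1) * (1 - sS (j + 2)) := by
  have h3 := HasSum.zero_add (f := fun n => mz (se j n) ((-1) ^ n)) (sS_rec1 j)
  have h4 := (gs_sS j).hs.unique h3
  rw [pow_zero, mz_nat (2 * j + 1) (se j 0) (by simp [se]; ring)] at h4
  rw [h4]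
  ring

lemma hs_congr {ι : Type*} {f g : ι → PowerSeries ℤ} {a b : PowerSeries ℤ} (h : HasSum f a)
    (hf : ∀ i, g i = f i) (hb : b = a) : HasSum g b := by
  rw [funext hf, hb]; exact h

lemma rec_unique (P : PowerSeries ℤ) (a : ℕ → PowerSeries ℤ)
    (h : ∀ j, 1 ≤ j → a j = X ^ (2 * j + 1) * (P - a (j + 2))) :
    ∀ j, 1 ≤ j → a j = P * sS j := by
  have key : ∀ N j, 1 ≤ j → X ^ N ∣ a j - P * sS j := by
    intro N
    induction N with
    | zero => intro j _; simp
    | succ N ih =>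
      intro j hj
      have h1 : a j - P * sS j = - (X ^ (2 * j + 1) * (a (j + 2) - P * sS (j + 2))) := by
        rw [h j hj, sS_rec j]; ring
      rw [h1, dvd_neg, pow_succ']
      exact mul_dvd_mul (dvd_pow_self X (by omega)) (ih (j + 2) (by omega))
  intro j hj
  rw [← sub_eq_zero]
  ext n
  have := key (n + 1) j hj
  rw [PowerSeries.X_pow_dvd_iff] at this
  rw [this n (by omega)]; simp

noncomputable def PP : PowerSeries ℤ := gf (fun _ => True)

lemma H_eq (j : ℕ) (hj : 1 ≤ j) : gf (fun r => (j : ℤ) ≤ r) = PP * sS j := by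
  refine rec_unique PP (fun j => gf (fun r => (j : ℤ) ≤ r)) ?_ j hj
  intro j hj
  have h1 := key1 j
  rw [if_neg (by omega), sub_zero] at h1
  rw [h1]
  congr 1
  rw [eq_sub_iff_add_eq, eq_comm]
  apply gf_add
  · intro x; push_cast; constructor <;> intro h <;> first | trivial | omega
  · intro x; push_cast; omega

lemma Lo_eq (j : ℕ) (hj : 1 ≤ j) : gf (fun r => r ≤ -(j : ℤ)) = PP * sS j := by
  refine rec_unique PP (fun j => gf (fun r => r ≤ -(j : ℤ))) ?_ j hj
  intro j hj
  have h1 := key2 j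
  rw [if_neg (by omega), sub_zero] at h1
  rw [h1]
  congr 1
  rw [eq_sub_iff_add_eq, eq_comm]
  apply gf_add
  · intro x; push_cast; constructor <;> intro h <;> first | trivial | omega
  · intro x; push_cast; omega

lemma H0_eq : gf (fun r => 0 ≤ r) = 1 + PP * sS 0 := by
  have h1 := key1 0
  have h2 := H_eq 2 (by norm_num)
  have h3 : PP = gf (fun r => r ≤ 1) + gf (fun r => 2 ≤ r) := by
    apply gf_add
    · intro x; constructor <;> intro h <;> first | trivial | omega
    · intro x; omega
  have h4 := sS_rec 0
  simp at h1 h2 h4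
  rw [h4, sub_eq_iff_eq_add.1 h1]
  linear_combination (-X) * h3 + (-X) * h2

noncomputable def psim : PowerSeries ℤ := 1 - sS 0 - sS 1

lemma PP_psim : PP * psim = 1 := by
  have h3 : PP = gf (fun r => 0 ≤ r) + gf (fun r => r ≤ -1) := by
    apply gf_add
    · intro x; constructor <;> intro h <;> first | trivial | omega
    · intro x; omega
  have h4 := Lo_eq 1 le_rfl
  simp at h4
  unfold psim
  linear_combination h3 + H0_eq + h4

noncomputable def FF : PowerSeries ℤ := gf (fun r => r ≡ 0 [ZMOD 4]) - gf (fun r => r ≡ 2 [ZMOD 4])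

lemma Npos (j : ℕ) (hj : 1 ≤ j) : psim * gf (fun r => r = (j : ℤ)) = sS j - sS (j + 1) := by
  have h : gf (fun r => (j : ℤ) ≤ r) = gf (fun r => r = (j : ℤ)) + gf (fun r => ((j + 1 : ℕ) : ℤ) ≤ r) := by
    apply gf_add
    · intro x; push_cast; omega
    · intro x; push_cast; omega
  rw [H_eq j hj, H_eq (j + 1) (by omega)] at h
  linear_combination (-psim) * h + (sS j - sS (j+1)) * PP_psim

lemma Nneg (j : ℕ) (hj : 1 ≤ j) : psim * gf (fun r => r = -(j : ℤ)) = sS j - sS (j + 1) := by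
  have h : gf (fun r => r ≤ -(j : ℤ)) = gf (fun r => r = -(j : ℤ)) + gf (fun r => r ≤ -((j + 1 : ℕ) : ℤ)) := by
    apply gf_add
    · intro x; push_cast; omega
    · intro x; push_cast; omega
  rw [Lo_eq j hj, Lo_eq (j + 1) (by omega)] at h
  linear_combination (-psim) * h + (sS j - sS (j+1)) * PP_psim

lemma Nzero : psim * gf (fun r => r = 0) = 1 - 2 * sS 1 := by
  have h3 : PP = gf (fun r => 0 ≤ r) + gf (fun r => r ≤ -1) := by
    apply gf_add
    · intro x; constructor <;> intro h <;> first | trivial | omega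
    · intro x; omega
  have h5 : gf (fun r => 0 ≤ r) = gf (fun r => r = 0) + gf (fun r => 1 ≤ r) := by
    apply gf_add
    · intro x; omega
    · intro x; omega
  have h4 := Lo_eq 1 le_rfl
  have h6 := H_eq 1 le_rfl
  simp at h4 h6
  linear_combination (-psim) * h3 - psim * h4 - psim * h5 - psim * h6 + (1 - 2 * sS 1) * PP_psim

lemma FF_hasSum : HasSum (fun j : ℕ => (-1) ^ (j + 1) *
    (gf (fun r => r = ((2 * (j + 1) : ℕ) : ℤ)) + gf (fun r => r = -((2 * (j + 1) : ℕ) : ℤ))))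
    (FF - gf (fun r => r = 0)) := by
  rw [PowerSeries.WithPiTopology.hasSum_iff_hasSum_coeff]
  intro n
  have e1 : PowerSeries.coeff n (FF - gf (fun r => r = 0)) = ∑ s ∈ All n,
      ((if rk s ≡ 0 [ZMOD 4] then 1 else 0) - (if rk s ≡ 2 [ZMOD 4] then 1 else 0)
        - (if rk s = 0 then 1 else 0) : ℤ) := by
    simp only [FF, gf, map_sub, PowerSeries.coeff_mk, cnt_eq_sum, Finset.sum_sub_distrib]
    congr!
  have e2 : (fun j : ℕ => PowerSeries.coeff n ((-1) ^ (j + 1) *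
    (gf (fun r => r = ((2 * (j + 1) : ℕ) : ℤ)) + gf (fun r => r = -((2 * (j + 1) : ℕ) : ℤ)))))
     = fun j : ℕ => ∑ s ∈ All n, (-1) ^ (j + 1) * ((if rk s = ((2 * (j + 1) : ℕ) : ℤ) then 1 else 0)
        + (if rk s = -((2 * (j + 1) : ℕ) : ℤ) then 1 else 0) : ℤ) := by
    funext j
    have : ((-1) ^ (j + 1) : PowerSeries ℤ) = PowerSeries.C ((-1) ^ (j + 1)) := by simp
    rw [this, PowerSeries.coeff_C_mul]
    simp only [gf, map_add, PowerSeries.coeff_mk, cnt_eq_sum, Finset.mul_sum, Finset.sum_add_distrib, mul_add]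
    congr!
  rw [e1, e2]
  apply hasSum_sum
  intro s _
  generalize rk s = k
  by_cases hk : ∃ j : ℕ, k = ((2 * (j + 1) : ℕ) : ℤ) ∨ k = -((2 * (j + 1) : ℕ) : ℤ)
  · obtain ⟨j, hj⟩ := hk
    have hval : ((if k ≡ 0 [ZMOD 4] then 1 else 0) - (if k ≡ 2 [ZMOD 4] then 1 else 0)
        - (if k = 0 then 1 else 0) : ℤ) = (-1) ^ (j + 1) * ((if k = ((2 * (j + 1) : ℕ) : ℤ) then 1 else 0)
        + (if k = -((2 * (j + 1) : ℕ) : ℤ) then 1 else 0) : ℤ) := by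
      have hz : ¬ k = 0 := by omega
      have e3 : ((if k = ((2 * (j + 1) : ℕ) : ℤ) then 1 else 0)
        + (if k = -((2 * (j + 1) : ℕ) : ℤ) then 1 else 0) : ℤ) = 1 := by
        rcases hj with h | h
        · rw [if_pos h, if_neg (by omega)]; rfl
        · rw [if_neg (by omega), if_pos h]; rfl
      rw [e3, if_neg hz]
      rcases Nat.even_or_odd' j with ⟨c, rfl | rfl⟩
      · have a1 : ¬ k ≡ 0 [ZMOD 4] := by unfold Int.ModEq; omega
        have a2 : k ≡ 2 [ZMOD 4] := by unfold Int.ModEq; omega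
        rw [if_neg a1, if_pos a2, pow_succ, pow_mul]; simp
      · have a1 : k ≡ 0 [ZMOD 4] := by unfold Int.ModEq; omega
        have a2 : ¬ k ≡ 2 [ZMOD 4] := by unfold Int.ModEq; omega
        rw [if_pos a1, if_neg a2, pow_succ, pow_succ, pow_mul]; simp
    rw [hval]
    apply hasSum_single j
    intro j' hj'
    rw [if_neg (by omega), if_neg (by omega)]; simp
  · push Not at hk
    have hval : ((if k ≡ 0 [ZMOD 4] then 1 else 0) - (if k ≡ 2 [ZMOD 4] then 1 else 0)
        - (if k = 0 then 1 else 0) : ℤ) = 0 := by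
      by_cases hz : k = 0
      · subst hz; simp; decide
      · have hodd : k % 2 = 1 := by
          by_contra h
          have := hk (k.natAbs / 2 - 1)
          omega
        have a1 : ¬ k ≡ 0 [ZMOD 4] := by unfold Int.ModEq; omega
        have a2 : ¬ k ≡ 2 [ZMOD 4] := by unfold Int.ModEq; omega
        rw [if_neg a1, if_neg a2, if_neg hz]; rfl
    rw [hval]
    convert hasSum_zero using 1
    funext j
    have := hk j
    rw [if_neg this.1, if_neg this.2]; simp

lemma FF_hasSum2 : HasSum (fun j : ℕ => (-1) ^ (j + 1) * (2 * (sS (2 * j + 2) - sS (2 * j + 3))))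
    (psim * FF - 1 + 2 * sS 1) := by
  have := FF_hasSum.mul_left psim
  apply hs_congr this
  · intro j
    have h1 := Npos (2 * (j + 1)) (by omega)
    have h2 := Nneg (2 * (j + 1)) (by omega)
    rw [show 2 * j + 2 = 2 * (j + 1) by ring, show 2 * j + 3 = 2 * (j + 1) + 1 by ring]
    linear_combination (-(-1)^(j+1)) * h1 + (-(-1)^(j+1)) * h2
  · linear_combination Nzero

/-- parity sign -/
def eps (a : ℤ) : ℤ := if a % 2 = 0 then 1 else -1

lemma eps_ne (a : ℤ) : eps a ≠ 0 := by unfold eps; split_ifs <;> norm_num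
lemma eps_add_one (a : ℤ) : eps (a + 1) = - eps a := by
  unfold eps; split_ifs <;> omega
lemma eps_nat (n : ℕ) : eps n = (-1) ^ n := by
  induction n with
  | zero => rfl
  | succ n ih => push_cast; rw [eps_add_one, ih]; ring
lemma eps_add (a b : ℤ) : eps (a + b) = eps a * eps b := by
  unfold eps; split_ifs <;> omega
lemma eps_neg (a : ℤ) : eps (-a) = eps a := by
  unfold eps; split_ifs <;> omega
lemma eps_congr (a b : ℤ) (h : (a - b) % 2 = 0) : eps a = eps b := by
  unfold eps; split_ifs <;> omega
lemma eps_anti (a b : ℤ) (h : (a - b) % 2 = 1) : eps a = - eps b := by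
  unfold eps; split_ifs <;> omega

lemma Adm.of1 {e w : ℤ → ℤ} (C : ℤ) (h : ∀ x, w x ≠ 0 → 0 ≤ e x ∧ |x| ≤ e x + C) : Adm e w := by
  refine ⟨fun i hi => (h i hi).1, fun n => ?_⟩
  apply (Set.finite_Icc (-(n+C)) (n+C)).subset
  rintro x ⟨hx, hn⟩
  have := (h x hx).2
  rw [Set.mem_Icc]; rw [← abs_le]; omega

lemma Adm.of2 {e w : ℤ × ℤ → ℤ} (C : ℤ)
    (h : ∀ x y, w (x, y) ≠ 0 → 0 ≤ e (x, y) ∧ |x| ≤ e (x, y) + C ∧ |y| ≤ e (x, y) + C) : Adm e w := by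
  refine ⟨fun i hi => (h i.1 i.2 hi).1, fun n => ?_⟩
  apply ((Set.finite_Icc (-(n+C)) (n+C)).prod (Set.finite_Icc (-(n+C)) (n+C))).subset
  rintro ⟨x, y⟩ ⟨hx, hn⟩
  have := (h x y hx).2
  rw [Set.mem_prod, Set.mem_Icc, Set.mem_Icc, ← abs_le, ← abs_le]
  constructor <;> simp only <;> omega

lemma Adm.of3 {e w : ℤ × ℤ × ℤ → ℤ} (C : ℤ)
    (h : ∀ x y z, w (x, y, z) ≠ 0 → 0 ≤ e (x, y, z) ∧ |x| ≤ e (x, y, z) + C ∧ |y| ≤ e (x, y, z) + C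
      ∧ |z| ≤ e (x, y, z) + C) : Adm e w := by
  refine ⟨fun i hi => (h i.1 i.2.1 i.2.2 hi).1, fun n => ?_⟩
  apply ((Set.finite_Icc (-(n+C)) (n+C)).prod ((Set.finite_Icc (-(n+C)) (n+C)).prod
    (Set.finite_Icc (-(n+C)) (n+C)))).subset
  rintro ⟨x, y, z⟩ ⟨hx, hn⟩
  have := (h x y z hx).2
  rw [Set.mem_prod, Set.mem_prod, Set.mem_Icc, Set.mem_Icc, Set.mem_Icc, ← abs_le, ← abs_le, ← abs_le]
  refine ⟨?_, ?_, ?_⟩ <;> simp only <;> omega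

lemma Adm.of2' {e w : ℤ × ℤ → ℤ} (C : ℤ)
    (h : ∀ x y, w (x, y) ≠ 0 → 0 ≤ e (x, y) ∧ |x| ≤ 8 * e (x, y) + C ∧ |y| ≤ 8 * e (x, y) + C) : Adm e w := by
  refine ⟨fun i hi => (h i.1 i.2 hi).1, fun n => ?_⟩
  apply ((Set.finite_Icc (-(8*n+C)) (8*n+C)).prod (Set.finite_Icc (-(8*n+C)) (8*n+C))).subset
  rintro ⟨x, y⟩ ⟨hx, hn⟩
  have := (h x y hx).2
  rw [Set.mem_prod, Set.mem_Icc, Set.mem_Icc, ← abs_le, ← abs_le]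
  constructor <;> simp only <;> omega

lemma Adm.of3' {e w : ℤ × ℤ × ℤ → ℤ} (C : ℤ)
    (h : ∀ x y z, w (x, y, z) ≠ 0 → 0 ≤ e (x, y, z) ∧ |x| ≤ 8 * e (x, y, z) + C ∧ |y| ≤ 8 * e (x, y, z) + C
      ∧ |z| ≤ 8 * e (x, y, z) + C) : Adm e w := by
  refine ⟨fun i hi => (h i.1 i.2.1 i.2.2 hi).1, fun n => ?_⟩
  apply ((Set.finite_Icc (-(8*n+C)) (8*n+C)).prod ((Set.finite_Icc (-(8*n+C)) (8*n+C)).prod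
    (Set.finite_Icc (-(8*n+C)) (8*n+C)))).subset
  rintro ⟨x, y, z⟩ ⟨hx, hn⟩
  have := (h x y z hx).2
  rw [Set.mem_prod, Set.mem_prod, Set.mem_Icc, Set.mem_Icc, Set.mem_Icc, ← abs_le, ← abs_le, ← abs_le]
  refine ⟨?_, ?_, ?_⟩ <;> simp only <;> omega

lemma Adm.mono {ι : Type*} {e w w' : ι → ℤ} (h : Adm e w) (hw : ∀ i, w' i ≠ 0 → w i ≠ 0) : Adm e w' :=
  ⟨fun i hi => h.nonneg i (hw i hi), fun n => (h.fin n).subset (fun i hi => ⟨hw i hi.1, hi.2⟩)⟩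

lemma Adm.add {ι : Type*} {e w w' : ι → ℤ} (h : Adm e w) (h' : Adm e w') : Adm e (fun i => w i + w' i) :=
  (h.gs.add h'.gs).adm

lemma Adm.congr {ι : Type*} {e w e' w' : ι → ℤ} (h : Adm e w)
    (hw : ∀ i, w' i = w i) (he : ∀ i, w i ≠ 0 → e' i = e i) : Adm e' w' := (h.gs.congr hw he).adm

lemma sign_cases (x : ℤ) : (x.sign = 1 ∧ 0 < x) ∨ (x.sign = 0 ∧ x = 0) ∨ (x.sign = -1 ∧ x < 0) := by
  rcases lt_trichotomy x 0 with h | h | h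
  · right; right; exact ⟨Int.sign_eq_neg_one_of_neg h, h⟩
  · right; left; subst h; exact ⟨rfl, rfl⟩
  · left; exact ⟨Int.sign_eq_one_of_pos h, h⟩

/-- triangular exponents -/
def tri (a : ℤ) : ℤ := a * (a + 1) / 2
lemma two_tri (a : ℤ) : 2 * tri a = a * (a + 1) := by
  unfold tri
  have : (2 : ℤ) ∣ a * (a + 1) := (Int.even_mul_succ_self a).two_dvd
  omega
lemma tri_add (a b : ℤ) : tri (a + b) = tri a + tri b + a * b := by
  have h1 := two_tri a; have h2 := two_tri b; have h3 := two_tri (a + b)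
  nlinarith
lemma tri_neg (a : ℤ) : tri (-1 - a) = tri a := by
  have h1 := two_tri a; have h3 := two_tri (-1 - a)
  nlinarith

lemma card_eq_cnt (p : ℤ → Prop) (n : ℕ) :
    Nat.card {P : n.Partition // NoRepeatedOddParts P ∧ p (m2Rank P)} = cnt p n := by
  unfold cnt
  rw [← Nat.card_eq_finsetCard]
  refine Nat.card_congr ?_
  refine Equiv.ofBijective (fun P => ⟨P.1.parts, ?_⟩) ⟨?_, ?_⟩
  · refine Finset.mem_filter.2 ⟨(mem_All _ _).2 ⟨⟨fun h => ?_, P.2.1⟩, P.1.parts_sum⟩, P.2.2⟩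
    exact absurd (P.1.parts_pos h) (lt_irrefl _)
  · intro P Q h
    apply Subtype.ext
    apply Nat.Partition.ext
    simpa using h
  · rintro ⟨s, hs⟩
    obtain ⟨hs, h3⟩ := Finset.mem_filter.1 hs
    obtain ⟨⟨h0, h1⟩, h2⟩ := (mem_All _ _).1 hs
    exact ⟨⟨⟨s, fun {i} hi => Nat.pos_of_ne_zero (fun h => h0 (h ▸ hi)), h2⟩, h1, h3⟩, rfl⟩

lemma N2_eq_cnt (r : ℤ) (n : ℕ) : N2 r 4 n = cnt (fun x => x ≡ r [ZMOD 4]) n :=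
  card_eq_cnt (fun x => x ≡ r [ZMOD 4]) n

lemma coeff_FF (n : ℕ) : PowerSeries.coeff n FF = (N2 0 4 n : ℤ) - N2 2 4 n := by
  rw [N2_eq_cnt, N2_eq_cnt, FF, map_sub, gf, gf, coeff_mk, coeff_mk]

lemma gs_nat_pos {e w : ℤ → ℤ} {f : PowerSeries ℤ} (h : GS (fun n : ℕ => e (n + 1)) (fun n : ℕ => w (n + 1)) f)
    (hw : ∀ x, w x ≠ 0 → 1 ≤ x) : GS e w f := by
  refine GS.ext (fun n : ℕ => (n : ℤ) + 1) (fun a b hab => by simpa using hab) h ?_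
  intro x hx
  refine ⟨(x - 1).toNat, ?_⟩
  have := hw x hx
  simp only; omega

lemma gs_nat_neg {e w : ℤ → ℤ} {f : PowerSeries ℤ} (h : GS (fun n : ℕ => e (-(n + 1))) (fun n : ℕ => w (-(n + 1))) f)
    (hw : ∀ x, w x ≠ 0 → x ≤ -1) : GS e w f := by
  refine GS.ext (fun n : ℕ => -((n : ℤ) + 1)) (fun a b hab => by simpa using hab) h ?_
  intro x hx
  refine ⟨(-x - 1).toNat, ?_⟩
  have := hw x hx
  simp only; omega

lemma gs_single {ι : Type*} (e w : ι → ℤ) (i : ι) (he : 0 ≤ e i) (hw : ∀ j, w j ≠ 0 → j = i) :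
    GS e w (mz (e i) (w i)) := by
  refine ⟨⟨fun j hj => (hw j hj) ▸ he, fun n => (Set.finite_singleton i).subset (fun j hj => hw j hj.1)⟩, ?_⟩
  apply hasSum_single
  intro j hj
  have : w j = 0 := by by_contra h; exact hj (hw j h)
  rw [this, mz_zero]

lemma gs_psim : GS (fun a : ℤ => 2 * a ^ 2 + a) (fun a => eps a) psim := by
  have h1 : GS (fun a : ℤ => 2 * a ^ 2 + a) (fun a => if 1 ≤ a then eps a else 0) (-sS 1) := by
    apply gs_nat_pos
    · apply (gs_sS 1).neg.congr
      · intro n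
        rw [if_pos (by omega), eps_add_one, eps_nat]
      · intro n _
        simp only [se]; push_cast; ring
    · intro x hx; by_contra h; exact hx (if_neg (by omega))
  have h2 : GS (fun a : ℤ => 2 * a ^ 2 + a) (fun a => if a ≤ -1 then eps a else 0) (-sS 0) := by
    apply gs_nat_neg
    · apply (gs_sS 0).neg.congr
      · intro n
        rw [if_pos (by omega), eps_neg, eps_add_one, eps_nat]
      · intro n _
        simp only [se]; push_cast; ring
    · intro x hx; by_contra h; exact hx (if_neg (by omega))
  have h3 := gs_single (fun a : ℤ => 2 * a ^ 2 + a) (fun a => if a = 0 then eps a else 0) 0 (by norm_num)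
    (by intro j hj; by_contra h; exact hj (if_neg h))
  have h4 := (h1.add h2).add h3
  have : psim = -sS 1 + -sS 0 + mz (2 * 0 ^ 2 + 0) (if (0:ℤ) = 0 then eps 0 else 0) := by
    rw [if_pos rfl, show eps 0 = 1 from rfl, mz_nat 0 _ (by norm_num), psim]; ring
  rw [this]
  refine h4.congr (fun a => ?_) (fun a _ => rfl)
  split_ifs <;> omega

/-- first indefinite series -/
def nnw (x : ℤ × ℤ) : ℤ := if x.2 = 0 then 0 else (Int.sign (4 * x.1 + 1) + Int.sign x.2) * eps (x.2 + x.1)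
def nne (x : ℤ × ℤ) : ℤ := 2 * x.2 ^ 2 + x.2 + 4 * x.2 * x.1

lemma nn_adm : Adm nne nnw := by
  apply Adm.of2 1
  intro m n h
  unfold nnw at h
  simp only [nne] at *
  have hc : (0 ≤ m ∧ 1 ≤ n) ∨ (m ≤ -1 ∧ n ≤ -1) := by
    by_cases hn : n = 0
    · rw [if_pos hn] at h; exact absurd rfl h
    rw [if_neg hn] at h
    have h2 := left_ne_zero_of_mul h
    rcases sign_cases (4 * m + 1) with a | a | a <;> rcases sign_cases n with b | b | b <;>
      rw [a.1, b.1] at h2 <;> omega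
  rcases hc with ⟨h1, h2⟩ | ⟨h1, h2⟩
  · rw [abs_of_nonneg h1, abs_of_nonneg (by omega)]
    refine ⟨by nlinarith, by nlinarith, by nlinarith⟩
  · rw [abs_of_neg (by omega), abs_of_neg (by omega)]
    refine ⟨by nlinarith, by nlinarith, by nlinarith⟩

noncomputable def NN : PowerSeries ℤ := ∑' i, mz (nne i) (nnw i)
lemma gs_NN : GS nne nnw NN := nn_adm.gs

lemma NN_fib_pos (j : ℕ) : GS (fun n => nne ((j : ℤ), n)) (fun n => nnw ((j : ℤ), n))
    (((2 * (-1) ^ (j + 1) : ℤ) : PowerSeries ℤ) * sS (2 * j + 1)) := by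
  apply gs_nat_pos
  · apply ((gs_sS (2 * j + 1)).smul (2 * (-1) ^ (j + 1))).congr
    · intro n
      unfold nnw
      simp only
      rw [if_neg (by omega), Int.sign_eq_one_of_pos (by omega), Int.sign_eq_one_of_pos (by omega), eps_add,
        eps_add_one, eps_nat, eps_nat]
      ring
    · intro n _
      simp only [se, nne]; push_cast; ring
  · intro x hx
    unfold nnw at hx
    simp only at hx
    by_contra h
    by_cases hn : x = 0
    · rw [if_pos hn] at hx; exact hx rfl
    · rw [if_neg hn, Int.sign_eq_one_of_pos (by omega), Int.sign_eq_neg_one_of_neg (by omega)] at hx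
      norm_num at hx

lemma NN_fib_neg (j : ℕ) : GS (fun n => nne (-((j : ℤ) + 1), n)) (fun n => nnw (-((j : ℤ) + 1), n))
    (((2 * (-1) ^ (j + 1) : ℤ) : PowerSeries ℤ) * sS (2 * j + 2)) := by
  apply gs_nat_neg
  · apply ((gs_sS (2 * j + 2)).smul (2 * (-1) ^ (j + 1))).congr
    · intro n
      unfold nnw
      simp only
      rw [if_neg (by omega), Int.sign_eq_neg_one_of_neg (by omega), Int.sign_eq_neg_one_of_neg (by omega), eps_add,
        eps_neg, eps_neg, eps_add_one, eps_nat, eps_add_one, eps_nat]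
      ring
    · intro n _
      simp only [se, nne]; push_cast; ring
  · intro x hx
    unfold nnw at hx
    simp only at hx
    by_contra h
    by_cases hn : x = 0
    · rw [if_pos hn] at hx; exact hx rfl
    · rw [if_neg hn, Int.sign_eq_neg_one_of_neg (by omega), Int.sign_eq_one_of_pos (by omega)] at hx
      norm_num at hx

noncomputable def NNf (m : ℤ) : PowerSeries ℤ := ∑' n, mz (nne (m, n)) (nnw (m, n))

lemma adm_fib (m : ℤ) : Adm (fun n => nne (m, n)) (fun n => nnw (m, n)) := by
  rcases lt_or_ge m 0 with h | h
  · have := NN_fib_neg (-m-1).toNat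
    rw [show -(((-m-1).toNat : ℤ) + 1) = m by omega] at this
    exact this.adm
  · have := NN_fib_pos m.toNat
    rw [show ((m.toNat : ℤ)) = m by omega] at this
    exact this.adm

lemma NNf_pos (j : ℕ) : NNf j = ((2 * (-1) ^ (j + 1) : ℤ) : PowerSeries ℤ) * sS (2 * j + 1) :=
  (adm_fib j).gs.unique (NN_fib_pos j)
lemma NNf_neg (j : ℕ) : NNf (-((j : ℤ) + 1)) = ((2 * (-1) ^ (j + 1) : ℤ) : PowerSeries ℤ) * sS (2 * j + 2) :=
  (adm_fib _).gs.unique (NN_fib_neg j)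

lemma NN_eq : NN = psim * FF - 1 := by
  have h0 : HasSum NNf NN := gs_NN.fiber NNf (fun m => (adm_fib m).gs)
  have s1 : Summable (fun j : ℕ => NNf j) := by
    have a : Adm (fun x : ℕ × ℤ => nne ((x.1 : ℤ), x.2)) (fun x => nnw ((x.1 : ℤ), x.2)) :=
      ⟨fun i hi => nn_adm.nonneg _ hi, fun n => (nn_adm.fin n).preimage
        (f := fun x : ℕ × ℤ => ((x.1 : ℤ), x.2)) (by
          rintro ⟨a, b⟩ _ ⟨c, d⟩ _ h; simpa using h)⟩
    exact (a.gs.fiber (fun j => NNf j) (fun m => (adm_fib m).gs)).summable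
  have s2 : Summable (fun j : ℕ => NNf (-((j : ℤ) + 1))) := by
    have a : Adm (fun x : ℕ × ℤ => nne (-((x.1 : ℤ) + 1), x.2)) (fun x => nnw (-((x.1 : ℤ) + 1), x.2)) :=
      ⟨fun i hi => nn_adm.nonneg _ hi, fun n => (nn_adm.fin n).preimage
        (f := fun x : ℕ × ℤ => (-((x.1 : ℤ) + 1), x.2)) (by
          rintro ⟨a, b⟩ _ ⟨c, d⟩ _ h; simpa using h)⟩
    exact (a.gs.fiber (fun j : ℕ => NNf (-((j : ℤ) + 1))) (fun m => (adm_fib (-((m : ℤ) + 1))).gs)).summable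
  have h1 := HasSum.of_nat_of_neg_add_one (f := NNf) s1.hasSum s2.hasSum
  have e1 := h0.unique h1
  -- shift the first
  have s3 : Summable (fun j : ℕ => NNf ((j + 1 : ℕ) : ℤ)) :=
    (summable_nat_add_iff (f := fun j : ℕ => NNf j) 1).2 s1
  have h3 := HasSum.zero_add (f := fun j : ℕ => NNf j) s3.hasSum
  have e2 := s1.hasSum.unique h3
  have h4 := HasSum.add (f := fun j : ℕ => NNf ((j + 1 : ℕ) : ℤ)) (g := fun j : ℕ => NNf (-((j : ℤ) + 1)))
    s3.hasSum s2.hasSum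
  have h5 : HasSum (fun j : ℕ => NNf ((j + 1 : ℕ) : ℤ) + NNf (-((j : ℤ) + 1))) (psim * FF - 1 + 2 * sS 1) := by
    apply hs_congr FF_hasSum2 _ rfl
    intro j
    rw [NNf_pos, NNf_neg]
    push_cast
    rw [show 2 * (j + 1) + 1 = 2 * j + 3 by ring]
    ring
  have e3 := h4.unique h5
  have e4 : NNf ((0 : ℕ) : ℤ) = - 2 * sS 1 := by rw [NNf_pos]; push_cast; ring
  rw [e1, e2]
  rw [e4]
  linear_combination e3

lemma GS.split {ι : Type*} {e w : ι → ℤ} {f : PowerSeries ℤ} (h : GS e w f) (p : ι → Prop) :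
    ∃ g1 g2, f = g1 + g2 ∧ GS e (fun i => if p i then w i else 0) g1 ∧ GS e (fun i => if p i then 0 else w i) g2 := by
  have a1 : Adm e (fun i => if p i then w i else 0) :=
    h.adm.mono (fun i hi h0 => hi (by simp [h0]))
  have a2 : Adm e (fun i => if p i then 0 else w i) :=
    h.adm.mono (fun i hi h0 => hi (by simp [h0]))
  refine ⟨_, _, ?_, a1.gs, a2.gs⟩
  apply h.unique
  refine (a1.gs.add a2.gs).congr (fun i => ?_) (fun i _ => rfl)
  split_ifs <;> simp

lemma int_ne_ps (c : ℤ) (hc : c ≠ 0) : (c : PowerSeries ℤ) ≠ 0 := by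
  intro h
  have := congrArg (PowerSeries.constantCoeff (R := ℤ)) h
  simp at this
  exact hc this
lemma two_ne_ps : (2 : PowerSeries ℤ) ≠ 0 := by
  have := int_ne_ps 2 (by norm_num)
  exact_mod_cast this

lemma adm_T4 : Adm (fun b : ℤ => 2 * b ^ 2 + 2 * b) (fun _ => 1) := by
  apply Adm.of1 1
  intro x _
  have : 0 ≤ 2 * x ^ 2 + 2 * x := by
    rcases le_or_gt 0 x with h | h <;> nlinarith
  refine ⟨this, ?_⟩
  rw [abs_le]
  constructor <;> nlinarith

noncomputable def T4 : PowerSeries ℤ := ∑' b : ℤ, mz (2 * b ^ 2 + 2 * b) 1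
lemma gs_T4 : GS (fun b : ℤ => 2 * b ^ 2 + 2 * b) (fun _ => 1) T4 := adm_T4.gs

def l2e (x : ℤ × ℤ) : ℤ := 2 * x.1 ^ 2 + 2 * x.1 + (4 * x.1 + 1) * x.2
def l2w (x : ℤ × ℤ) : ℤ := Int.sign (4 * x.1 + 1) + Int.sign (4 * x.2 + 1)

lemma l2_adm : Adm l2e l2w := by
  apply Adm.of2 1
  intro r m h
  simp only [l2w, l2e] at *
  have hc : (0 ≤ r ∧ 0 ≤ m) ∨ (r ≤ -1 ∧ m ≤ -1) := by
    rcases sign_cases (4 * r + 1) with a | a | a <;> rcases sign_cases (4 * m + 1) with b | b | b <;>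
      rw [a.1, b.1] at h <;> omega
  rcases hc with ⟨h1, h2⟩ | ⟨h1, h2⟩
  · rw [abs_of_nonneg h1, abs_of_nonneg (by omega)]
    refine ⟨by positivity, by nlinarith, by nlinarith⟩
  · rw [abs_of_neg (by omega), abs_of_neg (by omega)]
    refine ⟨by nlinarith, by nlinarith, by nlinarith⟩

noncomputable def L2 : PowerSeries ℤ := ∑' i, mz (l2e i) (l2w i)
lemma gs_L2 : GS l2e l2w L2 := l2_adm.gs

def eqJ1 : ℤ × ℤ × ℤ ≃ (ℤ × ℤ) × ℤ where
  toFun x := ((x.1, x.2.2), x.2.1 + x.2.2)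
  invFun y := (y.1.1, y.2 - y.1.2, y.1.2)
  left_inv x := by ext <;> simp
  right_inv x := by ext <;> simp

def eqJ2 : ℤ × ℤ × ℤ ≃ ℤ × ℤ × ℤ where
  toFun x := (x.1 + x.2.2, x.2.2, x.2.1)
  invFun y := (y.1 - y.2.1, y.2.2, y.2.1)
  left_inv x := by ext <;> simp
  right_inv x := by ext <;> simp

def eqJ3 : ℤ × ℤ × ℤ ≃ ℤ × ℤ × ℤ where
  toFun x := (x.1, x.2.1, - 1 - 2 * x.1 - 2 * x.2.1 - x.2.2)
  invFun x := (x.1, x.2.1, - 1 - 2 * x.1 - 2 * x.2.1 - x.2.2)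
  left_inv x := by ext <;> simp
  right_inv x := by ext <;> simp

def je (x : ℤ × ℤ × ℤ) : ℤ := 2 * x.1 ^ 2 + 2 * x.1 + (4 * x.1 + 1) * x.2.2 + 2 * (x.2.1 + x.2.2) ^ 2 + (x.2.1 + x.2.2)

def eqS : ℤ × ℤ ≃ ℤ × ℤ where
  toFun x := (x.1, x.2 + 1)
  invFun x := (x.1, x.2 - 1)
  left_inv x := by ext <;> simp
  right_inv x := by ext <;> simp

def eqR : ℤ ≃ ℤ where
  toFun x := -1 - x
  invFun x := -1 - x
  left_inv x := by simp
  right_inv x := by simp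

lemma sign1 (x : ℤ) : Int.sign (4 * x + 1) = if 0 ≤ x then 1 else -1 := by
  split_ifs with h
  · exact Int.sign_eq_one_of_pos (by omega)
  · exact Int.sign_eq_neg_one_of_neg (by omega)

lemma diag_sum {g : PowerSeries ℤ} (h : GS (fun x : ℤ × ℤ => 2 * x.1 ^ 2 + 2 * x.1)
    (fun x => eps x.2 * (Int.sign (4 * (x.1 - x.2) + 1) + Int.sign (4 * x.2 + 1))) g) : g = T4 := by
  have h1 := h.add (h.equiv eqS)
  have e1 : GS (fun x : ℤ × ℤ => 2 * x.1 ^ 2 + 2 * x.1) (fun x => if x.2 = -1 then 2 else 0) (2 * T4) := by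
    apply GS.ext (fun b : ℤ => (b, (-1 : ℤ))) (fun a b h => by simpa using h)
    · have := gs_T4.smul 2
      refine GS.congr (by simpa using this) (fun i => ?_) (fun i _ => rfl)
      simp
    · rintro ⟨b, m⟩ hm
      refine ⟨b, ?_⟩
      by_contra hh
      apply hm
      rw [if_neg]
      intro h2; apply hh; simp at h2; simp [h2]
  have a2 : Adm (fun b : ℤ => 2 * b ^ 2 + 2 * b) (fun b => 2 * eps b) := adm_T4.mono (by simp)
  have z2 := a2.gs.eq_zero eqR (by
      intro i; simp only [eqR, Equiv.coe_fn_mk]; rw [eps_anti (-1 - i) i (by omega)]; ring) (by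
      intro i; simp only [eqR, Equiv.coe_fn_mk]; ring)
  have g2 := a2.gs
  rw [z2] at g2
  have e2 : GS (fun x : ℤ × ℤ => 2 * x.1 ^ 2 + 2 * x.1) (fun x => if x.2 = x.1 then 2 * eps x.1 else 0) 0 := by
    apply GS.ext (fun b : ℤ => (b, b)) (fun a b h => by simpa using h)
    · simpa using g2
    · rintro ⟨b, m⟩ hm
      refine ⟨b, ?_⟩
      by_contra hh
      apply hm
      rw [if_neg]
      intro h2; apply hh; simp at h2; simp [h2]
  have e3 := (e1.add e2).congr (e' := fun x : ℤ × ℤ => 2 * x.1 ^ 2 + 2 * x.1)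
    (w' := fun x => eps x.2 * (Int.sign (4 * (x.1 - x.2) + 1) + Int.sign (4 * x.2 + 1)) +
      eps (eqS x).2 * (Int.sign (4 * ((eqS x).1 - (eqS x).2) + 1) + Int.sign (4 * (eqS x).2 + 1))) (by
      rintro ⟨b, m⟩
      simp only [eqS, Equiv.coe_fn_mk]
      rw [eps_add_one, sign1, sign1, sign1, sign1]
      by_cases c1 : m = -1
      · subst c1
        have : eps (-1) = -1 := rfl
        rw [this]
        by_cases c2 : -1 = b
        · subst c2; rw [this]; norm_num
        · rw [if_pos rfl, if_neg c2]
          split_ifs <;> first | omega | norm_num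
      · by_cases c2 : m = b
        · subst c2
          rw [if_neg c1, if_pos rfl]
          split_ifs <;> first | omega | ring
        · rw [if_neg c1, if_neg c2]
          split_ifs <;> first | omega | ring) (fun _ _ => rfl)
  have := h1.unique e3
  have h2 : (2 : PowerSeries ℤ) * g = 2 * T4 := by linear_combination this
  exact mul_left_cancel₀ two_ne_ps h2

lemma stepB0 : L2 * psim - T4 * NN = T4 := by
  have h1 : GS je (fun x => (Int.sign (4 * x.1 + 1) + Int.sign (4 * x.2.2 + 1)) * eps (x.2.1 + x.2.2)) (L2 * psim) := by
    refine ((gs_L2.mul gs_psim).equiv eqJ1).congr (fun x => ?_) (fun x _ => ?_)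
    · simp only [l2w, eqJ1, Equiv.coe_fn_mk]
    · simp only [l2e, eqJ1, Equiv.coe_fn_mk, je]; ring
  have h2 : GS je (fun x => nnw (x.2.2, x.2.1)) (T4 * NN) := by
    refine ((gs_T4.mul gs_NN).equiv eqJ2).congr (fun x => ?_) (fun x _ => ?_)
    · simp only [eqJ2, Equiv.coe_fn_mk, one_mul]
    · simp only [nne, eqJ2, Equiv.coe_fn_mk, je]; ring
  obtain ⟨g1, g2, hg, k1, k2⟩ := (h1.sub h2).split (fun x => x.2.1 = 0)
  have z2 : g2 = 0 := by
    apply k2.eq_zero eqJ3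
    · rintro ⟨r, n, m⟩
      simp only [eqJ3, Equiv.coe_fn_mk, nnw]
      by_cases hn : n = 0
      · simp [hn]
      · simp only [hn, if_false]
        rw [eps_anti (n + (-1 - 2 * r - 2 * n - m)) (n + m) (by omega)]
        ring
    · rintro ⟨r, n, m⟩
      simp only [eqJ3, Equiv.coe_fn_mk, je]
      ring
  have z1 : g1 = T4 := by
    apply diag_sum
    have := k1.inj (fun x : ℤ × ℤ => (x.1 - x.2, (0 : ℤ), x.2)) (by
      rintro ⟨a, b⟩ ⟨c, d⟩ h
      simp only [Prod.mk.injEq, true_and] at h ⊢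
      omega) (by
      rintro ⟨r, n, m⟩ h
      refine ⟨(r + m, m), ?_⟩
      by_contra hh
      apply h
      simp only at hh ⊢
      rw [if_neg]
      intro h2
      apply hh
      simp [h2])
    refine this.congr (fun x => ?_) (fun x _ => ?_)
    · simp only [nnw, if_true, zero_add]; ring
    · simp only [je]; ring
  rw [hg, z1, z2, add_zero]

lemma stepB : T4 * FF = L2 := by
  have h := stepB0
  rw [NN_eq] at h
  have hz : psim ≠ 0 := by
    intro h0
    have := PP_psim
    rw [h0, mul_zero] at this
    exact zero_ne_one this
  apply mul_left_cancel₀ hz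
  linear_combination -h

lemma Adm.gs_of_coeff {ι : Type*} {e w : ι → ℤ} {f : PowerSeries ℤ} (h : Adm e w)
    (hc : ∀ n : ℕ, HasSum (fun i => if e i = n then w i else 0) (PowerSeries.coeff n f)) : GS e w f := by
  have : f = ∑' i, mz (e i) (w i) := by
    ext n
    exact (hc n).unique (h.gs.coeff n)
  rw [this]; exact h.gs

noncomputable def sec (s : ℕ) (f : PowerSeries ℤ) : PowerSeries ℤ := PowerSeries.mk (fun K => PowerSeries.coeff (4 * K + s) f)

lemma coeff_sec (s K : ℕ) (f : PowerSeries ℤ) : PowerSeries.coeff K (sec s f) = PowerSeries.coeff (4 * K + s) f := by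
  simp [sec]

lemma GS.sec {ι : Type*} {e w : ι → ℤ} {f : PowerSeries ℤ} (h : GS e w f) (s : ℕ) (hs : s < 4) :
    GS (fun i => (e i - s) / 4) (fun i => if e i % 4 = s then w i else 0) (sec s f) := by
  have a : Adm (fun i => (e i - s) / 4) (fun i => if e i % 4 = s then w i else 0) := by
    refine ⟨fun i hi => ?_, fun n => ?_⟩
    · by_cases c : e i % 4 = s
      · rw [if_pos c] at hi
        have := h.adm.nonneg i hi
        omega
      · rw [if_neg c] at hi; exact absurd rfl hi
    · apply (h.adm.fin (4 * n + s)).subset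
      rintro i ⟨hi, hn⟩
      by_cases c : e i % 4 = s
      · rw [if_pos c] at hi
        exact ⟨hi, by omega⟩
      · rw [if_neg c] at hi; exact absurd rfl hi
  apply a.gs_of_coeff
  intro n
  rw [coeff_sec]
  have := h.coeff (4 * n + s)
  have key : (fun i => if (e i - s) / 4 = n then if e i % 4 = s then w i else 0 else 0) =
      fun i => if e i = ((4 * n + s : ℕ) : ℤ) then w i else 0 := by
    funext i
    push_cast
    by_cases c : e i = 4 * n + s
    · rw [if_pos c, if_pos (by omega), if_pos (by omega)]
    · rw [if_neg c]
      split_ifs <;> first | omega | rfl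
  rw [key]; exact this

lemma sec_shift (s t : ℕ) (hs : s < 4) (f : PowerSeries ℤ) : sec s (X ^ (4 * t) * f) = X ^ t * sec s f := by
  ext K
  rw [coeff_sec, PowerSeries.coeff_X_pow_mul', PowerSeries.coeff_X_pow_mul']
  by_cases h : t ≤ K
  · rw [if_pos h, if_pos (by omega), coeff_sec]
    congr 2
    omega
  · by_cases h2 : 4 * t ≤ 4 * K + s
    · omega
    · rw [if_neg h, if_neg h2]

lemma sec_hasSum {ι : Type*} {F : ι → PowerSeries ℤ} {f : PowerSeries ℤ} (h : HasSum F f) (s : ℕ) :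
    HasSum (fun i => sec s (F i)) (sec s f) := by
  rw [PowerSeries.WithPiTopology.hasSum_iff_hasSum_coeff ℤ] at h ⊢
  intro n
  simp only [coeff_sec]
  exact h (4 * n + s)

lemma adm_T1 : Adm tri (fun _ => 1) := by
  apply Adm.of1 1
  intro x _
  have h2 := two_tri x
  have : 0 ≤ x ^ 2 + x := by
    rcases le_or_gt 0 x with h | h <;> nlinarith
  refine ⟨by nlinarith, ?_⟩
  rw [abs_le]
  have h3 : 0 ≤ x ^ 2 - x := by
    rcases le_or_gt 1 x with h | h <;> nlinarith
  have h4 : 0 ≤ x ^ 2 + 3 * x + 2 := by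
    rcases le_or_gt (-1) x with h | h <;> nlinarith
  constructor <;> nlinarith

noncomputable def T1s : PowerSeries ℤ := ∑' b : ℤ, mz (tri b) 1
lemma gs_T1 : GS tri (fun _ => 1) T1s := adm_T1.gs

lemma mz_mul_one (e : ℤ) (he : 0 ≤ e) : mz e 1 = X ^ e.toNat := mz_nat _ _ (by omega)

lemma sec_T4_mul (s : ℕ) (hs : s < 4) (f : PowerSeries ℤ) : sec s (T4 * f) = T1s * sec s f := by
  have h1 := sec_hasSum (gs_T4.hs.mul_right f) s
  have h2 := gs_T1.hs.mul_right (sec s f)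
  refine h1.unique (hs_congr h2 (fun b => ?_) rfl)
  have h0 := gs_T1.adm.nonneg b one_ne_zero
  have := two_tri b
  rw [show 2 * b ^ 2 + 2 * b = 4 * tri b by linarith, mz_mul_one _ (by omega), mz_mul_one _ h0,
    show (4 * tri b).toNat = 4 * (tri b).toNat by omega]
  apply sec_shift _ _ hs

def lse (s : ℕ) (x : ℤ × ℤ) : ℤ := tri x.1 + (4 * x.1 + 1) * x.2 + x.1 * s
def lsw (s : ℕ) (x : ℤ × ℤ) : ℤ := Int.sign (4 * x.1 + 1) + Int.sign (16 * x.2 + 4 * s + 1)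

lemma l2e_eq (s : ℕ) (r m : ℤ) : l2e (r, 4 * m + s) = 4 * lse s (r, m) + s := by
  simp only [l2e, lse]
  have := two_tri r
  linarith

lemma gs_L2s (s : ℕ) (hs : s < 4) : GS (lse s) (lsw s) (T1s * sec s FF) := by
  rw [← sec_T4_mul s hs, stepB]
  have := (gs_L2.sec s hs).inj (fun x : ℤ × ℤ => (x.1, 4 * x.2 + s)) (by
    rintro ⟨a, b⟩ ⟨c, d⟩ h
    simp only [Prod.mk.injEq] at h ⊢
    omega) (by
    rintro ⟨r, m⟩ h
    refine ⟨(r, m / 4), ?_⟩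
    have c : l2e (r, m) % 4 = s := by
      by_contra c; rw [if_neg c] at h; exact h rfl
    have h2 := two_tri r
    have h3 : l2e (r, m) = 4 * (tri r + r * m) + m := by simp only [l2e]; linarith
    simp only [Prod.mk.injEq, true_and]
    omega)
  refine this.congr ?_ ?_
  · rintro ⟨r, m⟩
    simp only
    rw [l2e_eq, if_pos (by omega)]
    simp only [l2w, lsw]
    congr 2
    ring
  · rintro ⟨r, m⟩ _
    simp only
    rw [l2e_eq]
    omega

abbrev Z16 := ZMod 16

def DD (p r t : ℤ) : ℤ := p ^ 2 + r ^ 2 + t ^ 2 - 2 * p * r - 2 * p * t - 2 * r * t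
def ge (x : ℤ × ℤ × ℤ) : ℤ := (DD x.1 x.2.1 x.2.2 - 5) / 8
def Ww (y : Z16 → Z16 → Z16 → ℤ) (x : ℤ × ℤ × ℤ) : ℤ :=
  (Int.sign x.1 - Int.sign x.2.1) * y x.1 x.2.1 x.2.2

/-- odd classes modulo 16 -/
def od (v : Z16) : Prop := v.val % 2 = 1
instance (v : Z16) : Decidable (od v) := by unfold od; infer_instance

lemma od_cast (p : ℤ) : od (p : Z16) ↔ p % 2 = 1 := by
  unfold od
  have h : ((p : Z16).val : ℤ) = p % 16 := by
    have := ZMod.val_intCast (n := 16) p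
    simpa using this
  omega

def OS (y : Z16 → Z16 → Z16 → ℤ) : Prop := ∀ p r t, y p r t ≠ 0 → od p ∧ od r ∧ od t

lemma abs_le_mul (c v : ℤ) (hv : v ≠ 0) : |c| ≤ |c * v| := by
  rw [abs_mul]
  have : 1 ≤ |v| := Int.one_le_abs hv
  nlinarith [abs_nonneg c]

lemma W_adm (y : Z16 → Z16 → Z16 → ℤ) (hy : OS y) : Adm ge (Ww y) := by
  apply Adm.of3' 13
  intro p r t h
  have h1 := left_ne_zero_of_mul h
  have h2 := right_ne_zero_of_mul h
  simp only at h1 h2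
  obtain ⟨hp, hr, ht⟩ := hy _ _ _ h2
  rw [od_cast] at hp hr ht
  have hneg : p * r < 0 := by
    rcases sign_cases p with a | a | a <;> rcases sign_cases r with b | b | b <;>
      rw [a.1, b.1] at h1 <;> first | omega | nlinarith
  have hA : DD p r t = (t - p - r) ^ 2 + 4 * |p * r| := by
    rw [abs_of_neg hneg]; unfold DD; ring
  have b1 := abs_le_mul p r (by omega)
  have b2 := abs_le_mul r p (by omega)
  rw [mul_comm r p] at b2
  have hA0 : 1 ≤ |t - p - r| := Int.one_le_abs (by omega)
  have hq := sq_abs (t - p - r)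
  have tt : |t| ≤ |t - p - r| + |p| + |r| := by
    have e : t = (t - p - r) + p + r := by ring
    calc |t| = |(t - p - r) + p + r| := by rw [← e]
      _ ≤ |(t - p - r) + p| + |r| := abs_add_le _ _
      _ ≤ _ := by gcongr; exact abs_add_le _ _
  have h5 : 5 ≤ DD p r t := by
    have : 1 ≤ |p * r| := Int.one_le_abs (by omega)
    nlinarith
  simp only [ge]
  have hDp : |p| ≤ DD p r t := by nlinarith
  have hDr : |r| ≤ DD p r t := by nlinarith
  have hDt : |t| ≤ DD p r t := by nlinarith
  refine ⟨?_, ?_, ?_, ?_⟩ <;> omega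

def qE : ℤ × ℤ × ℤ ≃ ℤ × ℤ × ℤ where
  toFun x := (x.1, x.2.1, 2 * x.1 + 2 * x.2.1 - x.2.2)
  invFun x := (x.1, x.2.1, 2 * x.1 + 2 * x.2.1 - x.2.2)
  left_inv x := by ext <;> simp
  right_inv x := by ext <;> simp
def qS : ℤ × ℤ × ℤ ≃ ℤ × ℤ × ℤ where
  toFun x := (x.2.1, x.1, x.2.2)
  invFun x := (x.2.1, x.1, x.2.2)
  left_inv x := by ext <;> simp
  right_inv x := by ext <;> simp
def qN : ℤ × ℤ × ℤ ≃ ℤ × ℤ × ℤ where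
  toFun x := (-x.1, -x.2.1, -x.2.2)
  invFun x := (-x.1, -x.2.1, -x.2.2)
  left_inv x := by ext <;> simp
  right_inv x := by ext <;> simp
def qC : ℤ × ℤ × ℤ ≃ ℤ × ℤ × ℤ where
  toFun x := (x.2.1, x.2.2, x.1)
  invFun x := (x.2.2, x.1, x.2.1)
  left_inv x := by ext <;> simp
  right_inv x := by ext <;> simp

lemma W_eps {y : Z16 → Z16 → Z16 → ℤ} {f : PowerSeries ℤ} (h : GS ge (Ww y) f) :
    GS ge (Ww (fun p r t => y p r (2 * p + 2 * r - t))) f := by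
  refine (h.equiv qE).congr (fun x => ?_) (fun x _ => ?_)
  · simp only [Ww, qE, Equiv.coe_fn_mk]; push_cast; rfl
  · simp only [ge, qE, Equiv.coe_fn_mk, DD]; congr 1; ring

lemma W_swap {y : Z16 → Z16 → Z16 → ℤ} {f : PowerSeries ℤ} (h : GS ge (Ww y) f) :
    GS ge (Ww (fun p r t => - y r p t)) f := by
  refine (h.equiv qS).congr (fun x => ?_) (fun x _ => ?_)
  · simp only [Ww, qS, Equiv.coe_fn_mk]; ring
  · simp only [ge, qS, Equiv.coe_fn_mk, DD]; congr 1; ring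

lemma W_neg {y : Z16 → Z16 → Z16 → ℤ} {f : PowerSeries ℤ} (h : GS ge (Ww y) f) :
    GS ge (Ww (fun p r t => - y (-p) (-r) (-t))) f := by
  refine (h.equiv qN).congr (fun x => ?_) (fun x _ => ?_)
  · simp only [Ww, qN, Equiv.coe_fn_mk, Int.sign_neg]; push_cast; ring
  · simp only [ge, qN, Equiv.coe_fn_mk, DD]; congr 1; ring

lemma W_add {y z : Z16 → Z16 → Z16 → ℤ} {f g : PowerSeries ℤ} (h : GS ge (Ww y) f) (h' : GS ge (Ww z) g) :
    GS ge (Ww (fun p r t => y p r t + z p r t)) (f + g) := by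
  refine (h.add h').congr (fun x => ?_) (fun x _ => rfl)
  simp only [Ww]; ring

lemma W_smul {y : Z16 → Z16 → Z16 → ℤ} {f : PowerSeries ℤ} (c : ℤ) (h : GS ge (Ww y) f) :
    GS ge (Ww (fun p r t => c * y p r t)) (c * f) := by
  refine (h.smul c).congr (fun x => ?_) (fun x _ => rfl)
  simp only [Ww]; ring

lemma W_zero {y : Z16 → Z16 → Z16 → ℤ} {f : PowerSeries ℤ} (h : GS ge (Ww y) f) (hy : ∀ p r t, y p r t = 0) :
    f = 0 := by
  refine h.unique ((GS.zero ge).congr (fun x => ?_) (fun x _ => rfl))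
  simp only [Ww, hy, mul_zero]

lemma W_cyc (y : Z16 → Z16 → Z16 → ℤ) {f1 f2 f3 : PowerSeries ℤ}
    (h1 : GS ge (Ww y) f1) (h2 : GS ge (Ww (fun p r t => y t p r)) f2)
    (h3 : GS ge (Ww (fun p r t => y r t p)) f3) : f1 + f2 + f3 = 0 := by
  have k2 : GS ge (fun x => (Int.sign x.2.1 - Int.sign x.2.2) * y x.1 x.2.1 x.2.2) f2 := by
    refine (h2.equiv qC).congr (fun x => ?_) (fun x _ => ?_)
    · simp only [Ww, qC, Equiv.coe_fn_mk]
    · simp only [ge, qC, Equiv.coe_fn_mk, DD]; congr 1; ring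
  have k3 : GS ge (fun x => (Int.sign x.2.2 - Int.sign x.1) * y x.1 x.2.1 x.2.2) f3 := by
    refine (h3.equiv qC.symm).congr (fun x => ?_) (fun x _ => ?_)
    · simp only [Ww, qC, Equiv.coe_fn_symm_mk]
    · simp only [ge, qC, Equiv.coe_fn_symm_mk, DD]; congr 1; ring
  refine ((h1.add k2).add k3).unique ((GS.zero ge).congr (fun x => ?_) (fun x _ => rfl))
  simp only [Ww]; ring

/-- tables -/
def tb (l : List ℤ) (v : Z16) : ℤ := l.getD v.val 0
def chi4 (v : Z16) : ℤ := tb [0, 1, 0, -1, 0, 1, 0, -1, 0, 1, 0, -1, 0, 1, 0, -1] v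
def et1 (v : Z16) : ℤ := tb [0, 1, 0, 0, 0, 0, 0, -1, 0, -1, 0, 0, 0, 0, 0, 1] v
def et3 (v : Z16) : ℤ := tb [0, 0, 0, -1, 0, 1, 0, 0, 0, 0, 0, 1, 0, -1, 0, 0] v
def al (s : ℕ) : ℤ := [1, -1, -1, 1].getD s 0
def be (s : ℕ) : ℤ := [1, 1, -1, -1].getD s 0
def Dz (p r t : Z16) : Z16 := p * p + r * r + t * t - 2 * p * r - 2 * p * t - 2 * r * t
def bb (s : ℕ) (p r t : Z16) : ℤ :=
  if od p ∧ od r ∧ od t then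
    if Dz p r t = 13 then al s * (chi4 p * et1 r - chi4 r * et1 p)
    else if Dz p r t = 5 then be s * (chi4 p * et3 r - chi4 r * et3 p) else 0
  else 0

lemma bb_os (s : ℕ) : OS (bb s) := by
  intro p r t h
  by_contra hh
  exact h (if_neg hh)

set_option maxRecDepth 100000 in
lemma bb_id : ∀ s : Fin 4, ∀ p r t : Z16,
    (bb s t p r + bb s r t p) + (bb s (2 * p + 2 * r - t) p r + bb s r (2 * p + 2 * r - t) p) = 0 := by
  decide +kernel

lemma bb_zero (s : Fin 4) {f : PowerSeries ℤ} (h : GS ge (Ww (bb s)) f) : f = 0 := by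
  have o2 : OS (fun p r t => bb s t p r) := fun p r t h => by
    have := bb_os s _ _ _ h; tauto
  have o3 : OS (fun p r t => bb s r t p) := fun p r t h => by
    have := bb_os s _ _ _ h; tauto
  have g2 := (W_adm _ o2).gs
  have g3 := (W_adm _ o3).gs
  have e1 := W_cyc _ h g2 g3
  have g4 := W_add g2 g3
  have g5 := W_add g4 (W_eps g4)
  have e2 := W_zero g5 (fun p r t => bb_id s p r t)
  have e3 : (2 : PowerSeries ℤ) * f = 0 := by linear_combination 2 * e1 - e2
  exact (mul_eq_zero.1 e3).resolve_left two_ne_ps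

def ees (s : ℕ) (v : Z16) : ℤ := tb ([[0,0,0,1,0,0,0,1,0,-1,0,0,0,-1,0,0],[0,1,0,-1,0,0,0,0,0,0,0,0,0,1,0,-1],
  [0,1,0,0,0,1,0,0,0,0,0,-1,0,0,0,-1],[0,0,0,0,0,-1,0,1,0,-1,0,1,0,0,0,0]].getD s []) v
def sgo (s : ℕ) : ℤ := [-1, 1, 1, -1].getD s 0
/-- the weight of the Eisenstein part -/
def HH (s : ℕ) (p r : Z16) : ℤ := sgo s * (chi4 p * chi4 r) * ees s (-r)
def YY (s : ℕ) (p r t : Z16) : ℤ :=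
  if od p ∧ od r ∧ od t then
    (if 2 * (t - p - r) = r + 4 * s - 7 then -4 else 0) + HH s p r else 0
def YE (s : ℕ) (p r t : Z16) : ℤ := YY s p r t + YY s p r (2 * p + 2 * r - t)
def YS (s : ℕ) (p r t : Z16) : ℤ := YE s p r t + - YE s r p t

set_option maxRecDepth 100000 in
lemma YY_id : ∀ s : Fin 4, ∀ p r t : Z16,
    (YS s p r t + - YS s (-p) (-r) (-t)) + (-4) * bb s p r t = 0 := by
  decide +kernel

lemma YY_os (s : ℕ) : OS (YY s) := by
  intro p r t h
  by_contra hh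
  exact h (if_neg hh)

lemma YY_zero (s : Fin 4) {f : PowerSeries ℤ} (h : GS ge (Ww (YY s)) f) : f = 0 := by
  have h1 := W_add h (W_eps h)
  have h2 := W_add h1 (W_swap h1)
  have h3 := W_add h2 (W_neg h2)
  have h4 := (W_adm _ (bb_os s)).gs
  have e4 := bb_zero s h4
  rw [e4] at h4
  have h5 := W_add h3 (W_smul (-4) h4)
  have e5 := W_zero h5 (fun p r t => YY_id s p r t)
  have e6 : ((8 : ℤ) : PowerSeries ℤ) * f = 0 := by push_cast; linear_combination e5
  exact (mul_eq_zero.1 e6).resolve_left (int_ne_ps 8 (by norm_num))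

def the (s : ℕ) (b : ℤ) : ℤ := 8 * b ^ 2 + (4 * s - 7) * b
lemma adm_th (s : ℕ) (hs : s < 4) : Adm (the s) (fun _ => 1) := by
  apply Adm.of1 1
  intro x _
  unfold the
  have hs' : (s : ℤ) ≤ 3 := by omega
  have hs0 : (0 : ℤ) ≤ s := by omega
  rcases le_or_gt 1 x with h | h
  · have p1 : 0 ≤ (s : ℤ) * x := by positivity
    rw [abs_of_pos (by omega)]
    constructor <;> nlinarith
  · have p1 : 0 ≤ (3 - (s : ℤ)) * (- x) := mul_nonneg (by omega) (by omega)
    have p2 : 0 ≤ x ^ 2 + x := by rcases le_or_gt 0 x with h | h <;> nlinarith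
    rw [abs_of_nonpos (by omega)]
    constructor <;> nlinarith

noncomputable def TH (s : ℕ) : PowerSeries ℤ := ∑' b : ℤ, mz (the s b) 1
lemma gs_TH (s : ℕ) (hs : s < 4) : GS (the s) (fun _ => 1) (TH s) := (adm_th s hs).gs

def ape (s : ℕ) (x : ℤ × ℤ) : ℤ := 8 * x.2 ^ 2 + 16 * x.1 * x.2 + (4 * s - 7) * x.2 - 8 * x.1 - tri s
def apw (s : ℕ) (x : ℤ × ℤ) : ℤ := Int.sign (16 * x.1 + 4 * s + 1) + Int.sign (2 * x.2 - 1)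

lemma adm_ap (s : ℕ) (hs : s < 4) : Adm (ape s) (apw s) := by
  apply Adm.of2 10
  intro m k h
  simp only [ape, apw] at *
  have ht : tri s ≤ 4 * s ∧ tri s ≤ 6 := by interval_cases s <;> decide
  have hs' : (s : ℤ) ≤ 3 := by omega
  have hs0 : (0 : ℤ) ≤ s := by omega
  have hc : (0 ≤ m ∧ 1 ≤ k) ∨ (m ≤ -1 ∧ k ≤ 0) := by
    rcases sign_cases (16 * m + 4 * s + 1) with a | a | a <;> rcases sign_cases (2 * k - 1) with b | b | b <;>
      rw [a.1, b.1] at h <;> omega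
  rcases hc with ⟨h1, h2⟩ | ⟨h1, h2⟩
  · rw [abs_of_nonneg h1, abs_of_nonneg (by omega)]
    have e : 8 * k ^ 2 + 16 * m * k + (4 * s - 7) * k - 8 * m - tri s =
      8 * (k - 1) * k + k + 8 * m * (2 * k - 1) + 4 * s * (k - 1) + (4 * s - tri s) := by ring
    have p1 : 0 ≤ 8 * (k - 1) * k := by
      have : 0 ≤ k - 1 := by omega
      positivity
    have p2 : m ≤ 8 * m * (2 * k - 1) := by nlinarith
    have p3 : 0 ≤ 4 * s * (k - 1) := by
      have : 0 ≤ k - 1 := by omega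
      positivity
    rw [e]
    refine ⟨by linarith, by linarith, by linarith⟩
  · obtain ⟨k', rfl⟩ : ∃ k', k = -k' := ⟨-k, by ring⟩
    obtain ⟨m', rfl⟩ : ∃ m', m = -m' := ⟨-m, by ring⟩
    have h1' : 1 ≤ m' := by omega
    have h2' : 0 ≤ k' := by omega
    rw [abs_of_neg (by omega), abs_of_nonpos (by omega)]
    have e : 8 * (-k') ^ 2 + 16 * (-m') * (-k') + (4 * s - 7) * (-k') - 8 * (-m') - tri s =
      8 * k' ^ 2 + 16 * (m' - 1) * k' + (11 + 4 * (3 - s)) * k' + 8 * m' - tri s := by ring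
    have p1 : 0 ≤ 8 * k' ^ 2 := by positivity
    have p2 : 0 ≤ 16 * (m' - 1) * k' := by
      have : 0 ≤ m' - 1 := by omega
      positivity
    have p3 : k' ≤ (11 + 4 * (3 - s)) * k' := by nlinarith
    rw [e]
    refine ⟨by linarith, by linarith, by linarith⟩

noncomputable def AP (s : ℕ) : PowerSeries ℤ := ∑' x, mz (ape s x) (apw s x)
lemma gs_AP (s : ℕ) (hs : s < 4) : GS (ape s) (apw s) (AP s) := (adm_ap s hs).gs

def oo (s : ℕ) : ℤ := [3, 1, 1, 3].getD s 0
def uu (s : ℕ) : ℕ := [1, 0, 0, 1].getD s 0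
def eie (s : ℕ) (x : ℤ × ℤ) : ℤ := (- x.1 * x.2 - oo s) / 2
def eiw (s : ℕ) (x : ℤ × ℤ) : ℤ := (Int.sign x.1 - Int.sign x.2) * HH s x.1 x.2

lemma HH_od : ∀ s : Fin 4, ∀ p r : Z16, HH s p r ≠ 0 → od p ∧ od r := by decide +kernel
lemma HH_one : ∀ s : Fin 4, HH s 1 (-1) ≠ 0 → oo s = 1 := by decide +kernel
lemma HH_one' : ∀ s : Fin 4, HH s (-1) 1 ≠ 0 → oo s = 1 := by decide +kernel
lemma oo_uu : ∀ s : Fin 4, oo s = 2 * uu s + 1 ∧ uu s ≤ 1 := by decide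

lemma adm_ei (s : Fin 4) : Adm (eie s) (eiw s) := by
  apply Adm.of2' 10
  intro p r h
  have h1 := left_ne_zero_of_mul h
  have h2 := right_ne_zero_of_mul h
  simp only at h1 h2
  obtain ⟨hp, hr⟩ := HH_od s _ _ h2
  rw [od_cast] at hp hr
  have hneg : p * r < 0 := by
    rcases sign_cases p with a | a | a <;> rcases sign_cases r with b | b | b <;>
      rw [a.1, b.1] at h1 <;> first | omega | nlinarith
  have b1 := abs_le_mul p r (by omega)
  have b2 := abs_le_mul r p (by omega)
  rw [mul_comm r p] at b2
  rw [abs_of_neg hneg] at b1 b2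
  have ho : oo s ≤ 3 ∧ (oo s = 1 ∨ oo s = 3) := by fin_cases s <;> decide
  have hodd : (p * r) % 2 = 1 := by
    rw [Int.mul_emod, hp, hr]; rfl
  have key : oo s ≤ - (p * r) := by
    by_contra hc
    have h1 : p * r = -1 := by omega
    have h3 : oo s = 1 := by
      rcases Int.eq_one_or_neg_one_of_mul_eq_neg_one h1 with c | c
      · have : r = -1 := by subst c; omega
        subst c this
        exact HH_one s (by simpa using h2)
      · have : r = 1 := by subst c; omega
        subst c this
        exact HH_one' s (by simpa using h2)
    omega
  simp only [eie, neg_mul]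
  refine ⟨?_, ?_, ?_⟩ <;> omega

noncomputable def EI (s : ℕ) : PowerSeries ℤ := ∑' x, mz (eie s x) (eiw s x)
lemma gs_EI (s : Fin 4) : GS (eie s) (eiw s) (EI s) := (adm_ei s).gs

lemma T1_ne : T1s ≠ 0 := by
  intro h
  have h1 := gs_T1.coeff 0
  rw [h, map_zero] at h1
  have := le_hasSum h1 0 (fun j _ => by split_ifs <;> norm_num)
  simp [tri] at this

def k1 : ℤ × ℤ × ℤ ≃ (ℤ × ℤ) × ℤ where
  toFun x := ((x.1, x.2.2 - x.2.1), x.2.2)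
  invFun y := (y.1.1, y.2 - y.1.2, y.2)
  left_inv x := by ext <;> simp
  right_inv x := by ext <;> simp
def k2 (s : ℕ) : ℤ × ℤ × ℤ ≃ ℤ × ℤ × ℤ where
  toFun x := (x.1 + s + 4 * (x.2.2 - x.2.1), x.2.2 - x.2.1, x.2.1)
  invFun y := (y.1 - s - 4 * y.2.1, y.2.2, y.2.1 + y.2.2)
  left_inv x := by ext <;> simp <;> ring
  right_inv x := by ext <;> simp <;> ring

def de (s : ℕ) (x : ℤ × ℤ × ℤ) : ℤ := lse s (x.1, x.2.2 - x.2.1) + the s x.2.2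
def dw (x : ℤ × ℤ × ℤ) : ℤ := Int.sign (4 * x.1 + 1) - Int.sign (2 * x.2.1 - 1)

lemma gs_D3 (s : ℕ) (hs : s < 4) : GS (de s) dw (T1s * sec s FF * TH s - T1s * AP s) := by
  have h1 : GS (de s) (fun x => lsw s (x.1, x.2.2 - x.2.1)) (T1s * sec s FF * TH s) := by
    refine (((gs_L2s s hs).mul (gs_TH s hs)).equiv k1).congr (fun x => ?_) (fun x _ => ?_)
    · simp only [k1, Equiv.coe_fn_mk, mul_one]
    · simp only [k1, Equiv.coe_fn_mk, de]
  have h2 : GS (de s) (fun x => apw s (x.2.2 - x.2.1, x.2.1)) (T1s * AP s) := by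
    refine ((gs_T1.mul (gs_AP s hs)).equiv (k2 s)).congr (fun x => ?_) (fun x _ => ?_)
    · simp only [k2, Equiv.coe_fn_mk, one_mul]
    · obtain ⟨r, k, b⟩ := x
      simp only [k2, Equiv.coe_fn_mk, de, lse, the, ape]
      have e1 := two_tri r
      have e2 := two_tri s
      have e3 := two_tri (r + s + 4 * (b - k))
      have : 2 * (tri r + (4 * r + 1) * (b - k) + r * s + (8 * b ^ 2 + (4 * s - 7) * b)) =
        2 * (tri (r + s + 4 * (b - k)) + (8 * k ^ 2 + 16 * (b - k) * k + (4 * s - 7) * k - 8 * (b - k) - tri s)) := by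
        linear_combination e1 - e3 + e2
      omega
  refine (h1.sub h2).congr (fun x => ?_) (fun x _ => rfl)
  simp only [dw, lsw, apw]; ring

def YA (s : ℕ) (p r t : Z16) : ℤ :=
  if (od p ∧ od r ∧ od t) ∧ 2 * (t - p - r) = r + 4 * s - 7 then -4 else 0
def YB (s : ℕ) (p r t : Z16) : ℤ := if od p ∧ od r ∧ od t then HH s p r else 0

lemma uu_cast (s : Fin 4) : ∃ u : ℤ, (uu s : ℤ) = u ∧ oo s = 2 * u + 1 := ⟨_, rfl, (oo_uu s).1⟩

lemma gs_YA (s : Fin 4) {f : PowerSeries ℤ} (h : GS (de s) dw f) :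
    GS ge (Ww (YA s)) (X ^ uu s * (4 * f)) := by
  apply GS.ext (fun x : ℤ × ℤ × ℤ => (2 * x.2.1 - 1, 4 * x.1 + 1,
    (2 * x.2.1 - 1) + (4 * x.1 + 1) + (2 * (x.1 + s + 4 * x.2.2 - 2) + 1)))
  · rintro ⟨a, b, c⟩ ⟨d, e, f⟩ h
    simp only [Prod.mk.injEq] at h ⊢
    omega
  · have h2 := (h.smul 4).shift (uu s)
    push_cast at h2
    refine h2.congr ?_ ?_
    · rintro ⟨r, k, b⟩
      simp only [Ww, dw, YA]
      rw [if_pos]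
      · ring
      · refine ⟨⟨?_, ?_, ?_⟩, ?_⟩
        · rw [od_cast]; omega
        · rw [od_cast]; omega
        · rw [od_cast]; omega
        · have h16 : (16 : Z16) = 0 := by decide
          push_cast
          linear_combination (b : Z16) * h16
    · rintro ⟨r, k, b⟩ _
      obtain ⟨u, hu, ho⟩ := uu_cast s
      rw [hu]
      have hou : u = 1 ∧ ((s : ℕ) : ℤ) ^ 2 = 3 * s ∨ u = 0 ∧ ((s : ℕ) : ℤ) ^ 2 = 3 * s - 2 := by
        rw [← hu]; fin_cases s <;> decide
      simp only [ge, DD, de, lse, the]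
      have e1 := two_tri r
      have : (2 * k - 1) ^ 2 + (4 * r + 1) ^ 2 + (2 * k - 1 + (4 * r + 1) + (2 * (r + ((s : ℕ) : ℤ) + 4 * b - 2) + 1)) ^ 2
          - 2 * (2 * k - 1) * (4 * r + 1)
          - 2 * (2 * k - 1) * (2 * k - 1 + (4 * r + 1) + (2 * (r + ((s : ℕ) : ℤ) + 4 * b - 2) + 1))
          - 2 * (4 * r + 1) * (2 * k - 1 + (4 * r + 1) + (2 * (r + ((s : ℕ) : ℤ) + 4 * b - 2) + 1)) - 5
          = 8 * (tri r + (4 * r + 1) * (b - k) + r * ((s : ℕ) : ℤ) + (8 * b ^ 2 + (4 * ((s : ℕ) : ℤ) - 7) * b) + u) := by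
        rcases hou with ⟨h1, h2⟩ | ⟨h1, h2⟩
        · rw [h1]; linear_combination (-4) * e1 + 4 * h2
        · rw [h1]; linear_combination (-4) * e1 + 4 * h2
      rw [this]
      omega
  · rintro ⟨p, r, t⟩ hne
    have hy := right_ne_zero_of_mul hne
    simp only [YA] at hy
    have hc : (od (p : Z16) ∧ od (r : Z16) ∧ od (t : Z16)) ∧ 2 * ((t : Z16) - p - r) = r + 4 * ((s : ℕ) : Z16) - 7 := by
      by_contra hh; exact hy (if_neg hh)
    obtain ⟨⟨hp, hr, ht⟩, he⟩ := hc
    rw [od_cast] at hp hr ht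
    have he2 : ((2 * (t - p - r) - (r + 4 * ((s : ℕ) : ℤ) - 7) : ℤ) : Z16) = 0 := by
      push_cast; linear_combination he
    rw [ZMod.intCast_zmod_eq_zero_iff_dvd] at he2
    push_cast at he2
    refine ⟨((r - 1) / 4, (p + 1) / 2, (2 * (t - p - r) - (r + 4 * ((s : ℕ) : ℤ) - 7)) / 16), ?_⟩
    simp only [Prod.mk.injEq]
    refine ⟨?_, ?_, ?_⟩ <;> omega

lemma gs_YB (s : Fin 4) : GS ge (Ww (YB s)) (X ^ uu s * (T1s * EI s)) := by
  apply GS.ext (fun x : ℤ × ℤ × ℤ => (x.2.1, x.2.2, x.2.1 + x.2.2 + (2 * x.1 + 1)))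
  · rintro ⟨a, b, c⟩ ⟨d, e, f⟩ h
    simp only [Prod.mk.injEq] at h ⊢
    omega
  · have h2 := (gs_T1.mul (gs_EI s)).shift (uu s)
    refine h2.congr ?_ ?_
    · rintro ⟨a, p, r⟩
      simp only [Ww, eiw, YB, one_mul]
      congr 1
      by_cases hh : HH s p r = 0
      · rw [hh]; simp
      · have := HH_od s _ _ hh
        rw [if_pos]
        refine ⟨this.1, this.2, ?_⟩
        rw [od_cast, od_cast] at this
        rw [od_cast]; omega
    · rintro ⟨a, p, r⟩ hne
      obtain ⟨u, hu, ho⟩ := uu_cast s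
      rw [hu]
      have hh : HH s p r ≠ 0 := by
        intro h0; apply hne; simp [eiw, h0]
      have := HH_od s _ _ hh
      rw [od_cast, od_cast] at this
      have hodd : (p * r) % 2 = 1 := by
        rw [Int.mul_emod, this.1, this.2]; rfl
      simp only [ge, DD, eie]
      have e1 := two_tri a
      have : p ^ 2 + r ^ 2 + (p + r + (2 * a + 1)) ^ 2 - 2 * p * r - 2 * p * (p + r + (2 * a + 1))
        - 2 * r * (p + r + (2 * a + 1)) - 5 = 8 * tri a - 4 * (p * r) - 4 := by linear_combination (-4) * e1
      rw [this, ho, neg_mul]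
      omega
  · rintro ⟨p, r, t⟩ hne
    have hy := right_ne_zero_of_mul hne
    simp only [YB] at hy
    have hc : (od (p : Z16) ∧ od (r : Z16) ∧ od (t : Z16)) := by
      by_contra hh; exact hy (if_neg hh)
    obtain ⟨hp, hr, ht⟩ := hc
    rw [od_cast] at hp hr ht
    refine ⟨((t - p - r - 1) / 2, p, r), ?_⟩
    simp only [Prod.mk.injEq, true_and]
    omega

theorem stepD (s : Fin 4) : 4 * (TH s * sec s FF) = 4 * AP s - EI s := by
  have h1 := gs_YA s (gs_D3 s s.2)
  have h2 := W_add h1 (gs_YB s)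
  have h3 : GS ge (Ww (YY s)) (X ^ uu s * (4 * (T1s * sec s FF * TH s - T1s * AP s)) + X ^ uu s * (T1s * EI s)) := by
    refine h2.congr (fun x => ?_) (fun x _ => rfl)
    simp only [Ww, YA, YB, YY]
    congr 1
    split_ifs <;> tauto
  have h4 := YY_zero s h3
  have hx : (X ^ uu s * T1s : PowerSeries ℤ) ≠ 0 := mul_ne_zero (pow_ne_zero _ X_ne_zero) T1_ne
  apply mul_left_cancel₀ hx
  linear_combination h4

noncomputable def geo (D : ℕ) : PowerSeries ℤ := PowerSeries.mk (fun n => if D ∣ n then 1 else 0)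

lemma geo_mul (D : ℕ) (hD : 0 < D) : (1 - X ^ D) * geo D = 1 := by
  ext n
  rw [sub_mul, one_mul, map_sub, PowerSeries.coeff_X_pow_mul', geo, PowerSeries.coeff_mk, PowerSeries.coeff_one]
  by_cases h : D ≤ n
  · rw [if_pos h, PowerSeries.coeff_mk]
    have h1 : D ∣ n - D ↔ D ∣ n := (Nat.dvd_sub_iff_left h dvd_rfl)
    have h2 : n ≠ 0 := by omega
    simp [h1, h2]
  · rw [if_neg h]
    by_cases h0 : n = 0
    · simp [h0]
    · have : ¬ D ∣ n := fun hd => h (Nat.le_of_dvd (by omega) hd)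
      simp [this, h0]

lemma gs_geo (D : ℕ) (hD : 0 < D) : GS (fun j : ℕ => (D : ℤ) * j) (fun _ => 1) (geo D) := by
  have a : Adm (fun j : ℕ => (D : ℤ) * j) (fun _ => 1) := by
    refine ⟨fun i _ => by positivity, fun n => ?_⟩
    apply (Set.finite_Iic n.toNat).subset
    rintro i ⟨_, hi⟩
    have : (i : ℤ) ≤ D * i := by nlinarith
    simp only [Set.mem_Iic]
    omega
  apply a.gs_of_coeff
  intro n
  rw [geo, PowerSeries.coeff_mk]
  by_cases h : D ∣ n
  · obtain ⟨k, rfl⟩ := h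
    have := hasSum_ite_eq k (1 : ℤ)
    simp only [dvd_mul_right, if_true]
    have key : (fun i : ℕ => if (D : ℤ) * i = ((D * k : ℕ) : ℤ) then (1 : ℤ) else 0) = fun i => if i = k then 1 else 0 := by
      funext i
      have : ((D : ℤ) * i = ((D * k : ℕ) : ℤ)) ↔ i = k := by
        push_cast
        constructor
        · intro h
          have h2 : (D : ℤ) ≠ 0 := by omega
          have := mul_left_cancel₀ h2 h
          exact_mod_cast this
        · rintro rfl; rfl
      simp only [this]
    rw [key]; exact this
  · simp only [h, if_false]
    have key : (fun i : ℕ => if (D : ℤ) * i = (n : ℤ) then (1 : ℤ) else 0) = fun _ => 0 := by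
      funext i
      rw [if_neg]
      intro h2
      exact h ⟨i, by exact_mod_cast h2.symm⟩
    rw [key]; exact hasSum_zero

lemma gs_prog (α D : ℕ) (hD : 0 < D) (w : ℤ) :
    GS (fun j : ℕ => (α : ℤ) + D * j) (fun _ => w) ((w : PowerSeries ℤ) * (X ^ α * geo D)) := by
  refine (((gs_geo D hD).shift α).smul w).congr (fun i => by ring) (fun i _ => by ring)

def apA (s u : ℕ) : ℕ := 8 * u ^ 2 + [9, 13, 17, 21].getD s 0 * u + [1, 4, 6, 7].getD s 0
def apB (s u : ℕ) : ℕ := 8 * u ^ 2 + [23, 19, 15, 11].getD s 0 * u + [8, 7, 5, 2].getD s 0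

def apsig (x : ℕ × (ℕ ⊕ ℕ)) : ℤ × ℤ :=
  Sum.elim (fun j : ℕ => ((j : ℤ), (x.1 : ℤ) + 1)) (fun j : ℕ => (-1 - (j : ℤ), -(x.1 : ℤ))) x.2

lemma apsig_inj : Function.Injective apsig := by
  rintro ⟨u, j | j⟩ ⟨u', j' | j'⟩ h <;> simp only [apsig, Sum.elim_inl, Sum.elim_inr, Prod.mk.injEq] at h <;>
    simp only [Prod.mk.injEq, Sum.inl.injEq, Sum.inr.injEq, reduceCtorEq, and_false] <;> omega

lemma ap_inl (s : Fin 4) (u j : ℕ) : ape s (j, (u : ℤ) + 1) = apA s u + ((16 * u + 8 : ℕ) : ℤ) * j := by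
  fin_cases s <;> simp [ape, apA, tri] <;> ring
lemma ap_inr (s : Fin 4) (u j : ℕ) : ape s (-1 - (j : ℤ), -(u : ℤ)) = apB s u + ((16 * u + 8 : ℕ) : ℤ) * j := by
  fin_cases s <;> simp [ape, apB, tri] <;> ring

lemma apw_inl (s : Fin 4) (u j : ℕ) : apw s (j, (u : ℤ) + 1) = 2 := by
  have h1 : Int.sign (16 * (j : ℤ) + 4 * ((s : ℕ) : ℤ) + 1) = 1 := Int.sign_eq_one_of_pos (by omega)
  have h2 : Int.sign (2 * ((u : ℤ) + 1) - 1) = 1 := Int.sign_eq_one_of_pos (by omega)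
  simp only [apw, h1, h2]; norm_num
lemma apw_inr (s : Fin 4) (u j : ℕ) : apw s (-1 - (j : ℤ), -(u : ℤ)) = -2 := by
  have h1 : Int.sign (16 * (-1 - (j : ℤ)) + 4 * ((s : ℕ) : ℤ) + 1) = -1 := Int.sign_eq_neg_one_of_neg (by omega)
  have h2 : Int.sign (2 * (-(u : ℤ)) - 1) = -1 := Int.sign_eq_neg_one_of_neg (by omega)
  simp only [apw, h1, h2]; norm_num

lemma apA_par (s : Fin 4) (u j : ℕ) : sgo s * (-1) ^ (apA s u + (16 * u + 8) * j) = (-1) ^ u := by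
  have h : (-1 : ℤ) ^ ((16 * u + 8) * j) = 1 := Even.neg_one_pow ⟨(8 * u + 4) * j, by ring⟩
  have h8 : (-1 : ℤ) ^ (8 * u ^ 2) = 1 := Even.neg_one_pow ⟨4 * u ^ 2, by ring⟩
  rw [pow_add, h]
  fin_cases s <;> simp [apA, sgo, pow_add, pow_mul, h8]
lemma apB_par (s : Fin 4) (u j : ℕ) : sgo s * (-1) ^ (apB s u + (16 * u + 8) * j) = - (-1) ^ u := by
  have h : (-1 : ℤ) ^ ((16 * u + 8) * j) = 1 := Even.neg_one_pow ⟨(8 * u + 4) * j, by ring⟩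
  have h8 : (-1 : ℤ) ^ (8 * u ^ 2) = 1 := Even.neg_one_pow ⟨4 * u ^ 2, by ring⟩
  rw [pow_add, h]
  fin_cases s <;> simp [apB, sgo, pow_add, pow_mul, h8]

/-- Appell part after X -> -X -/
lemma hs_AP (s : Fin 4) : HasSum (fun u : ℕ => ((2 * (-1) ^ u : ℤ) : PowerSeries ℤ) *
    ((X ^ apA s u + X ^ apB s u) * geo (16 * u + 8))) ((sgo s : PowerSeries ℤ) * rescale (-1 : ℤ) (AP s)) := by
  have h1 := ((gs_AP s s.2).evalNeg).smul (sgo s)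
  have h2 := h1.inj apsig apsig_inj (by
    rintro ⟨m, k⟩ hw
    have hw : apw s (m, k) ≠ 0 := by
      intro h0; apply hw; simp [h0]
    simp only [apw] at hw
    have hs := s.2
    rcases sign_cases (16 * m + 4 * ((s : ℕ) : ℤ) + 1) with a | a | a <;> rcases sign_cases (2 * k - 1) with b | b | b <;>
      rw [a.1, b.1] at hw
    all_goals try omega
    · exact ⟨((k - 1).toNat, Sum.inl m.toNat), by simp only [apsig, Sum.elim_inl, Prod.mk.injEq]; omega⟩
    · exact ⟨((-k).toNat, Sum.inr (-1 - m).toNat), by simp only [apsig, Sum.elim_inr, Prod.mk.injEq]; omega⟩)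
  refine h2.fiber _ (fun u => ?_)
  have g1 := gs_prog (apA s u) (16 * u + 8) (by omega) (2 * (-1) ^ u)
  have g2 := gs_prog (apB s u) (16 * u + 8) (by omega) (2 * (-1) ^ u)
  have g := g1.sum g2
  rw [← mul_add, ← add_mul] at g
  refine g.congr ?_ ?_
  · rintro (j | j)
    · simp only [apsig, Sum.elim_inl, ap_inl, apw_inl]
      have := apA_par s u j
      rw [← this]
      have e : ((apA s u : ℤ) + ((16 * u + 8 : ℕ) : ℤ) * j).toNat = apA s u + (16 * u + 8) * j := by
        norm_cast
      rw [e]; ring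
    · simp only [apsig, Sum.elim_inr, ap_inr, apw_inr]
      have := apB_par s u j
      have e : ((apB s u : ℤ) + ((16 * u + 8 : ℕ) : ℤ) * j).toNat = apB s u + (16 * u + 8) * j := by
        norm_cast
      rw [e]; linear_combination -2 * this
  · rintro (j | j) _
    · simp only [apsig, Sum.elim_inl, ap_inl]
    · simp only [apsig, Sum.elim_inr, ap_inr]

/-- residues of the four Eisenstein progressions: two positive, two negative -/
def tv (s q : ℕ) : ℕ := ([[3, 7, 9, 13], [1, 13, 3, 15], [1, 5, 11, 15], [7, 11, 5, 9]].getD s []).getD q 0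
def tsg (q : ℕ) : ℤ := [1, 1, -1, -1].getD q 0
/-- exponent as in the double sum over odd divisors -/
def ete (s q : ℕ) (x : ℕ × ℕ) : ℤ := ((2 * (x.1 : ℤ) + 1) * (16 * x.2 + tv s q) - oo s) / 2

def eisig (s : ℕ) (x : (Bool × Fin 4) × (ℕ × ℕ)) : ℤ × ℤ :=
  if x.1.1 then (2 * (x.2.1 : ℤ) + 1, - (16 * (x.2.2 : ℤ) + tv s x.1.2)) else
    (-(2 * (x.2.1 : ℤ) + 1), 16 * (x.2.2 : ℤ) + tv s x.1.2)

lemma tv_lt : ∀ s q : Fin 4, tv s q < 16 ∧ tv s q % 2 = 1 ∧ oo s ≤ tv s q + 2 := by decide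
lemma tv_inj : ∀ s q q' : Fin 4, tv s q = tv s q' → q = q' := by decide
lemma tv_oo : ∀ s q : Fin 4, oo s ≤ tv s q := by decide

lemma eisig_inj (s : Fin 4) : Function.Injective (eisig s) := by
  rintro ⟨⟨b, q⟩, u, i⟩ ⟨⟨b', q'⟩, u', i'⟩ h
  have h1 := tv_lt s q
  have h2 := tv_lt s q'
  have h3 := tv_inj s q q'
  cases b <;> cases b' <;> simp [eisig] at h
  · have : q = q' := h3 (by omega)
    subst this
    simp; omega
  · omega
  · omega
  · have : q = q' := h3 (by omega)
    subst this
    simp; omega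

lemma ees_tv : ∀ s : Fin 4, ∀ v : Z16, ees s v ≠ 0 → ∃ q : Fin 4, v.val = tv s q := by decide +kernel
lemma HH_val : ∀ s q : Fin 4, ∀ p : Z16, HH s p (-(tv s q : Z16)) = sgo s * chi4 p * chi4 (-(tv s q : Z16)) * tsg q := by
  decide +kernel
lemma HH_val' : ∀ s q : Fin 4, ∀ p : Z16, HH s (-p) (tv s q : Z16) = - (sgo s * chi4 p * chi4 (-(tv s q : Z16)) * tsg q) := by
  decide +kernel
lemma chi_tv : ∀ s q : Fin 4, sgo s * chi4 (-(tv s q : Z16)) * (-1) ^ ((tv s q - oo s) / 2).toNat = -1 := by decide +kernel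
lemma chi_aux : ∀ v : Fin 8, chi4 (2 * (v.val : Z16) + 1) = (-1) ^ v.val := by decide +kernel

lemma chi_u (u : ℕ) : chi4 (2 * (u : Z16) + 1) = (-1) ^ u := by
  have h := chi_aux ⟨u % 8, Nat.mod_lt _ (by norm_num)⟩
  have h1 : (2 * (u : Z16) + 1) = 2 * ((u % 8 : ℕ) : Z16) + 1 := by
    have : (16 : Z16) = 0 := by decide
    conv_lhs => rw [← Nat.div_add_mod u 8]
    push_cast
    linear_combination ((u / 8 : ℕ) : Z16) * this
  have h2 : (-1 : ℤ) ^ u = (-1) ^ (u % 8) := by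
    conv_lhs => rw [← Nat.div_add_mod u 8]
    rw [pow_add, pow_mul]; norm_num
  rw [h1, h2]; exact h

lemma ete_eq (s q : Fin 4) (u i : ℕ) : ∃ t0 : ℕ, (tv s q : ℤ) = oo s + 2 * t0 ∧
    ete s q (u, i) = t0 + u * tv s q + 8 * i * (2 * u + 1) := by
  have h1 := tv_oo s q
  have h2 := (tv_lt s q).2.1
  have h3 := (oo_uu s).1
  refine ⟨((tv s q - oo s) / 2).toNat, by omega, ?_⟩
  have : (tv s q : ℤ) = oo s + 2 * (((tv s q - oo s) / 2).toNat : ℤ) := by omega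
  unfold ete
  generalize ((((tv s q : ℤ) - oo s) / 2).toNat) = t0 at this
  apply Int.ediv_eq_of_eq_mul_left (by norm_num)
  linear_combination this

lemma ete_sign (s q : Fin 4) (u i : ℕ) : (-1 : ℤ) ^ (ete s q (u, i)).toNat = (-1) ^ ((tv s q - oo s) / 2).toNat * (-1) ^ u := by
  obtain ⟨t0, h1, h2⟩ := ete_eq s q u i
  have e1 : (ete s q (u, i)).toNat = t0 + u * tv s q + 8 * i * (2 * u + 1) := by
    rw [h2]; norm_cast
  have e2 : (((tv s q : ℤ) - oo s) / 2).toNat = t0 := by omega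
  rw [e1, e2]
  have h8 : (-1 : ℤ) ^ (8 * i * (2 * u + 1)) = 1 := Even.neg_one_pow ⟨4 * i * (2 * u + 1), by ring⟩
  have h9 : (-1 : ℤ) ^ (u * tv s q) = (-1) ^ u := by
    rw [mul_comm, pow_mul, Odd.neg_one_pow]
    rw [Nat.odd_iff]; exact (tv_lt s q).2.1
  rw [pow_add, pow_add, h8, h9]; ring

lemma eie_sig (s : Fin 4) (b : Bool) (q : Fin 4) (u i : ℕ) : eie s (eisig s ((b, q), (u, i))) = ete s q (u, i) := by
  cases b <;> simp only [eie, eisig, ete, if_true, if_false, Bool.false_eq_true]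
  · congr 2
  · congr 2; ring

lemma eiw_sig (s : Fin 4) (b : Bool) (q : Fin 4) (u i : ℕ) : eiw s (eisig s ((b, q), (u, i))) * (-1) ^ (ete s q (u, i)).toNat = - 2 * tsg q := by
  have h1 := (tv_lt s q).2.1
  have s1 : Int.sign (2 * (u : ℤ) + 1) = 1 := Int.sign_eq_one_of_pos (by omega)
  have s2 : Int.sign (16 * (i : ℤ) + tv s q) = 1 := Int.sign_eq_one_of_pos (by omega)
  have s3 : Int.sign (-(2 * (u : ℤ) + 1)) = -1 := by rw [Int.sign_neg, s1]
  have s4 : Int.sign (-(16 * (i : ℤ) + tv s q)) = -1 := by rw [Int.sign_neg, s2]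
  have h16 : (16 : Z16) = 0 := by decide
  have c1 : ((16 * (i : ℤ) + tv s q : ℤ) : Z16) = (tv s q : Z16) := by
    push_cast; rw [h16]; ring
  have c2 : ((-(16 * (i : ℤ) + tv s q) : ℤ) : Z16) = -(tv s q : Z16) := by
    rw [Int.cast_neg, c1]
  have c3 : ((2 * (u : ℤ) + 1 : ℤ) : Z16) = 2 * (u : Z16) + 1 := by push_cast; ring
  have c4 : ((-(2 * (u : ℤ) + 1) : ℤ) : Z16) = - (2 * (u : Z16) + 1) := by rw [Int.cast_neg, c3]
  have hu : ((-1 : ℤ) ^ u) * (-1) ^ u = 1 := by rw [← mul_pow]; norm_num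
  have hc := chi_tv s q
  rw [ete_sign]
  cases b <;> simp only [eiw, eisig, if_true, if_false, Bool.false_eq_true]
  · rw [s3, s2, c4, c1, HH_val', chi_u]
    linear_combination 2 * tsg q * hu * (sgo s * chi4 (-(tv s q : Z16)) * (-1) ^ ((tv s q - oo s) / 2).toNat) + 2 * tsg q * hc
  · rw [s1, s4, c3, c2, HH_val, chi_u]
    linear_combination 2 * tsg q * hu * (sgo s * chi4 (-(tv s q : Z16)) * (-1) ^ ((tv s q - oo s) / 2).toNat) + 2 * tsg q * hc

lemma ees_odd : ∀ s : Fin 4, ∀ w : Z16, ees s (-w) = - ees s w := by decide +kernel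

lemma eisig_range (s : Fin 4) (x : ℤ × ℤ) (h : eiw s x ≠ 0) : x ∈ Set.range (eisig s) := by
  obtain ⟨p, r⟩ := x
  simp only [eiw] at h
  have h1 := left_ne_zero_of_mul h
  have h2 := right_ne_zero_of_mul h
  have hod := HH_od s _ _ h2
  rw [od_cast, od_cast] at hod
  obtain ⟨q, hq⟩ := ees_tv s _ (right_ne_zero_of_mul h2)
  have hv : (((-r : ℤ) : Z16).val : ℤ) = (-r) % 16 := by
    have := ZMod.val_intCast (n := 16) (-r)
    simpa using this
  rw [← Int.cast_neg] at hq
  rw [hq] at hv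
  have hodd := ees_odd s
  obtain ⟨q', hq'⟩ := ees_tv s (r : Z16) (by
    have := right_ne_zero_of_mul h2
    rw [hodd] at this
    intro h0; rw [h0] at this; simp at this)
  have hv' : (((r : ℤ) : Z16).val : ℤ) = r % 16 := by
    have := ZMod.val_intCast (n := 16) r
    simpa using this
  rw [hq'] at hv'
  rcases sign_cases p with a | a | a <;> rcases sign_cases r with b | b | b <;>
      rw [a.1, b.1] at h1
  all_goals try omega
  · refine ⟨((true, q), (p / 2).toNat, ((-r) / 16).toNat), ?_⟩
    simp only [eisig, if_true, Prod.mk.injEq]; omega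
  · refine ⟨((false, q'), ((-p) / 2).toNat, (r / 16).toNat), ?_⟩
    simp only [eisig, if_false, Bool.false_eq_true, Prod.mk.injEq]; omega

lemma adm_ET (s q : Fin 4) : Adm (ete s q) (fun _ => 1) := by
  refine ⟨?_, ?_⟩
  · rintro ⟨u, i⟩ _
    obtain ⟨t0, h1, h2⟩ := ete_eq s q u i
    rw [h2]; positivity
  · intro n
    apply ((Set.finite_Iic n.toNat).prod (Set.finite_Iic n.toNat)).subset
    rintro ⟨u, i⟩ ⟨_, hi⟩
    obtain ⟨t0, h1, h2⟩ := ete_eq s q u i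
    have h3 := (tv_lt s q).2.1
    have h4 : 1 ≤ tv s q := by omega
    rw [h2] at hi
    have a : (u : ℤ) ≤ n := by nlinarith [Int.natCast_nonneg u, Int.natCast_nonneg i, Int.natCast_nonneg t0]
    have b : (i : ℤ) ≤ n := by nlinarith [Int.natCast_nonneg u, Int.natCast_nonneg i, Int.natCast_nonneg t0]
    simp only [Set.mem_prod, Set.mem_Iic]
    omega

noncomputable def ET (s q : ℕ) : PowerSeries ℤ := ∑' x, mz (ete s q x) 1
lemma gs_ET (s q : Fin 4) : GS (ete s q) (fun _ => 1) (ET s q) := (adm_ET s q).gs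

lemma EI_eq (s : Fin 4) : rescale (-1 : ℤ) (EI s) = -4 * (ET s 0 + ET s 1 - ET s 2 - ET s 3) := by
  have h := ((gs_EI s).evalNeg).inj (eisig s) (eisig_inj s) (fun i hi => eisig_range s i (left_ne_zero_of_mul hi))
  have h2 := h.fiber (fun x => (((-2 * tsg x.2 : ℤ) : PowerSeries ℤ)) * ET s x.2) (by
    rintro ⟨b, q⟩
    refine ((gs_ET s q).smul (-2 * tsg q)).congr ?_ ?_
    · rintro ⟨u, i⟩
      rw [eie_sig, eiw_sig]; ring
    · rintro ⟨u, i⟩ _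
      rw [eie_sig])
  have h3 := (hasSum_fintype (fun x : Bool × Fin 4 => (((-2 * tsg x.2 : ℤ) : PowerSeries ℤ)) * ET s x.2))
  rw [h2.unique h3, Fintype.sum_prod_type]
  simp [Fin.sum_univ_four, tsg]
  ring

/-- theta function after X -> -X -/
noncomputable def jt (s : ℕ) : PowerSeries ℤ := rescale (-1 : ℤ) (TH s)
noncomputable def gg (s : ℕ) : PowerSeries ℤ := rescale (-1 : ℤ) (sec s FF)

lemma gs_jt (s : Fin 4) : GS (the s) eps (jt s) := by
  refine ((gs_TH s s.2).evalNeg).congr (fun b => ?_) (fun _ _ => rfl)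
  have h0 := (gs_TH s s.2).adm.nonneg b one_ne_zero
  rw [one_mul, ← eps_nat, Int.toNat_of_nonneg h0]
  apply eps_congr
  unfold the
  have : b - (8 * b ^ 2 + (4 * ((s : ℕ) : ℤ) - 7) * b) = 2 * (4 * b - 4 * b ^ 2 - 2 * s * b) := by ring
  rw [this]; simp

lemma coeff_gg (s K : ℕ) : PowerSeries.coeff K (gg s) = (-1) ^ K * ((N2 0 4 (4 * K + s) : ℤ) - N2 2 4 (4 * K + s)) := by
  rw [gg, PowerSeries.coeff_rescale, coeff_sec, coeff_FF]

lemma jt_gg (s : Fin 4) : jt s * gg s = rescale (-1 : ℤ) (AP s) + (ET s 0 + ET s 1 - ET s 2 - ET s 3) := by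
  have h := congrArg (rescale (-1 : ℤ)) (stepD s)
  have h4 : rescale (-1 : ℤ) (4 : PowerSeries ℤ) = 4 := map_ofNat _ 4
  rw [map_mul, map_sub, map_mul, map_mul, h4, EI_eq] at h
  apply mul_left_cancel₀ (int_ne_ps 4 (by norm_num))
  push_cast
  unfold jt gg
  linear_combination h

/-- both ways of summing the Eisenstein progressions -/
lemma ET_c (s q : Fin 4) (t0 : ℕ) (h : (tv s q : ℤ) = oo s + 2 * t0) :
    HasSum (fun u : ℕ => (X ^ (t0 + u * tv s q) : PowerSeries ℤ) * geo (16 * u + 8)) (ET s q) := by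
  refine (gs_ET s q).fiber _ (fun u => ?_)
  have := gs_prog (t0 + u * tv s q) (16 * u + 8) (by omega) 1
  rw [Int.cast_one, one_mul] at this
  refine this.congr (fun _ => rfl) (fun i _ => ?_)
  obtain ⟨t1, h1, h2⟩ := ete_eq s q u i
  have : t1 = t0 := by omega
  subst this
  rw [h2]; push_cast; ring

lemma ET_d (s q : Fin 4) (t0 : ℕ) (h : (tv s q : ℤ) = oo s + 2 * t0) :
    HasSum (fun i : ℕ => (X ^ (t0 + 8 * i) : PowerSeries ℤ) * geo (16 * i + tv s q)) (ET s q) := by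
  refine ((gs_ET s q).equiv (Equiv.prodComm ℕ ℕ)).fiber _ (fun i => ?_)
  have h3 := (tv_lt s q).2.1
  have := gs_prog (t0 + 8 * i) (16 * i + tv s q) (by omega) 1
  rw [Int.cast_one, one_mul] at this
  refine this.congr (fun _ => rfl) (fun u _ => ?_)
  simp only [Equiv.prodComm_apply, Prod.swap]
  obtain ⟨t1, h1, h2⟩ := ete_eq s q u i
  have : t1 = t0 := by omega
  subst this
  rw [h2]; push_cast; ring

/-- q-Pochhammer `(Q;Q)_n` -/
def qp {R : Type*} [CommRing R] (Q : R) (n : ℕ) : R := ∏ i ∈ Finset.range n, (1 - Q ^ (i + 1))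

lemma qp_succ {R : Type*} [CommRing R] (Q : R) (n : ℕ) : qp Q (n + 1) = qp Q n * (1 - Q ^ (n + 1)) := by
  rw [qp, Finset.prod_range_succ]; rfl

/-- Gaussian binomial `[m + l choose m]` -/
def gb {R : Type*} [CommRing R] (Q : R) : ℕ → ℕ → R
  | 0, _ => 1
  | _ + 1, 0 => 1
  | m + 1, l + 1 => gb Q (m + 1) l + Q ^ (l + 1) * gb Q m (l + 1)

lemma gb_zero_left {R : Type*} [CommRing R] (Q : R) (l : ℕ) : gb Q 0 l = 1 := by rw [gb]
lemma gb_zero_right {R : Type*} [CommRing R] (Q : R) (l : ℕ) : gb Q l 0 = 1 := by cases l <;> rw [gb]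

lemma gb_qp {R : Type*} [CommRing R] (Q : R) (N : ℕ) : ∀ m l : ℕ, m + l = N → qp Q m * qp Q l * gb Q m l = qp Q (m + l) := by
  induction N with
  | zero =>
    intro m l h
    have h1 : m = 0 := by omega
    have h2 : l = 0 := by omega
    subst h1 h2
    simp [qp, gb]
  | succ N ih =>
    intro m l h
    cases m with
    | zero => simp [qp, gb]
    | succ m =>
      cases l with
      | zero => simp [qp, gb]
      | succ l =>
        have h1 := ih m (l + 1) (by omega)
        have h2 := ih (m + 1) l (by omega)
        have e1 : m + (l + 1) = m + l + 1 := by ring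
        have e2 : m + 1 + l = m + l + 1 := by ring
        have e3 : m + 1 + (l + 1) = m + l + 1 + 1 := by ring
        rw [e1] at h1
        rw [e2] at h2
        rw [e3, gb, qp_succ Q (m + l + 1)]
        have h3 := qp_succ Q m
        have h4 := qp_succ Q l
        linear_combination (1 - Q ^ (l + 1)) * h2 + Q ^ (l + 1) * (1 - Q ^ (m + 1)) * h1
          + Q ^ (l + 1) * qp Q (l + 1) * gb Q m (l + 1) * h3 + qp Q (m + 1) * gb Q (m + 1) l * h4

def gt {R : Type*} [CommRing R] (Q A : R) (N r : ℕ) : R := (-1) ^ r * Q ^ (r.choose 2) * A ^ (N - r) * gb Q r (N - r)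

lemma gt_succ {R : Type*} [CommRing R] (Q A : R) (N r : ℕ) (h : r < N) :
    gt Q A (N + 1) (r + 1) = A * gt Q A N (r + 1) - Q ^ N * gt Q A N r := by
  obtain ⟨l, rfl⟩ := Nat.exists_eq_add_of_lt h
  have e1 : r + l + 1 + 1 - (r + 1) = l + 1 := by omega
  have e2 : r + l + 1 - (r + 1) = l := by omega
  have e3 : r + l + 1 - r = l + 1 := by omega
  have e4 : (r + 1).choose 2 = r + r.choose 2 := by
    rw [Nat.choose_succ_succ' r 1, Nat.choose_one_right]
  simp only [gt, e1, e2, e3, e4, gb]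
  ring

/-- Gauss binomial theorem -/
lemma gauss {R : Type*} [CommRing R] (Q A : R) (N : ℕ) :
    ∏ i ∈ Finset.range N, (A - Q ^ i) = ∑ r ∈ Finset.range (N + 1), gt Q A N r := by
  induction N with
  | zero => simp [gt, gb]
  | succ N ih =>
    rw [Finset.prod_range_succ, ih, Finset.sum_range_succ' (gt Q A (N + 1)), Finset.sum_range_succ (fun k => gt Q A (N + 1) (k + 1))]
    rw [Finset.sum_congr rfl (fun r hr => gt_succ Q A N r (Finset.mem_range.1 hr)), Finset.sum_sub_distrib,
      ← Finset.mul_sum, ← Finset.mul_sum]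
    have h1 := Finset.sum_range_succ (gt Q A N) N
    have h2 := Finset.sum_range_succ' (gt Q A N) N
    have h3 : gt Q A (N + 1) (N + 1) = - Q ^ N * gt Q A N N := by
      have e4 : (N + 1).choose 2 = N + N.choose 2 := by
        rw [Nat.choose_succ_succ' N 1, Nat.choose_one_right]
      simp only [gt, Nat.sub_self, gb_zero_right, e4]; ring
    have h4 : gt Q A (N + 1) 0 = A * gt Q A N 0 := by
      simp only [gt, Nat.sub_zero, gb_zero_left]; ring
    rw [h3, h4]
    linear_combination A * h2 - Q ^ N * h1

lemma qp_congr {R : Type*} [CommRing R] (Q : R) (m n : ℕ) (h : m ≤ n) : Q ^ (m + 1) ∣ qp Q n - qp Q m := by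
  induction n, h using Nat.le_induction with
  | base => simp
  | succ n h ih =>
    rw [qp_succ]
    have h1 : Q ^ (m + 1) ∣ Q ^ (n + 1) := pow_dvd_pow _ (by omega)
    have : qp Q n * (1 - Q ^ (n + 1)) - qp Q m = (qp Q n - qp Q m) - Q ^ (n + 1) * qp Q n := by ring
    rw [this]
    exact dvd_sub ih (h1.mul_right _)

lemma qp_unit (k n : ℕ) (hk : 0 < k) : IsUnit (qp (X ^ k : PowerSeries ℤ) n) := by
  rw [PowerSeries.isUnit_iff_constantCoeff, qp, map_prod]
  have : ∀ i, constantCoeff (R := ℤ) (1 - (X ^ k) ^ (i + 1)) = 1 := by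
    intro i
    rw [← pow_mul, map_sub, map_pow, PowerSeries.constantCoeff_X, zero_pow (by positivity)]; simp
  simp [this]

lemma dvd_cancel_unit {R : Type*} [CommRing R] {u a b : R} (hu : IsUnit u) (h : a ∣ u * b) : a ∣ b :=
  (hu.dvd_mul_left).1 h

/-- the Gaussian binomial times the Pochhammer symbol is congruent to one -/
lemma gb_approx (k n r l : ℕ) (hk : 0 < k) (h : r + l = 2 * n) (m : ℕ) (hr : m ≤ r) (hl : m ≤ l) :
    (X ^ k : PowerSeries ℤ) ^ (m + 1) ∣ qp (X ^ k : PowerSeries ℤ) n * gb (X ^ k : PowerSeries ℤ) r l - 1 := by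
  set Q := (X ^ k : PowerSeries ℤ) with hQ
  have h1 := gb_qp Q _ r l rfl
  have a1 : Q ^ (m + 1) ∣ qp Q r - qp Q m := qp_congr Q m r hr
  have a2 : Q ^ (m + 1) ∣ qp Q l - qp Q m := qp_congr Q m l hl
  have a3 : Q ^ (m + 1) ∣ qp Q (r + l) - qp Q m := qp_congr Q m _ (by omega)
  have a4 : Q ^ (m + 1) ∣ qp Q n - qp Q m := qp_congr Q m _ (by omega)
  have hu : IsUnit (qp Q r * qp Q l) := (qp_unit k r hk).mul (qp_unit k l hk)
  apply dvd_cancel_unit hu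
  have : qp Q r * qp Q l * (qp Q n * gb Q r l - 1) = (qp Q n - qp Q m) * qp Q (r + l) + qp Q m * (qp Q (r + l) - qp Q m)
     - (qp Q r - qp Q m) * qp Q l - qp Q m * (qp Q l - qp Q m) := by
    linear_combination qp Q n * h1
  rw [this]
  exact dvd_sub (dvd_sub (dvd_add (a4.mul_right _) (a3.mul_left _)) (a1.mul_right _)) (a2.mul_left _)

/-- finite theta product -/
noncomputable def pp (k n : ℕ) : PowerSeries ℤ := ∏ i ∈ Finset.range n, ((1 - X ^ (16 * i + k)) * (1 - X ^ (16 * i + (16 - k))))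

lemma prod_pow_range (Q : PowerSeries ℤ) (n : ℕ) : ∏ i ∈ Finset.range n, Q ^ i = Q ^ (n.choose 2) := by
  rw [Finset.prod_pow_eq_pow_sum, Finset.sum_range_id, Nat.choose_two_right]

lemma pp_gauss (k n : ℕ) (hn : 0 < n) (hk : k < 16) :
    ∏ i ∈ Finset.range (2 * n), ((X ^ (16 * n - k) : PowerSeries ℤ) - (X ^ 16) ^ i)
      = (-1) ^ n * X ^ (16 * n.choose 2 + (16 * n - k) * n) * pp k n := by
  rw [two_mul, Finset.prod_range_add]
  have h2 : ∀ i ∈ Finset.range n, (X ^ (16 * n - k) : PowerSeries ℤ) - (X ^ 16) ^ (n + i)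
      = X ^ (16 * n - k) * (1 - X ^ (16 * i + k)) := by
    intro i _
    rw [mul_sub, mul_one, ← pow_add, ← pow_mul]
    congr 2
    omega
  have h1 : ∏ i ∈ Finset.range n, ((X ^ (16 * n - k) : PowerSeries ℤ) - (X ^ 16) ^ i) =
     (-1) ^ n * X ^ (16 * n.choose 2) * ∏ i ∈ Finset.range n, (1 - X ^ (16 * i + (16 - k))) := by
    have h3 : ∀ i ∈ Finset.range n, ((X ^ (16 * n - k) : PowerSeries ℤ) - (X ^ 16) ^ i) =
        (-1) * (X ^ 16) ^ i * (1 - X ^ (16 * (n - 1 - i) + (16 - k))) := by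
      intro i hi
      have hi := Finset.mem_range.1 hi
      have e : 16 * n - k = 16 * i + (16 * (n - 1 - i) + (16 - k)) := by omega
      rw [e, pow_add, pow_mul]; ring
    rw [Finset.prod_congr rfl h3, Finset.prod_mul_distrib, Finset.prod_mul_distrib, prod_pow_range, Finset.prod_const,
      Finset.card_range, Finset.prod_range_reflect (fun i => (1 - X ^ (16 * i + (16 - k)) : PowerSeries ℤ)), pow_mul]
  rw [h1, Finset.prod_congr rfl h2, Finset.prod_mul_distrib, Finset.prod_const, Finset.card_range, pp, Finset.prod_mul_distrib,
    ← pow_mul, pow_add]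
  ring

lemma choose_two_int (r : ℕ) : 2 * ((r.choose 2 : ℕ) : ℤ) = r * (r - 1) := by
  induction r with
  | zero => simp
  | succ r ih =>
    rw [Nat.choose_succ_succ' r 1, Nat.choose_one_right]
    push_cast; linear_combination ih

lemma the_bd (s : Fin 4) (j : ℤ) : 8 * j ^ 2 - 7 * |j| ≤ the s j := by
  unfold the
  have hs := s.2
  rcases abs_cases j with ⟨h, h0⟩ | ⟨h, h0⟩ <;> rw [h] <;> nlinarith

lemma the_nonneg (s : Fin 4) (j : ℤ) : 0 ≤ the s j := (gs_TH s s.2).adm.nonneg j one_ne_zero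

lemma gt_eq (s : Fin 4) (n r : ℕ) (hn : 0 < n) (hr : r ≤ 2 * n) :
    gt (X ^ 16 : PowerSeries ℤ) (X ^ (16 * n - (4 * s + 1))) (2 * n) r =
      (-1) ^ n * X ^ (16 * n.choose 2 + (16 * n - (4 * s + 1)) * n) *
        (mz (the s (r - n)) (eps (r - n)) * gb (X ^ 16 : PowerSeries ℤ) r (2 * n - r)) := by
  have hs := s.2
  have e1 : mz (the s (r - n)) (eps (r - n)) = (-1) ^ (r + n) * X ^ (the s (r - n)).toNat := by
    rw [mz, eps_congr (r - n) ((r + n : ℕ) : ℤ) (by push_cast; omega), eps_nat, PowerSeries.X_pow_eq]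
    rcases Nat.even_or_odd (r + n) with h | h
    · rw [h.neg_one_pow, h.neg_one_pow, one_mul]
    · rw [h.neg_one_pow, h.neg_one_pow, map_neg]; ring
  have e2 : 16 * r.choose 2 + (16 * n - (4 * s + 1)) * (2 * n - r) =
      16 * n.choose 2 + (16 * n - (4 * s + 1)) * n + (the s (r - n)).toNat := by
    zify [hr, show 4 * (s : ℕ) + 1 ≤ 16 * n by omega]
    rw [Int.toNat_of_nonneg (the_nonneg s _)]
    unfold the
    linear_combination 8 * choose_two_int r - 8 * choose_two_int n
  rw [e1, gt, ← pow_mul, ← pow_mul]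
  have e3 : (X : PowerSeries ℤ) ^ (16 * r.choose 2) * X ^ ((16 * n - (4 * s + 1)) * (2 * n - r)) =
     X ^ (16 * n.choose 2 + (16 * n - (4 * s + 1)) * n) * X ^ (the s (r - n)).toNat := by
    rw [← pow_add, e2, pow_add]
  have e4 : (-1 : PowerSeries ℤ) ^ r = (-1) ^ n * (-1) ^ (r + n) := by
    rw [pow_add, mul_comm ((-1 : PowerSeries ℤ) ^ r), ← mul_assoc, ← pow_add, Even.neg_one_pow ⟨n, rfl⟩, one_mul]
  rw [e4]
  linear_combination (-1) ^ n * (-1) ^ (r + n) * gb (X ^ 16 : PowerSeries ℤ) r (2 * n - r) * e3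

lemma pp_eq (s : Fin 4) (n : ℕ) (hn : 0 < n) : pp (4 * s + 1) n =
    ∑ r ∈ Finset.range (2 * n + 1), mz (the s (r - n)) (eps (r - n)) * gb (X ^ 16 : PowerSeries ℤ) r (2 * n - r) := by
  have h1 := pp_gauss (4 * s + 1) n hn (by omega)
  rw [gauss] at h1
  rw [Finset.sum_congr rfl (fun r hr => gt_eq s n r hn (by have := Finset.mem_range.1 hr; omega)), ← Finset.mul_sum] at h1
  have h0 : (-1 : PowerSeries ℤ) ^ n * X ^ (16 * n.choose 2 + (16 * n - (4 * s + 1)) * n) ≠ 0 :=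
    mul_ne_zero (pow_ne_zero _ (neg_ne_zero.2 one_ne_zero)) (pow_ne_zero _ X_ne_zero)
  exact (mul_left_cancel₀ h0 h1).symm

lemma mz_dvd (e w : ℤ) (M : ℕ) (h : (M : ℤ) ≤ e) : (X ^ M : PowerSeries ℤ) ∣ mz e w := by
  rw [PowerSeries.X_pow_dvd_iff]
  intro m hm
  rw [mz, PowerSeries.coeff_monomial, if_neg (by omega)]

lemma jt_trunc (s : Fin 4) (n : ℕ) (hn : 0 < n) : (X ^ (16 * n) : PowerSeries ℤ) ∣
    jt s - ∑ r ∈ Finset.range (2 * n + 1), mz (the s (r - n)) (eps (r - n)) := by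
  rw [PowerSeries.X_pow_dvd_iff]
  intro m hm
  rw [map_sub, map_sum, sub_eq_zero]
  have h1 := ((PowerSeries.WithPiTopology.hasSum_iff_hasSum_coeff ℤ).1 (gs_jt s).hs) m
  have h2 : HasSum (fun j : ℤ => PowerSeries.coeff m (mz (the s j) (eps j)))
      (∑ j ∈ (Finset.range (2 * n + 1)).image (fun r : ℕ => (r : ℤ) - n), PowerSeries.coeff m (mz (the s j) (eps j))) := by
    apply hasSum_sum_of_ne_finset_zero
    intro j hj
    have hj' : (n : ℤ) + 1 ≤ |j| := by
      by_contra hc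
      apply hj
      rw [Finset.mem_image]
      refine ⟨(j + n).toNat, ?_, ?_⟩
      · rw [Finset.mem_range]
        have := abs_le.1 (show |j| ≤ n by omega); omega
      · have := abs_le.1 (show |j| ≤ n by omega); omega
    have := the_bd s j
    have h3 : (16 * n : ℤ) ≤ the s j := by
      rw [← sq_abs j] at this
      nlinarith
    exact (PowerSeries.X_pow_dvd_iff.1 (mz_dvd _ _ (16 * n) (by push_cast; exact h3))) m hm
  rw [h1.unique h2, Finset.sum_image]
  intro a _ b _ h
  simp only at h
  omega

/-- approximate Jacobi triple product -/
lemma jtp (s : Fin 4) (n : ℕ) (hn : 0 < n) : (X ^ (16 * n) : PowerSeries ℤ) ∣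
    pp (4 * s + 1) n * qp (X ^ 16 : PowerSeries ℤ) n - jt s := by
  have h1 := jt_trunc s n hn
  have h2 : (X ^ (16 * n) : PowerSeries ℤ) ∣ pp (4 * s + 1) n * qp (X ^ 16 : PowerSeries ℤ) n -
      ∑ r ∈ Finset.range (2 * n + 1), mz (the s (r - n)) (eps (r - n)) := by
    rw [pp_eq s n hn, Finset.sum_mul, ← Finset.sum_sub_distrib]
    apply Finset.dvd_sum
    intro r hr
    have hr := Finset.mem_range.1 hr
    set m := min r (2 * n - r) with hm
    have h3 := gb_approx 16 n r (2 * n - r) (by norm_num) (by omega) m (by omega) (by omega)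
    rw [← pow_mul] at h3
    set M := 16 * n - 16 * (m + 1) with hM
    have h4 : (X ^ M : PowerSeries ℤ) ∣ mz (the s (r - n)) (eps (r - n)) := by
      apply mz_dvd
      have := the_bd s (r - n)
      have h0 := the_nonneg s (r - n)
      have hmm : (m : ℤ) = n - |(r : ℤ) - n| := by
        rcases abs_cases ((r : ℤ) - n) with ⟨h, h0⟩ | ⟨h, h0⟩ <;> rw [h] <;> omega
      rw [← sq_abs] at this
      have habs := abs_nonneg ((r : ℤ) - n)
      generalize |(r : ℤ) - n| = y at *
      have : 8 * y ^ 2 - 23 * y + 16 ≥ 0 := by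
        rcases le_or_gt y 1 with c | c
        · have : y = 0 ∨ y = 1 := by omega
          rcases this with rfl | rfl <;> norm_num
        · nlinarith
      omega
    have h5 := mul_dvd_mul h4 h3
    rw [← pow_add] at h5
    have h6 : (X ^ (16 * n) : PowerSeries ℤ) ∣ X ^ (M + 16 * (m + 1)) := pow_dvd_pow _ (by omega)
    refine (h6.trans h5).trans (dvd_of_eq (by ring))
  have := dvd_sub h2 h1
  refine this.trans (dvd_of_eq (by ring))

/-- non-negative coefficients -/
def Nn (f : PowerSeries ℤ) : Prop := ∀ n, 0 ≤ PowerSeries.coeff n f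

lemma Nn.add {f g : PowerSeries ℤ} (hf : Nn f) (hg : Nn g) : Nn (f + g) := fun n => by
  rw [map_add]; exact add_nonneg (hf n) (hg n)
lemma Nn.mul {f g : PowerSeries ℤ} (hf : Nn f) (hg : Nn g) : Nn (f * g) := fun n => by
  rw [PowerSeries.coeff_mul]
  exact Finset.sum_nonneg (fun x _ => mul_nonneg (hf _) (hg _))
lemma Nn.zero : Nn 0 := fun n => by simp
lemma Nn.one : Nn 1 := fun n => by rw [PowerSeries.coeff_one]; split_ifs <;> norm_num
lemma Nn.X_pow (k : ℕ) : Nn (X ^ k) := fun n => by rw [PowerSeries.coeff_X_pow]; split_ifs <;> norm_num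
lemma Nn.geo (D : ℕ) : Nn (geo D) := fun n => by rw [_root_.geo, PowerSeries.coeff_mk]; split_ifs <;> norm_num
lemma Nn.prod {ι : Type*} (s : Finset ι) (f : ι → PowerSeries ℤ) (h : ∀ i, Nn (f i)) : Nn (∏ i ∈ s, f i) :=
  Finset.prod_induction f Nn (fun _ _ => Nn.mul) Nn.one (fun i _ => h i)
lemma Nn.sum {ι : Type*} (s : Finset ι) (f : ι → PowerSeries ℤ) (h : ∀ i, Nn (f i)) : Nn (∑ i ∈ s, f i) :=
  Finset.sum_induction f Nn (fun _ _ => Nn.add) Nn.zero (fun i _ => h i)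

lemma geo_zero (D : ℕ) : PowerSeries.coeff 0 (geo D) = 1 := by simp [geo]

lemma geo_nn (a i : ℕ) (ha : 0 < a) : Nn (geo a * (1 - X ^ (a * i))) := by
  have : geo a * (1 - X ^ (a * i)) = ∑ l ∈ Finset.range i, (X ^ a) ^ l := by
    have h1 := geo_mul a ha
    have h2 := mul_neg_geom_sum (X ^ a : PowerSeries ℤ) i
    rw [pow_mul]
    linear_combination geo a * (-h2) + (∑ l ∈ Finset.range i, (X ^ a : PowerSeries ℤ) ^ l) * h1
  rw [this]
  apply Nn.sum
  intro l
  rw [← pow_mul]; exact Nn.X_pow _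

def mem (a b d : ℕ) : Prop := ∃ i j, d = a * i + b * j

lemma cone_one (a b d : ℕ) (ha : 0 < a) (hb : 0 < b) (hd : mem a b d) : Nn (geo a * geo b * (1 - X ^ d)) := by
  obtain ⟨i, j, rfl⟩ := hd
  have : geo a * geo b * (1 - X ^ (a * i + b * j)) = geo b * (geo a * (1 - X ^ (a * i))) +
      X ^ (a * i) * geo a * (geo b * (1 - X ^ (b * j))) := by rw [pow_add]; ring
  rw [this]
  exact ((Nn.geo b).mul (geo_nn a i ha)).add (((Nn.X_pow _).mul (Nn.geo a)).mul (geo_nn b j hb))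

/-- cone of series that become non-negative after division by `(1-x^a)(1-x^b)`, positive at `T` -/
def SC (a b : ℕ) (T : Set ℕ) (f : PowerSeries ℤ) : Prop :=
  Nn (geo a * geo b * f) ∧ ∀ K ∈ T, 0 < PowerSeries.coeff K (geo a * geo b * f)

lemma SC.mono {a b : ℕ} {T T' : Set ℕ} {f : PowerSeries ℤ} (h : SC a b T f) (hT : T' ⊆ T) : SC a b T' f :=
  ⟨h.1, fun K hK => h.2 K (hT hK)⟩
lemma SC.empty {a b : ℕ} {T : Set ℕ} {f : PowerSeries ℤ} (h : SC a b T f) : SC a b ∅ f := h.mono (Set.empty_subset _)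

lemma SC.add {a b : ℕ} {T T' : Set ℕ} {f g : PowerSeries ℤ} (hf : SC a b T f) (hg : SC a b T' g) :
    SC a b (T ∪ T') (f + g) := by
  refine ⟨?_, ?_⟩
  · rw [mul_add]; exact hf.1.add hg.1
  · rintro K (h | h) <;> rw [mul_add, map_add]
    · exact add_pos_of_pos_of_nonneg (hf.2 K h) (hg.1 K)
    · exact add_pos_of_nonneg_of_pos (hf.1 K) (hg.2 K h)

lemma SC.add0 {a b : ℕ} {f g : PowerSeries ℤ} (hf : SC a b ∅ f) (hg : SC a b ∅ g) : SC a b ∅ (f + g) := (hf.add hg).empty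

lemma SC.of_nn {a b : ℕ} {f : PowerSeries ℤ} (h : Nn f) : SC a b ∅ f :=
  ⟨((Nn.geo a).mul (Nn.geo b)).mul h, fun _ h => absurd h (Set.notMem_empty _)⟩

lemma SC.nn_mul {a b : ℕ} {f g : PowerSeries ℤ} (hg : Nn g) (h : SC a b ∅ f) : SC a b ∅ (g * f) := by
  refine ⟨?_, fun _ h => absurd h (Set.notMem_empty _)⟩
  have := hg.mul h.1
  rwa [mul_left_comm] at this

lemma SC.pair {a b : ℕ} (ha : 0 < a) (hb : 0 < b) (K d : ℕ) (g : PowerSeries ℤ) (hd : mem a b d) (hg : Nn g) :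
    SC a b ∅ (X ^ K * (1 - X ^ d) * g) := by
  refine ⟨?_, fun _ h => absurd h (Set.notMem_empty _)⟩
  have := ((Nn.X_pow K).mul hg).mul (cone_one a b d ha hb hd)
  have e : geo a * geo b * (X ^ K * (1 - X ^ d) * g) = X ^ K * g * (geo a * geo b * (1 - X ^ d)) := by ring
  rwa [e]

lemma SC.pair1 {a b : ℕ} (ha : 0 < a) (hb : 0 < b) (K d : ℕ) (g : PowerSeries ℤ) (hd : mem a b d) (hg : Nn g)
    (hd0 : 0 < d) (hg0 : PowerSeries.coeff 0 g = 1) : SC a b {K} (X ^ K * (1 - X ^ d) * g) := by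
  refine ⟨(SC.pair ha hb K d g hd hg).1, ?_⟩
  intro K' hK
  rw [Set.mem_singleton_iff.1 hK]
  have e : geo a * geo b * (X ^ K * (1 - X ^ d) * g) = X ^ K * (g * (geo a * geo b * (1 - X ^ d))) := by ring
  rw [e, PowerSeries.coeff_X_pow_mul', if_pos le_rfl, Nat.sub_self]
  rw [PowerSeries.coeff_zero_eq_constantCoeff_apply] at *
  have h1 := geo_zero a
  have h2 := geo_zero b
  rw [PowerSeries.coeff_zero_eq_constantCoeff_apply] at h1 h2
  have hx : constantCoeff (R := ℤ) (X ^ d) = 0 := by rw [map_pow, PowerSeries.constantCoeff_X, zero_pow (by omega)]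
  rw [map_mul, map_mul, map_mul, map_sub, h1, h2, hg0, hx]
  norm_num

lemma SC.monomial (a b m : ℕ) : SC a b {n | ∃ i j, n = m + a * i + b * j} (X ^ m) := by
  refine ⟨(SC.of_nn (Nn.X_pow m)).1, ?_⟩
  rintro _ ⟨i, j, rfl⟩
  rw [mul_comm (geo a * geo b) (X ^ m), PowerSeries.coeff_X_pow_mul', if_pos (by omega), PowerSeries.coeff_mul]
  apply Finset.sum_pos'
  · intro x _; exact mul_nonneg (Nn.geo a _) (Nn.geo b _)
  · refine ⟨(a * i, b * j), ?_, ?_⟩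
    · rw [Finset.HasAntidiagonal.mem_antidiagonal]; omega
    · simp [geo]

lemma SC.hasSum {a b : ℕ} {ι : Type*} {f : ι → PowerSeries ℤ} {s : PowerSeries ℤ} {T : ι → Set ℕ} (h : HasSum f s)
    (F : Finset ι) (hf : ∀ u, u ∉ F → SC a b (T u) (f u)) : SC a b {K | ∃ u, u ∉ F ∧ K ∈ T u} (s - ∑ u ∈ F, f u) := by
  have h1 : HasSum (fun u => if u ∈ F then f u else 0) (∑ u ∈ F, f u) := by
    have : ∑ u ∈ F, f u = ∑ u ∈ F, (if u ∈ F then f u else 0) := Finset.sum_congr rfl (fun u hu => by simp [hu])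
    rw [this]
    apply hasSum_sum_of_ne_finset_zero
    intro u hu; simp [hu]
  have h2 := ((h.sub h1).mul_left (geo a * geo b))
  have h3 := (PowerSeries.WithPiTopology.hasSum_iff_hasSum_coeff ℤ).1 h2
  have h4 : ∀ u n, 0 ≤ PowerSeries.coeff n (geo a * geo b * (f u - if u ∈ F then f u else 0)) := by
    intro u n
    by_cases hu : u ∈ F
    · simp [hu]
    · simp only [hu, if_false, sub_zero]
      exact (hf u hu).1 n
  refine ⟨fun n => (h3 n).nonneg (fun u => h4 u n), ?_⟩
  rintro K ⟨u, hu, hK⟩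
  have h5 := le_hasSum (h3 K) u (fun v _ => h4 v K)
  refine lt_of_lt_of_le ?_ h5
  simp only [hu, if_false, sub_zero]
  exact (hf u hu).2 K hK

/-- group consecutive terms -/
lemma hasSum_pairs {f : ℕ → PowerSeries ℤ} {s : PowerSeries ℤ} (h : HasSum f s) :
    HasSum (fun p => f (2 * p) + f (2 * p + 1)) s := by
  have h1 : HasSum (fun x : ℕ × Fin 2 => f (2 * x.1 + x.2)) s := by
    have := ((Nat.divModEquiv 2).symm.hasSum_iff (f := f)).2 h
    refine hs_congr this ?_ rfl
    intro x
    simp [Nat.divModEquiv, Function.comp]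
    congr 1; ring
  refine h1.prod_fiberwise (fun p => ?_)
  have := hasSum_fintype (fun i : Fin 2 => f (2 * p + i))
  rw [Fin.sum_univ_two] at this
  exact this

/-- two progressions -/
lemma SC.prog2 {a b : ℕ} (ha : 0 < a) (hb : 0 < b) (α δ D E : ℕ) (hD : 0 < D) (hE : 0 < E) (h1 : mem a b δ) (h2 : mem a b E) :
    SC a b ∅ (X ^ α * geo D - X ^ (α + δ) * geo (D + E)) := by
  have e : X ^ α * geo D - X ^ (α + δ) * geo (D + E) = X ^ α * (1 - X ^ δ) * geo (D + E) +
      X ^ (α + D) * (1 - X ^ E) * (geo D * geo (D + E)) := by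
    have g1 := geo_mul D hD
    have g2 := geo_mul (D + E) (by omega)
    rw [pow_add] at g2
    rw [pow_add, pow_add]
    linear_combination X ^ α * geo D * (-g2) + X ^ α * geo (D + E) * g1
  rw [e]
  exact (SC.pair ha hb _ _ _ h1 (Nn.geo _)).add0 (SC.pair ha hb _ _ _ h2 ((Nn.geo _).mul (Nn.geo _)))

noncomputable def wf (k i : ℕ) : PowerSeries ℤ := geo (16 * i + k) * geo (16 * i + (16 - k)) * geo (16 * i + 16)

lemma wf_nn (k i : ℕ) : Nn (wf k i) := ((Nn.geo _).mul (Nn.geo _)).mul (Nn.geo _)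
lemma wf_zero (k i : ℕ) : PowerSeries.coeff 0 (wf k i) = 1 := by
  have h1 := geo_zero (16 * i + k)
  have h2 := geo_zero (16 * i + (16 - k))
  have h3 := geo_zero (16 * i + 16)
  rw [PowerSeries.coeff_zero_eq_constantCoeff_apply] at *
  rw [wf, map_mul, map_mul, h1, h2, h3]; norm_num

lemma wf_prod (k n : ℕ) (hk : 0 < k) (hk' : k < 16) :
    (∏ i ∈ Finset.range n, wf k i) * (pp k n * qp (X ^ 16 : PowerSeries ℤ) n) = 1 := by
  rw [pp, qp, ← Finset.prod_mul_distrib, ← Finset.prod_mul_distrib]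
  apply Finset.prod_eq_one
  intro i _
  have h1 := geo_mul (16 * i + k) (by omega)
  have h2 := geo_mul (16 * i + (16 - k)) (by omega)
  have h3 := geo_mul (16 * i + 16) (by omega)
  have e : ((X : PowerSeries ℤ) ^ 16) ^ (i + 1) = X ^ (16 * i + 16) := by rw [← pow_mul]; congr 1
  rw [wf, e]
  calc _ = ((1 - X ^ (16 * i + k)) * geo (16 * i + k)) * ((1 - X ^ (16 * i + (16 - k))) * geo (16 * i + (16 - k))) *
        ((1 - X ^ (16 * i + 16)) * geo (16 * i + 16)) := by ring
    _ = 1 := by rw [h1, h2, h3]; ring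

lemma gg_coeff (s : Fin 4) (n m : ℕ) (hm : m < 16 * n) :
    PowerSeries.coeff m (gg s) = PowerSeries.coeff m ((∏ i ∈ Finset.range n, wf (4 * s + 1) i) * (jt s * gg s)) := by
  obtain ⟨h, hh⟩ := jtp s n (by omega)
  have h1 := wf_prod (4 * s + 1) n (by omega) (by omega)
  have e : gg s = (∏ i ∈ Finset.range n, wf (4 * s + 1) i) * (jt s * gg s) +
      X ^ (16 * n) * ((∏ i ∈ Finset.range n, wf (4 * s + 1) i) * h * gg s) := by
    linear_combination (-gg s) * h1 + (∏ i ∈ Finset.range n, wf (4 * s + 1) i) * gg s * hh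
  conv_lhs => rw [e]
  rw [map_add, PowerSeries.coeff_X_pow_mul', if_neg (by omega), add_zero]

lemma coeff_mul_pos {V f : PowerSeries ℤ} (hV : Nn V) (h0 : PowerSeries.coeff 0 V = 1) (hf : Nn f) (K : ℕ) :
    PowerSeries.coeff K f ≤ PowerSeries.coeff K (V * f) := by
  rw [PowerSeries.coeff_mul]
  have := Finset.single_le_sum (f := fun p : ℕ × ℕ => PowerSeries.coeff p.1 V * PowerSeries.coeff p.2 f)
    (s := Finset.HasAntidiagonal.antidiagonal K) (fun p _ => mul_nonneg (hV _) (hf _)) (a := (0, K))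
    (by rw [Finset.HasAntidiagonal.mem_antidiagonal]; simp)
  simpa [h0] using this

lemma link (s : Fin 4) (c : ℤ) (T : Set ℕ) (h : SC (4 * s + 1) (16 - (4 * s + 1)) T ((c : PowerSeries ℤ) * (jt s * gg s)))
    (K : ℕ) (hK : K ∈ T) : 0 < c * PowerSeries.coeff K (gg s) := by
  set k : ℕ := 4 * s + 1 with hk
  have e := gg_coeff s (K + 1) K (by omega)
  rw [← hk, Finset.prod_range_succ'] at e
  set V := (∏ i ∈ Finset.range K, wf k (i + 1)) * geo 16 with hV
  have hVn : Nn V := (Nn.prod _ _ (fun i => wf_nn _ _)).mul (Nn.geo _)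
  have hV0 : PowerSeries.coeff 0 V = 1 := by
    have h3 := geo_zero 16
    have h2 := fun i => wf_zero k (i + 1)
    simp only [PowerSeries.coeff_zero_eq_constantCoeff_apply] at *
    rw [hV, map_mul, h3, map_prod, Finset.prod_eq_one (fun i _ => h2 i)]; norm_num
  have e2 : PowerSeries.coeff K (V * (geo k * geo (16 - k) * ((c : PowerSeries ℤ) * (jt s * gg s)))) =
      c * PowerSeries.coeff K (gg s) := by
    rw [e, ← PowerSeries.coeff_C_mul]
    congr 1
    rw [hV, wf]
    simp only [mul_zero, zero_add]
    have : PowerSeries.C c = (c : PowerSeries ℤ) := by simp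
    rw [this]
    ring
  rw [← e2]
  exact lt_of_lt_of_le (h.2 K hK) (coeff_mul_pos hVn hV0 h.1 K)

lemma mem_lin (a b i j d : ℕ) (h : d = a * i + b * j) : mem a b d := ⟨i, j, h⟩

lemma apA_succ (s : Fin 4) (u : ℕ) : apA s (u + 1) = apA s u + (16 * u + 17 + 4 * s) := by
  fin_cases s <;> simp [apA] <;> ring
lemma apB_succ (s : Fin 4) (u : ℕ) : apB s (u + 1) = apB s u + (16 * u + 31 - 4 * s) := by
  fin_cases s <;> simp [apB] <;> ring_nf <;> omega

lemma geo_split (D m : ℕ) (hD : 0 < D) (hm : 0 < m) : geo D = (∑ l ∈ Finset.range m, X ^ (D * l)) * geo (D * m) := by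
  have h1 := geo_mul D hD
  have h2 := geo_mul (D * m) (by positivity)
  have h3 := mul_neg_geom_sum (X ^ D : PowerSeries ℤ) m
  simp only [← pow_mul] at h3
  linear_combination (-geo D) * h2 - geo D * geo (D * m) * h3 + (∑ l ∈ Finset.range m, X ^ (D * l)) * geo (D * m) * h1

lemma ap_pairs (s : Fin 4) : HasSum (fun p : ℕ => 2 * ((X ^ apA s (2 * p) * geo (32 * p + 8) - X ^ apA s (2 * p + 1) * geo (32 * p + 24)) +
    (X ^ apB s (2 * p) * geo (32 * p + 8) - X ^ apB s (2 * p + 1) * geo (32 * p + 24))))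
    ((sgo s : PowerSeries ℤ) * rescale (-1 : ℤ) (AP s)) := by
  refine hs_congr (hasSum_pairs (hs_AP s)) (fun p => ?_) rfl
  have e1 : 16 * (2 * p) + 8 = 32 * p + 8 := by ring
  have e2 : 16 * (2 * p + 1) + 8 = 32 * p + 24 := by ring
  have e3 : (-1 : ℤ) ^ (2 * p) = 1 := by rw [pow_mul]; norm_num
  have e4 : (-1 : ℤ) ^ (2 * p + 1) = -1 := by rw [pow_succ, e3]; norm_num
  rw [e1, e2, e3, e4]
  push_cast
  ring

lemma nn_two : Nn (2 : PowerSeries ℤ) := by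
  have := Nn.one.add Nn.one
  rwa [one_add_one_eq_two] at this

lemma ap_pair_sc (s : Fin 4) (p : ℕ) : SC (4 * s + 1) (16 - (4 * s + 1)) ∅ (2 * ((X ^ apA s (2 * p) * geo (32 * p + 8) - X ^ apA s (2 * p + 1) * geo (32 * p + 24)) +
    (X ^ apB s (2 * p) * geo (32 * p + 8) - X ^ apB s (2 * p + 1) * geo (32 * p + 24)))) := by
  have m16 : mem (4 * s + 1) (16 - (4 * s + 1)) 16 := ⟨1, 1, by omega⟩
  refine SC.nn_mul nn_two (SC.add0 ?_ ?_)
  · rw [apA_succ]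
    exact SC.prog2 (by omega) (by omega) _ _ (32 * p + 8) 16 (by omega) (by omega) ⟨2 * p + 2, 2 * p + 1, by
      fin_cases s <;> simp <;> ring⟩ m16
  · rw [apB_succ]
    exact SC.prog2 (by omega) (by omega) _ _ (32 * p + 8) 16 (by omega) (by omega) ⟨2 * p + 1, 2 * p + 2, by
      fin_cases s <;> simp <;> omega⟩ m16

lemma ap_free (s : Fin 4) : SC (4 * s + 1) (16 - (4 * s + 1)) ∅ ((sgo s : PowerSeries ℤ) * rescale (-1 : ℤ) (AP s)
    - 2 * (X ^ apA s 0 + X ^ (apA s 0 + 8) + X ^ apB s 0 + X ^ (apB s 0 + 8)) * geo 24) := by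
  have h := SC.hasSum (T := fun _ => ∅) (ap_pairs s) {0} (fun p _ => ap_pair_sc s p)
  rw [Finset.sum_singleton] at h
  have ma : mem (4 * s + 1) (16 - (4 * s + 1)) (4 * s + 1) := ⟨1, 0, by omega⟩
  have mb : mem (4 * s + 1) (16 - (4 * s + 1)) (16 - (4 * s + 1)) := ⟨0, 1, by omega⟩
  have h2 := (SC.pair (by omega) (by omega) (apA s 0 + 16) _ (geo 24) ma (Nn.geo _)).add0
    (SC.pair (by omega) (by omega) (apB s 0 + 16) _ (geo 24) mb (Nn.geo _))
  have h3 := h.empty.add0 (SC.nn_mul nn_two h2)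
  have e1 : apA s (2 * 0 + 1) = apA s 0 + 16 + (4 * s + 1) := by rw [Nat.mul_zero, apA_succ]; ring
  have e2 : apB s (2 * 0 + 1) = apB s 0 + 16 + (16 - (4 * s + 1)) := by rw [Nat.mul_zero, apB_succ]; omega
  have e3 := geo_split 8 3 (by norm_num) (by norm_num)
  simp only [Finset.sum_range_succ, Finset.sum_range_zero] at e3
  norm_num at e3
  rw [e1, e2] at h3
  convert h3 using 1
  simp only [mul_zero, zero_add]
  rw [e3]
  simp only [pow_add]
  ring

lemma lam (s : Fin 4) : ((sgo s : ℤ) : PowerSeries ℤ) * (jt s * gg s) = (sgo s : PowerSeries ℤ) * rescale (-1 : ℤ) (AP s)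
    + (sgo s : PowerSeries ℤ) * (ET s 0 + ET s 1 - ET s 2 - ET s 3) := by rw [jt_gg]; ring

/-- the Eisenstein part, summed over `u` -/
lemma hs_E (s : Fin 4) (t : Fin 4 → ℕ) (h : ∀ q : Fin 4, (tv s q : ℤ) = oo s + 2 * t q) :
    HasSum (fun u : ℕ => (sgo s : PowerSeries ℤ) * ((X ^ (t 0 + u * tv s 0) + X ^ (t 1 + u * tv s 1) -
      X ^ (t 2 + u * tv s 2) - X ^ (t 3 + u * tv s 3)) * geo (16 * u + 8)))
      ((sgo s : PowerSeries ℤ) * (ET s 0 + ET s 1 - ET s 2 - ET s 3)) := by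
  have h0 := ET_c s 0 (t 0) (h 0)
  have h1 := ET_c s 1 (t 1) (h 1)
  have h2 := ET_c s 2 (t 2) (h 2)
  have h3 := ET_c s 3 (t 3) (h 3)
  refine hs_congr ((((h0.add h1).sub h2).sub h3).mul_left (sgo s : PowerSeries ℤ)) (fun u => ?_) rfl
  simp only [Fin.val_zero, Fin.val_one, Fin.val_two, show ((3 : Fin 4) : ℕ) = 3 from rfl]
  ring

lemma SC.congr {a b : ℕ} {T T' : Set ℕ} {f g : PowerSeries ℤ} (h : SC a b T f) (hT : T' ⊆ T) (e : g = f) : SC a b T' g := by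
  rw [e]; exact h.mono hT

lemma mem97 (d : ℕ) (h : 9 * ((4 * d) % 7) ≤ d) : mem 9 7 d :=
  ⟨(4 * d) % 7, (d - 9 * ((4 * d) % 7)) / 7, by omega⟩

lemma E2_sc (u : ℕ) (hu : u ≠ 0) : SC 9 7 {u} (((1 : ℤ) : PowerSeries ℤ) * ((X ^ (0 + u * 1) + X ^ (2 + u * 5) -
      X ^ (5 + u * 11) - X ^ (7 + u * 15)) * geo (16 * u + 8))) := by
  rcases (show u = 1 ∨ 2 ≤ u by omega) with rfl | h
  · have h1 := (SC.pair1 (a := 9) (b := 7) (by norm_num) (by norm_num) 1 21 (geo 24) (mem97 _ (by norm_num)) (Nn.geo _) (by norm_num)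
      (geo_zero _)).add (SC.pair (by norm_num) (by norm_num) 7 9 (geo 24) (mem97 _ (by norm_num)) (Nn.geo _))
    rw [Set.union_empty] at h1
    convert h1 using 1
    norm_num
    ring
  · have hm : mem 9 7 (10 * u + 5) := mem97 _ (by
      rcases (show u = 2 ∨ u = 3 ∨ u = 4 ∨ 5 ≤ u by omega) with rfl | rfl | rfl | h <;> omega)
    have h1 := (SC.pair1 (by norm_num) (by norm_num) u _ (geo (16 * u + 8)) hm (Nn.geo _) (by omega)
      (geo_zero _)).add (SC.pair (by norm_num) (by norm_num) (2 + u * 5) _ (geo (16 * u + 8)) hm (Nn.geo _))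
    rw [Set.union_empty] at h1
    convert h1 using 1
    have e1 : 5 + u * 11 = u + (10 * u + 5) := by ring
    have e2 : 7 + u * 15 = (2 + u * 5) + (10 * u + 5) := by ring
    rw [e1, e2, pow_add X u, pow_add X (2 + u * 5)]
    push_cast
    ring

lemma fin2 : SC 9 7 ∅ (2 * (X ^ 6 + X ^ 14 + X ^ 5 + X ^ 13) * geo 24 + (1 + X ^ 2 - X ^ 5 - X ^ 7) * geo 8) := by
  have P := fun (K d : ℕ) (g : PowerSeries ℤ) (h : 9 * ((4 * d) % 7) ≤ d) (hg : Nn g) =>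
    SC.pair (a := 9) (b := 7) (by norm_num) (by norm_num) K d g (mem97 d h) hg
  have h1 := P 0 7 (geo 8) (by norm_num) (Nn.geo _)
  have h2 := P 2 27 (geo 8) (by norm_num) (Nn.geo _)
  have h3 := P 14 7 1 (by norm_num) Nn.one
  have h4 : SC 9 7 ∅ (2 * X ^ 6 * geo 24 + X ^ 14 * geo 24 + X ^ 38 * geo 24 + X ^ 5 * geo 24 + X ^ 13 * geo 24
    + X ^ 29 * geo 24 + X ^ 37 * geo 24) := by
    have := fun k => (Nn.X_pow k).mul (Nn.geo 24)
    exact SC.of_nn (((((((nn_two.mul (Nn.X_pow _)).mul (Nn.geo _)).add (this _)).add (this _)).add (this _)).add (this _)).add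
      (this _)|>.add (this _))
  have h := ((h1.add0 h2).add0 h3).add0 h4
  convert h using 1
  have g1 := geo_mul 8 (by norm_num)
  have g2 := geo_mul 24 (by norm_num)
  linear_combination (-X ^ 5 - X ^ 13 - X ^ 21) * g1 + (X ^ 14 + X ^ 5 + X ^ 13) * g2

lemma pos2 (K : ℕ) (hK : K ≠ 0) : 0 < PowerSeries.coeff K (gg 2) := by
  have hE := hs_E 2 ![0, 2, 5, 7] (by decide)
  have h1 := SC.hasSum (T := fun u => {u}) hE {0} (fun u hu => E2_sc u (by simpa using hu))
  rw [Finset.sum_singleton] at h1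
  have h2 := (h1.add (ap_free 2)).add fin2
  have h3 := link 2 (sgo (2 : Fin 4)) {K | K ≠ 0} (by
    rw [lam 2]
    refine SC.congr h2 ?_ ?_
    · intro K hK
      exact Or.inl (Or.inl ⟨K, by simpa using hK, rfl⟩)
    · simp [apA, apB, tv, sgo]
      ring) K hK
  simpa [sgo] using h3

lemma mem511 (d : ℕ) (h : 11 * (d % 5) ≤ d) : mem 5 11 d :=
  ⟨(d - 11 * (d % 5)) / 5, d % 5, by omega⟩

noncomputable def E1f (u : ℕ) : PowerSeries ℤ := ((1 : ℤ) : PowerSeries ℤ) * ((X ^ (0 + u * 1) + X ^ (6 + u * 13) -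
      X ^ (1 + u * 3) - X ^ (7 + u * 15)) * geo (16 * u + 8))

lemma S1p (K d D : ℕ) (h : 11 * (d % 5) ≤ d) : SC 5 11 ∅ (X ^ K * (1 - X ^ d) * geo D) :=
  SC.pair (by norm_num) (by norm_num) K d _ (mem511 d h) (Nn.geo _)
lemma S1q (K d : ℕ) (h : 11 * (d % 5) ≤ d) : SC 5 11 ∅ (X ^ K * (1 - X ^ d)) := by
  have := SC.pair (a := 5) (b := 11) (by norm_num) (by norm_num) K d _ (mem511 d h) Nn.one
  rwa [mul_one] at this

lemma E1_sc (u : ℕ) (hu : u ∉ ({0, 1, 3, 4, 6, 8, 9, 11, 14, 19} : Finset ℕ)) : SC 5 11 {u} (E1f u) := by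
  have hm : 11 * ((2 * u + 1) % 5) ≤ 2 * u + 1 := by
    simp only [Finset.mem_insert, Finset.mem_singleton] at hu
    rcases (show u < 22 ∨ 22 ≤ u by omega) with h | h
    · interval_cases u <;> simp at hu ⊢
    · omega
  have h1 := (SC.pair1 (by norm_num) (by norm_num) u _ (geo (16 * u + 8)) (mem511 _ hm) (Nn.geo _) (by omega)
      (geo_zero _)).add (S1p (6 + u * 13) (2 * u + 1) (16 * u + 8) hm)
  rw [Set.union_empty] at h1
  refine h1.congr (le_refl _) ?_
  have e1 : 1 + u * 3 = u + (2 * u + 1) := by ring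
  have e2 : 7 + u * 15 = (6 + u * 13) + (2 * u + 1) := by ring
  rw [E1f, e1, e2, pow_add X u, pow_add X (6 + u * 13)]
  push_cast
  ring

lemma E1_ex (u : ℕ) (h7 : 11 * ((14 * u + 7) % 5) ≤ 14 * u + 7) (h3 : 11 * ((6 * u + 3) % 5) ≤ 6 * u + 3) :
    SC 5 11 {u} (E1f u + X ^ (1 + u * 3)) := by
  have h1 := (SC.pair1 (by norm_num) (by norm_num) u _ (geo (16 * u + 8)) (mem511 _ h7) (Nn.geo _) (by omega)
      (geo_zero _)).add (S1p (6 + u * 13) (6 * u + 3) (16 * u + 8) h3)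
  rw [Set.union_empty] at h1
  refine h1.congr (le_refl _) ?_
  have g := geo_mul (16 * u + 8) (by omega)
  have e1 : X ^ (7 + u * 15) = (X ^ u * X ^ (14 * u + 7) : PowerSeries ℤ) := by rw [← pow_add]; congr 1; ring
  have e2 : (X ^ (1 + u * 3) * X ^ (16 * u + 8) : PowerSeries ℤ) = X ^ (6 + u * 13) * X ^ (6 * u + 3) := by
    rw [← pow_add, ← pow_add]; congr 1; ring
  rw [E1f, e1, zero_add, mul_one]
  push_cast
  linear_combination (-X ^ (1 + u * 3)) * g - geo (16 * u + 8) * e2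

lemma E1_0 : SC 5 11 ∅ (E1f 0 - 1 + X ^ 7 + X ^ 15 + X + X ^ 9) := by
  refine ((S1p 8 15 8 (by norm_num)).add0 (S1p 6 11 8 (by norm_num))).congr (le_refl _) ?_
  have g := geo_mul 8 (by norm_num)
  simp only [E1f]
  norm_num
  linear_combination (1 - X ^ 7 - X ^ 15 - X - X ^ 9) * g
lemma E1_1 : SC 5 11 ∅ (E1f 1 - X + X ^ 4 + X ^ 28 + X ^ 22) := by
  refine ((S1p 25 27 24 (by norm_num)).add0 (S1p 19 27 24 (by norm_num))).congr (le_refl _) ?_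
  have g := geo_mul 24 (by norm_num)
  simp only [E1f]
  norm_num
  linear_combination (X - X ^ 4 - X ^ 28 - X ^ 22) * g
lemma E1_3 : SC 5 11 ∅ (E1f 3 - X ^ 3 + X ^ 52 + X ^ 10) := by
  refine ((S1p 59 49 56 (by norm_num)).add0 (S1p 45 21 56 (by norm_num))).congr (le_refl _) ?_
  have g := geo_mul 56 (by norm_num)
  simp only [E1f]
  norm_num
  linear_combination (X ^ 3 - X ^ 52 - X ^ 10) * g
lemma E1_4 : SC 5 11 ∅ (E1f 4 - X ^ 4 + X ^ 67 + X ^ 13) := by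
  refine ((S1p 76 63 72 (by norm_num)).add0 (S1p 58 27 72 (by norm_num))).congr (le_refl _) ?_
  have g := geo_mul 72 (by norm_num)
  simp only [E1f]
  norm_num
  linear_combination (X ^ 4 - X ^ 67 - X ^ 13) * g
lemma E1_6 : SC 5 11 ∅ (E1f 6 + X ^ 19 + X ^ 123) := by
  refine ((S1p 6 91 104 (by norm_num)).add0 (S1p 84 143 104 (by norm_num))).congr (le_refl _) ?_
  have g := geo_mul 104 (by norm_num)
  simp only [E1f]
  norm_num
  linear_combination (-X ^ 19 - X ^ 123) * g

lemma fin1 : SC 5 11 {3} (2 * (X ^ 4 + X ^ 12 + X ^ 7 + X ^ 15) * geo 24 + 1 + X + X ^ 3 + X ^ 4 - (X ^ 7 + X ^ 15 + X + X ^ 9)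
    - (X ^ 4 + X ^ 28 + X ^ 22) - (X ^ 52 + X ^ 10) - (X ^ 67 + X ^ 13) - (X ^ 19 + X ^ 123) - X ^ 25 - X ^ 28 - X ^ 34 - X ^ 43 - X ^ 58) := by
  have h0 := SC.pair1 (a := 5) (b := 11) (by norm_num) (by norm_num) 3 10 1 (mem511 _ (by norm_num)) Nn.one (by norm_num)
      (by simp)
  rw [mul_one] at h0
  have h1 := ((((S1q 4 15 (by norm_num)).add0 (S1q 12 16 (by norm_num))).add0 (S1q 12 22 (by norm_num))).add0
    (S1q 28 15 (by norm_num))).add0 (S1q 36 22 (by norm_num))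
  have h2 := ((((S1q 52 15 (by norm_num)).add0 (S1q 7 15 (by norm_num))).add0 (S1q 15 10 (by norm_num))).add0
    (S1q 63 60 (by norm_num))).add0 ((S1q 0 10 (by norm_num)).add0 (S1q 4 5 (by norm_num)))
  have n := fun k => nn_two.mul ((Nn.X_pow k).mul (Nn.geo 24))
  have h3 : SC 5 11 ∅ _ := SC.of_nn ((n 76).add (n 60) |>.add (n 31) |>.add (n 87) |>.add (Nn.X_pow 36) |>.add (Nn.X_pow 39)
    |>.add (Nn.X_pow 39) |>.add (Nn.X_pow 63))
  have h := h0.add ((h1.add0 h2).add0 h3)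
  rw [Set.union_empty] at h
  refine h.congr (le_refl _) ?_
  have g := geo_mul 24 (by norm_num)
  linear_combination (2 * X ^ 4 * (1 + X ^ 24 + X ^ 48) + 2 * X ^ 12 * (1 + X ^ 24) + 2 * X ^ 7 + 2 * X ^ 15 * (1 + X ^ 24 + X ^ 48)) * g

lemma pos1 (K : ℕ) (hK : K % 2 = 1) (hK3 : 3 ≤ K) : 0 < PowerSeries.coeff K (gg 1) := by
  have hE := hs_E 1 ![0, 6, 1, 7] (by decide)
  have h1 := SC.hasSum (T := fun u => {u}) hE {0, 1, 3, 4, 6, 8, 9, 11, 14, 19} (fun u hu => E1_sc u hu)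
  have hs : (∑ u ∈ ({0, 1, 3, 4, 6, 8, 9, 11, 14, 19} : Finset ℕ), E1f u) =
    E1f 0 + E1f 1 + E1f 3 + E1f 4 + E1f 6 + E1f 8 + E1f 9 + E1f 11 + E1f 14 + E1f 19 := by
    repeat rw [Finset.sum_insert (by simp)]
    rw [Finset.sum_singleton]
    ring
  have h1 : SC 5 11 {K | ∃ u, u ∉ ({0, 1, 3, 4, 6, 8, 9, 11, 14, 19} : Finset ℕ) ∧ K ∈ ({u} : Set ℕ)}
      ((sgo (1 : Fin 4) : PowerSeries ℤ) * (ET (1 : Fin 4) 0 + ET (1 : Fin 4) 1 - ET (1 : Fin 4) 2 - ET (1 : Fin 4) 3)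
        - ∑ u ∈ ({0, 1, 3, 4, 6, 8, 9, 11, 14, 19} : Finset ℕ), E1f u) := h1
  rw [hs] at h1
  have h2 := (((E1_0.add0 E1_1).add0 (E1_3.add0 E1_4)).add0 E1_6).add0 (ap_free 1)
  have h3 := ((((E1_ex 8 (by norm_num) (by norm_num)).add (E1_ex 9 (by norm_num) (by norm_num))).add
    (E1_ex 11 (by norm_num) (by norm_num))).add (E1_ex 14 (by norm_num) (by norm_num))).add (E1_ex 19 (by norm_num) (by norm_num))
  have h4 := (h1.add h2).add (h3.add fin1)
  have h5 := link 1 (sgo (1 : Fin 4)) {K | K % 2 = 1 ∧ 3 ≤ K} (by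
    rw [lam 1]
    refine SC.congr h4 ?_ ?_
    · rintro K ⟨hK, hK3⟩
      by_cases hF : K ∈ ({0, 1, 3, 4, 6, 8, 9, 11, 14, 19} : Finset ℕ)
      · simp only [Finset.mem_insert, Finset.mem_singleton] at hF
        simp only [Set.mem_union, Set.mem_singleton_iff]
        right
        omega
      · exact Or.inl (Or.inl ⟨K, hF, rfl⟩)
    · simp [apA, apB]
      ring) K ⟨hK, hK3⟩
  simpa [sgo] using h5

lemma mem133 (d : ℕ) (h : 13 * (d % 3) ≤ d) : mem 13 3 d :=
  ⟨d % 3, (d - 13 * (d % 3)) / 3, by omega⟩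

noncomputable def E3f (u : ℕ) : PowerSeries ℤ := ((-1 : ℤ) : PowerSeries ℤ) * ((X ^ (2 + u * 7) + X ^ (4 + u * 11) -
      X ^ (1 + u * 5) - X ^ (3 + u * 9)) * geo (16 * u + 8))

lemma S3p (K d D : ℕ) (h : 13 * (d % 3) ≤ d) : SC 13 3 ∅ (X ^ K * (1 - X ^ d) * geo D) :=
  SC.pair (by norm_num) (by norm_num) K d _ (mem133 d h) (Nn.geo _)
lemma S3q (K d : ℕ) (h : 13 * (d % 3) ≤ d) : SC 13 3 ∅ (X ^ K * (1 - X ^ d)) := by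
  have := SC.pair (a := 13) (b := 3) (by norm_num) (by norm_num) K d _ (mem133 d h) Nn.one
  rwa [mul_one] at this

lemma E3_sc (u : ℕ) (hu : u ∉ ({0, 2, 3, 5, 8, 11} : Finset ℕ)) : SC 13 3 {1 + u * 5, 3 + u * 9} (E3f u) := by
  have hm : 13 * ((2 * u + 1) % 3) ≤ 2 * u + 1 := by
    simp only [Finset.mem_insert, Finset.mem_singleton] at hu
    rcases (show u < 13 ∨ 13 ≤ u by omega) with h | h
    · interval_cases u <;> simp at hu ⊢
    · omega
  have h1 := (SC.pair1 (by norm_num) (by norm_num) (1 + u * 5) _ (geo (16 * u + 8)) (mem133 _ hm) (Nn.geo _) (by omega)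
      (geo_zero _)).add (SC.pair1 (by norm_num) (by norm_num) (3 + u * 9) _ (geo (16 * u + 8)) (mem133 _ hm) (Nn.geo _) (by omega)
      (geo_zero _))
  refine h1.congr (le_refl _) ?_
  have e1 : 2 + u * 7 = (1 + u * 5) + (2 * u + 1) := by ring
  have e2 : 4 + u * 11 = (3 + u * 9) + (2 * u + 1) := by ring
  rw [E3f, e1, e2, pow_add X (1 + u * 5), pow_add X (3 + u * 9)]
  push_cast
  ring

lemma E3_ex (u : ℕ) (h7 : 13 * ((14 * u + 7) % 3) ≤ 14 * u + 7) :
    SC 13 3 ∅ (E3f u + X ^ (2 + u * 7)) := by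
  have h1 := (S3p (1 + u * 5) (6 * u + 3) (16 * u + 8) (by omega)).add0 (S3p (3 + u * 9) (14 * u + 7) (16 * u + 8) h7)
  refine h1.congr (le_refl _) ?_
  have g := geo_mul (16 * u + 8) (by omega)
  have e1 : X ^ (4 + u * 11) = (X ^ (1 + u * 5) * X ^ (6 * u + 3) : PowerSeries ℤ) := by rw [← pow_add]; congr 1; ring
  have e2 : (X ^ (2 + u * 7) * X ^ (16 * u + 8) : PowerSeries ℤ) = X ^ (3 + u * 9) * X ^ (14 * u + 7) := by
    rw [← pow_add, ← pow_add]; congr 1; ring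
  rw [E3f, e1]
  push_cast
  linear_combination (-X ^ (2 + u * 7)) * g - geo (16 * u + 8) * e2

lemma E3_0 : SC 13 3 ∅ (E3f 0 + X ^ 2 + X ^ 10) := by
  refine ((S3p 1 3 8 (by norm_num)).add0 (S3p 3 15 8 (by norm_num))).congr (le_refl _) ?_
  have g := geo_mul 8 (by norm_num)
  simp only [E3f]
  norm_num
  linear_combination (-X ^ 2 - X ^ 10) * g

lemma fin3 : SC 13 3 {n | 18 ≤ n ∨ (7 ≤ n ∧ n % 3 = 1) ∨ (2 ≤ n ∧ n % 3 = 2)} (2 * (X ^ 7 + X ^ 15 + X ^ 2 + X ^ 10) * geo 24 - (X ^ 2 + X ^ 10)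
    - X ^ 16 - X ^ 23 - X ^ 37 - X ^ 58 - X ^ 79) := by
  have h0 := ((SC.monomial 13 3 2).add (SC.monomial 13 3 7)).add (SC.monomial 13 3 15)
  have h1 := ((((S3q 7 3 (by norm_num)).add0 (S3q 63 16 (by norm_num))).add0 (S3q 10 13 (by norm_num))).add0
    (S3q 10 6 (by norm_num))).add0 (S3q 34 3 (by norm_num))
  have n := fun k => nn_two.mul ((Nn.X_pow k).mul (Nn.geo 24))
  have m := Nn.X_pow
  have h3 : SC 13 3 ∅ _ := SC.of_nn ((n 31).add (n 87) |>.add (n 26) |>.add (n 82) |>.add (m 15) |>.add (m 39) |>.add (m 39)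
    |>.add (m 63) |>.add (m 34) |>.add (m 58))
  have h := h0.add (h1.add0 h3)
  refine h.congr ?_ ?_
  · intro K hK
    left
    have hK : 18 ≤ K ∨ (7 ≤ K ∧ K % 3 = 1) ∨ (2 ≤ K ∧ K % 3 = 2) := hK
    rcases (show K % 3 = 0 ∨ K % 3 = 1 ∨ K % 3 = 2 by omega) with h | h | h
    · exact Or.inr ⟨0, (K - 15) / 3, by omega⟩
    · exact Or.inl (Or.inr ⟨0, (K - 7) / 3, by omega⟩)
    · exact Or.inl (Or.inl ⟨0, (K - 2) / 3, by omega⟩)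
  · have g := geo_mul 24 (by norm_num)
    linear_combination (2 * X ^ 7 + 2 * X ^ 15 * (1 + X ^ 24 + X ^ 48) + 2 * X ^ 2 + 2 * X ^ 10 * (1 + X ^ 24 + X ^ 48)) * g

lemma pos3 (K : ℕ) (hK : K % 2 = 0) (hK3 : 6 ≤ K) : PowerSeries.coeff K (gg 3) < 0 := by
  have hE := hs_E 3 ![2, 4, 1, 3] (by decide)
  have h1 := SC.hasSum (T := fun u => {1 + u * 5, 3 + u * 9}) hE {0, 2, 3, 5, 8, 11} (fun u hu => E3_sc u hu)
  have hs : (∑ u ∈ ({0, 2, 3, 5, 8, 11} : Finset ℕ), E3f u) =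
    E3f 0 + E3f 2 + E3f 3 + E3f 5 + E3f 8 + E3f 11 := by
    repeat rw [Finset.sum_insert (by simp)]
    rw [Finset.sum_singleton]
    ring
  have h1 : SC 13 3 {K | ∃ u, u ∉ ({0, 2, 3, 5, 8, 11} : Finset ℕ) ∧ K ∈ ({1 + u * 5, 3 + u * 9} : Set ℕ)}
      ((sgo (3 : Fin 4) : PowerSeries ℤ) * (ET (3 : Fin 4) 0 + ET (3 : Fin 4) 1 - ET (3 : Fin 4) 2 - ET (3 : Fin 4) 3)
        - ∑ u ∈ ({0, 2, 3, 5, 8, 11} : Finset ℕ), E3f u) := h1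
  rw [hs] at h1
  have h2 := E3_0.add0 (ap_free 3)
  have h3 := ((((E3_ex 2 (by norm_num)).add0 (E3_ex 3 (by norm_num))).add0
    (E3_ex 5 (by norm_num))).add0 (E3_ex 8 (by norm_num))).add0 (E3_ex 11 (by norm_num))
  have h4 := (h1.add h2).add (h3.add fin3)
  have h5 := link 3 (sgo (3 : Fin 4)) {K | K % 2 = 0 ∧ 6 ≤ K} (by
    rw [lam 3]
    refine SC.congr h4 ?_ ?_
    · rintro K ⟨hK, hK3⟩
      rcases (show K = 6 ∨ K = 12 ∨ 18 ≤ K ∨ (7 ≤ K ∧ K % 3 = 1) ∨ (2 ≤ K ∧ K % 3 = 2) by omega) with rfl | rfl | h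
      · exact Or.inl (Or.inl ⟨1, by simp, by simp⟩)
      · exact Or.inl (Or.inl ⟨1, by simp, by simp⟩)
      · exact Or.inr (Or.inr h)
    · simp [apA, apB]
      ring) K ⟨hK, hK3⟩
  have h6 : sgo (3 : Fin 4) = -1 := rfl
  rw [h6] at h5
  have h7 : (0 : ℤ) < -1 * PowerSeries.coeff K (gg 3) := h5
  linarith

/-- coefficient of `x^n` in `x^α / ((1-x)(1-x^D))` -/
def tt (α D n : ℕ) : ℕ := (n + D - α) / D

lemma geo1_succ (f : PowerSeries ℤ) (n : ℕ) :
    PowerSeries.coeff (n + 1) (geo 1 * f) = PowerSeries.coeff n (geo 1 * f) + PowerSeries.coeff (n + 1) f := by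
  have h := geo_mul 1 (by norm_num)
  have e : f = geo 1 * f - X * (geo 1 * f) := by linear_combination (-f) * h
  have := congrArg (PowerSeries.coeff (n + 1)) e
  rw [map_sub, PowerSeries.coeff_succ_X_mul] at this
  linarith

lemma coeff_tt (α D : ℕ) (hD : 0 < D) (n : ℕ) :
    PowerSeries.coeff n (geo 1 * (X ^ α * geo D)) = (tt α D n : ℤ) := by
  induction n with
  | zero =>
    have h1 := geo_zero 1
    have h2 := geo_zero D
    rw [PowerSeries.coeff_zero_eq_constantCoeff_apply] at *
    rw [map_mul, map_mul, h1, h2, map_pow, PowerSeries.constantCoeff_X, tt]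
    rcases Nat.eq_zero_or_pos α with rfl | h
    · simp [Nat.div_self hD]
    · rw [zero_pow (by omega), Nat.div_eq_of_lt (by omega)]; norm_num
  | succ n ih =>
    rw [geo1_succ, ih, PowerSeries.coeff_X_pow_mul', geo, PowerSeries.coeff_mk]
    by_cases h : α ≤ n + 1
    · simp only [h, if_true]
      have e : tt α D (n + 1) = tt α D n + if D ∣ n + 1 - α then 1 else 0 := by
        rw [tt, tt]
        have e1 : n + 1 + D - α = (n + D - α) + 1 := by omega
        rw [e1, Nat.succ_div]
        congr 1
        have e2 : n + D - α + 1 = (n + 1 - α) + D := by omega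
        rw [e2]
        by_cases hd : D ∣ n + 1 - α
        · rw [if_pos hd, if_pos ((Nat.dvd_add_self_right).2 hd)]
        · rw [if_neg hd, if_neg (fun h => hd ((Nat.dvd_add_self_right).1 h))]
      rw [e]
      push_cast
      rfl
    · simp only [h, if_false]
      rw [tt, tt, Nat.div_eq_of_lt (by omega), Nat.div_eq_of_lt (by omega)]; norm_num

lemma tt_lo (α D n : ℕ) (hD : 0 < D) (h : α ≤ n) : ((n : ℚ) - α + 1) / D ≤ tt α D n := by
  rw [div_le_iff₀ (by exact_mod_cast hD)]
  have h1 := Nat.div_add_mod (n + D - α) D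
  have h2 := Nat.mod_lt (n + D - α) hD
  have h3 : n + 1 ≤ tt α D n * D + α := by rw [tt, mul_comm]; omega
  have : ((n : ℚ) + 1) ≤ tt α D n * D + α := by exact_mod_cast h3
  linarith
lemma tt_hi (α D n : ℕ) (hD : 0 < D) (h : α ≤ n) : (tt α D n : ℚ) ≤ ((n : ℚ) - α + D) / D := by
  rw [le_div_iff₀ (by exact_mod_cast hD)]
  have h1 := Nat.div_add_mod (n + D - α) D
  have h3 : tt α D n * D + α ≤ n + D := by rw [tt, mul_comm]; omega
  have : (tt α D n : ℚ) * D + α ≤ n + D := by exact_mod_cast h3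
  linarith

def posN (n : ℕ) : ℕ := 2 * tt 1 8 n + 2 * tt 8 8 n + 2 * tt 51 40 n + 2 * tt 86 40 n + 2 * tt 165 72 n + 2 * tt 228 72 n + tt 3 9 n + tt 5 13 n + tt 11 25 n + tt 13 29 n + tt 19 41 n + tt 21 45 n + tt 27 57 n + tt 29 61 n + tt 35 73 n + tt 37 77 n + tt 43 89 n + tt 45 93 n
def negN (n : ℕ) : ℕ := 2 * tt 18 24 n + 2 * tt 39 24 n + 2 * tt 100 56 n + 2 * tt 149 56 n + 2 * tt 246 88 n + 2 * tt 323 88 n + tt 0 3 n + tt 2 7 n + tt 8 19 n + tt 10 23 n + tt 16 35 n + tt 18 39 n + tt 24 51 n + tt 26 55 n + tt 32 67 n + tt 34 71 n + tt 40 83 n + tt 42 87 n + tt 48 99 n + tt 50 103 n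

lemma pn_large (n : ℕ) (hn : 800 ≤ n) : negN n + 2 ≤ posN n := by
  have p0 := tt_lo 1 8 n (by norm_num) (by omega)
  have p1 := tt_lo 8 8 n (by norm_num) (by omega)
  have p2 := tt_lo 51 40 n (by norm_num) (by omega)
  have p3 := tt_lo 86 40 n (by norm_num) (by omega)
  have p4 := tt_lo 165 72 n (by norm_num) (by omega)
  have p5 := tt_lo 228 72 n (by norm_num) (by omega)
  have p6 := tt_lo 3 9 n (by norm_num) (by omega)
  have p7 := tt_lo 5 13 n (by norm_num) (by omega)
  have p8 := tt_lo 11 25 n (by norm_num) (by omega)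
  have p9 := tt_lo 13 29 n (by norm_num) (by omega)
  have p10 := tt_lo 19 41 n (by norm_num) (by omega)
  have p11 := tt_lo 21 45 n (by norm_num) (by omega)
  have p12 := tt_lo 27 57 n (by norm_num) (by omega)
  have p13 := tt_lo 29 61 n (by norm_num) (by omega)
  have p14 := tt_lo 35 73 n (by norm_num) (by omega)
  have p15 := tt_lo 37 77 n (by norm_num) (by omega)
  have p16 := tt_lo 43 89 n (by norm_num) (by omega)
  have p17 := tt_lo 45 93 n (by norm_num) (by omega)
  have q0 := tt_hi 18 24 n (by norm_num) (by omega)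
  have q1 := tt_hi 39 24 n (by norm_num) (by omega)
  have q2 := tt_hi 100 56 n (by norm_num) (by omega)
  have q3 := tt_hi 149 56 n (by norm_num) (by omega)
  have q4 := tt_hi 246 88 n (by norm_num) (by omega)
  have q5 := tt_hi 323 88 n (by norm_num) (by omega)
  have q6 := tt_hi 0 3 n (by norm_num) (by omega)
  have q7 := tt_hi 2 7 n (by norm_num) (by omega)
  have q8 := tt_hi 8 19 n (by norm_num) (by omega)
  have q9 := tt_hi 10 23 n (by norm_num) (by omega)
  have q10 := tt_hi 16 35 n (by norm_num) (by omega)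
  have q11 := tt_hi 18 39 n (by norm_num) (by omega)
  have q12 := tt_hi 24 51 n (by norm_num) (by omega)
  have q13 := tt_hi 26 55 n (by norm_num) (by omega)
  have q14 := tt_hi 32 67 n (by norm_num) (by omega)
  have q15 := tt_hi 34 71 n (by norm_num) (by omega)
  have q16 := tt_hi 40 83 n (by norm_num) (by omega)
  have q17 := tt_hi 42 87 n (by norm_num) (by omega)
  have q18 := tt_hi 48 99 n (by norm_num) (by omega)
  have q19 := tt_hi 50 103 n (by norm_num) (by omega)
  have hn' : (800 : ℚ) ≤ n := by exact_mod_cast hn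
  have : ((negN n + 2 : ℕ) : ℚ) ≤ (posN n : ℕ) := by
    rw [negN, posN]
    push_cast at *
    linarith
  exact_mod_cast this

def isPt (n : ℕ) : Bool := Nat.ble 15 n && (Nat.beq (n % 16) 15 || Nat.beq (n % 16) 0 || Nat.beq (n % 16) 1)
def ptn (n : ℕ) : ℕ := cond (isPt n) 1 0

def chk (n : ℕ) : Bool := (Nat.beq n 0 || Nat.ble (negN n + ptn n) (posN n)) &&
  (Nat.beq (n % 2) 1 || Nat.ble n 11 || Nat.beq n 16 || Nat.beq n 18 || Nat.ble (negN n + ptn n + 1) (posN n))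

lemma chk_all : (List.range 800).all chk = true := by decide +kernel

lemma pn_small (n : ℕ) (hn : n < 800) : (n ≠ 0 → negN n + ptn n ≤ posN n) ∧
    (n % 2 = 0 → 12 ≤ n → n ≠ 16 → n ≠ 18 → negN n + ptn n + 1 ≤ posN n) := by
  have h := List.all_eq_true.1 chk_all n (List.mem_range.2 hn)
  simp only [chk, Bool.and_eq_true, Bool.or_eq_true, Nat.beq_eq, Nat.ble_eq] at h
  omega

lemma ptn_le (n : ℕ) : ptn n ≤ 1 := by rw [ptn]; cases isPt n <;> simp

lemma pn_all (n : ℕ) : (n ≠ 0 → negN n + ptn n ≤ posN n) ∧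
    (n % 2 = 0 → 12 ≤ n → n ≠ 16 → n ≠ 18 → negN n + ptn n + 1 ≤ posN n) := by
  have hp := ptn_le n
  rcases (show n < 800 ∨ 800 ≤ n by omega) with h | h
  · exact pn_small n h
  · have := pn_large n h
    exact ⟨fun _ => by omega, fun _ _ _ _ => by omega⟩

lemma prog2_eq (α δ D E : ℕ) (hD : 0 < D) : (X ^ α * geo D - X ^ (α + δ) * geo (D + E) : PowerSeries ℤ) =
    X ^ α * (1 - X ^ δ) * geo (D + E) + X ^ (α + D) * (1 - X ^ E) * (geo D * geo (D + E)) := by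
  have g1 := geo_mul D hD
  have g2 := geo_mul (D + E) (by omega)
  rw [pow_add] at g2
  rw [pow_add, pow_add]
  linear_combination X ^ α * geo D * (-g2) + X ^ α * geo (D + E) * g1

/-- the cone for `1 - x` alone -/
lemma SC.one {f : PowerSeries ℤ} : SC 1 0 ∅ f ↔ Nn (geo 1 * f) := by
  have h0 : geo 0 = 1 := by
    ext n
    rw [geo, PowerSeries.coeff_mk, PowerSeries.coeff_one]
    by_cases h : n = 0
    · simp [h]
    · simp [h]
  constructor
  · intro h
    have := h.1
    rwa [h0, mul_one] at this
  · intro h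
    refine ⟨?_, fun _ h => absurd h (Set.notMem_empty _)⟩
    rwa [h0, mul_one]

lemma one_prog2 (α δ D E : ℕ) (hD : 0 < D) : SC 1 0 ∅ (X ^ α * geo D - X ^ (α + δ) * geo (D + E)) := by
  rw [SC.one, prog2_eq α δ D E hD]
  have h : ∀ d, Nn (geo 1 * (1 - X ^ d)) := fun d => by
    have := geo_nn 1 d (by norm_num)
    rwa [one_mul] at this
  have := ((Nn.X_pow α).mul (Nn.geo (D + E))).mul (h δ) |>.add
    (((Nn.X_pow (α + D)).mul ((Nn.geo D).mul (Nn.geo (D + E)))).mul (h E))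
  convert this using 1
  ring

lemma ap0_sc : SC 1 0 ∅ ((sgo (0 : Fin 4) : PowerSeries ℤ) * rescale (-1 : ℤ) (AP (0 : Fin 4)) - ∑ p ∈ Finset.range 3,
    2 * ((X ^ apA (0 : Fin 4) (2 * p) * geo (32 * p + 8) - X ^ apA (0 : Fin 4) (2 * p + 1) * geo (32 * p + 24)) +
    (X ^ apB (0 : Fin 4) (2 * p) * geo (32 * p + 8) - X ^ apB (0 : Fin 4) (2 * p + 1) * geo (32 * p + 24)))) := by
  refine (SC.hasSum (T := fun _ => ∅) (ap_pairs 0) (Finset.range 3) (fun p _ => ?_)).empty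
  refine SC.nn_mul nn_two (SC.add0 ?_ ?_)
  · rw [apA_succ]
    exact one_prog2 _ _ (32 * p + 8) 16 (by omega)
  · rw [apB_succ]
    exact one_prog2 _ _ (32 * p + 8) 16 (by omega)

noncomputable def eif (i : ℕ) : PowerSeries ℤ :=
  (X ^ (3 + 8 * i) * geo (16 * i + 9) - X ^ (8 * i + 8) * geo (16 * i + 19)) +
  (X ^ (5 + 8 * i) * geo (16 * i + 13) - X ^ (8 * i + 10) * geo (16 * i + 23))

lemma hs_eif : HasSum eif (((sgo (0 : Fin 4) : PowerSeries ℤ) * (ET (0 : Fin 4) 0 + ET (0 : Fin 4) 1 - ET (0 : Fin 4) 2 - ET (0 : Fin 4) 3))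
    + geo 3 + X ^ 2 * geo 7) := by
  have h0 := (hasSum_nat_add_iff' 1).2 (ET_d 0 0 0 (by decide))
  have h1 := (hasSum_nat_add_iff' 1).2 (ET_d 0 1 2 (by decide))
  have h2 := ET_d 0 2 3 (by decide)
  have h3 := ET_d 0 3 5 (by decide)
  refine hs_congr ((h2.sub h0).add (h3.sub h1)) (fun i => ?_) ?_
  · have t0 : tv (0 : Fin 4) (0 : Fin 4) = 3 := rfl
    have t1 : tv (0 : Fin 4) (1 : Fin 4) = 7 := rfl
    have t2 : tv (0 : Fin 4) (2 : Fin 4) = 9 := rfl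
    have t3 : tv (0 : Fin 4) (3 : Fin 4) = 13 := rfl
    rw [t0, t1, t2, t3, eif]
    have a0 : 0 + 8 * (i + 1) = 8 * i + 8 := by ring
    have a1 : 2 + 8 * (i + 1) = 8 * i + 10 := by ring
    have b0 : 16 * (i + 1) + 3 = 16 * i + 19 := by ring
    have b1 : 16 * (i + 1) + 7 = 16 * i + 23 := by ring
    rw [a0, a1, b0, b1]
  · simp [tv, sgo]
    ring

lemma ei0_sc : SC 1 0 ∅ (((sgo (0 : Fin 4) : PowerSeries ℤ) * (ET (0 : Fin 4) 0 + ET (0 : Fin 4) 1 - ET (0 : Fin 4) 2 - ET (0 : Fin 4) 3))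
    + geo 3 + X ^ 2 * geo 7 - ∑ i ∈ Finset.range 6, eif i) := by
  refine (SC.hasSum (T := fun _ => ∅) hs_eif (Finset.range 6) (fun i _ => ?_)).empty
  have e1 : 8 * i + 8 = (3 + 8 * i) + 5 := by ring
  have e2 : 8 * i + 10 = (5 + 8 * i) + 5 := by ring
  rw [eif, e1, e2]
  exact (one_prog2 _ 5 (16 * i + 9) 10 (by omega)).add0 (one_prog2 _ 5 (16 * i + 13) 10 (by omega))

lemma S0_lower (n : ℕ) : (posN n : ℤ) - negN n ≤
    PowerSeries.coeff n (geo 1 * ((sgo (0 : Fin 4) : PowerSeries ℤ) * (jt (0 : Fin 4) * gg (0 : Fin 4)))) := by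
  have h := SC.one.1 (ap0_sc.add0 ei0_sc) n
  rw [lam 0]
  have T := fun (α D : ℕ) (hD : 0 < D) => coeff_tt α D hD n
  have T0 : PowerSeries.coeff n (geo 1 * geo 3) = (tt 0 3 n : ℤ) := by
    have := T 0 3 (by norm_num)
    rwa [pow_zero, one_mul] at this
  have key : PowerSeries.coeff n (geo 1 * (∑ p ∈ Finset.range 3,
    2 * ((X ^ apA (0 : Fin 4) (2 * p) * geo (32 * p + 8) - X ^ apA (0 : Fin 4) (2 * p + 1) * geo (32 * p + 24)) +
    (X ^ apB (0 : Fin 4) (2 * p) * geo (32 * p + 8) - X ^ apB (0 : Fin 4) (2 * p + 1) * geo (32 * p + 24))) +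
    (∑ i ∈ Finset.range 6, eif i) - geo 3 - X ^ 2 * geo 7)) = (posN n : ℤ) - negN n := by
    rw [mul_sub, mul_sub, mul_add, map_sub, map_sub, map_add, T0, T 2 7 (by norm_num)]
    have c1 : ∀ p, PowerSeries.coeff n (geo 1 * (2 * ((X ^ apA (0 : Fin 4) (2 * p) * geo (32 * p + 8) - X ^ apA (0 : Fin 4) (2 * p + 1) * geo (32 * p + 24)) +
    (X ^ apB (0 : Fin 4) (2 * p) * geo (32 * p + 8) - X ^ apB (0 : Fin 4) (2 * p + 1) * geo (32 * p + 24))))) =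
      2 * (tt (apA (0 : Fin 4) (2 * p)) (32 * p + 8) n - tt (apA (0 : Fin 4) (2 * p + 1)) (32 * p + 24) n +
        (tt (apB (0 : Fin 4) (2 * p)) (32 * p + 8) n - tt (apB (0 : Fin 4) (2 * p + 1)) (32 * p + 24) n) : ℤ) := by
      intro p
      rw [mul_left_comm, two_mul, map_add, mul_add, mul_sub, mul_sub, map_add, map_sub, map_sub, T _ _ (by omega), T _ _ (by omega),
        T _ _ (by omega), T _ _ (by omega)]
      ring
    have c2 : ∀ i, PowerSeries.coeff n (geo 1 * eif i) = (tt (3 + 8 * i) (16 * i + 9) n - tt (8 * i + 8) (16 * i + 19) n +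
        (tt (5 + 8 * i) (16 * i + 13) n - tt (8 * i + 10) (16 * i + 23) n) : ℤ) := by
      intro i
      rw [eif, mul_add, mul_sub, mul_sub, map_add, map_sub, map_sub, T _ _ (by omega), T _ _ (by omega),
        T _ _ (by omega), T _ _ (by omega)]
    rw [Finset.mul_sum, Finset.mul_sum, map_sum, map_sum, Finset.sum_congr rfl (fun p _ => c1 p), Finset.sum_congr rfl (fun i _ => c2 i)]
    simp [Finset.sum_range_succ, apA, apB, posN, negN]
    ring
  rw [← key]
  have e := map_sub (PowerSeries.coeff (R := ℤ) n)
  rw [← sub_nonneg, ← map_sub, ← mul_sub]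
  convert h using 3
  ring

/-- invariant: `Q` a product of geometric series over parts, `R` the sum of `x^p` over those parts -/
def PInv (Q R : PowerSeries ℤ) : Prop := Nn R ∧ Nn (Q - 1 - R) ∧ Nn (Q * (R - 1) + 1)

lemma PInv.one : PInv 1 0 := ⟨Nn.zero, by simpa using Nn.zero, by simpa using Nn.zero⟩

lemma PInv.step {Q R : PowerSeries ℤ} (h : PInv Q R) (p : ℕ) (hp : 0 < p) : PInv (Q * geo p) (R + X ^ p) := by
  obtain ⟨h1, h2, h3⟩ := h
  have g := geo_mul p hp
  have G := Nn.geo p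
  have Xp := Nn.X_pow p
  refine ⟨h1.add Xp, ?_, ?_⟩
  · have := ((h2.mul G).add ((Xp.mul h1).mul G)).add ((Xp.mul Xp).mul G)
    convert this using 1
    linear_combination (1 + R + X ^ p) * g
  · have := (G.mul h3).add ((Xp.mul G).mul (h2.add h1))
    convert this using 1
    linear_combination (-g)

noncomputable def tr (i : ℕ) : PowerSeries ℤ := geo (16 * i + 15) * geo (16 * i + 16) * geo (16 * i + 17)
noncomputable def rr (i : ℕ) : PowerSeries ℤ := X ^ (16 * i + 15) + X ^ (16 * i + 16) + X ^ (16 * i + 17)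

lemma PInv.prod (n : ℕ) : PInv (∏ i ∈ Finset.range n, tr i) (∑ i ∈ Finset.range n, rr i) := by
  induction n with
  | zero => simpa using PInv.one
  | succ n ih =>
    have := ((ih.step (16 * n + 15) (by omega)).step (16 * n + 16) (by omega)).step (16 * n + 17) (by omega)
    rw [Finset.prod_range_succ, Finset.sum_range_succ, tr, rr]
    convert this using 1 <;> ring

lemma wf_tr (n : ℕ) : ∏ i ∈ Finset.range (n + 1), wf 1 i =
    geo 1 * ((∏ i ∈ Finset.range n, tr i) * geo (16 * n + 15) * geo (16 * n + 16)) := by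
  induction n with
  | zero => simp [wf]; ring
  | succ n ih =>
    rw [Finset.prod_range_succ, ih, Finset.prod_range_succ, tr, wf]
    have e : 16 * (n + 1) + 1 = 16 * n + 17 := by ring
    rw [e]
    norm_num
    ring

lemma rr_coeff (n m : ℕ) : PowerSeries.coeff m (∑ i ∈ Finset.range n, rr i) =
    if isPt m = true ∧ m < 16 * n + 15 then 1 else 0 := by
  induction n with
  | zero =>
    rw [Finset.sum_range_zero, map_zero, if_neg]
    simp only [isPt, Bool.and_eq_true, Nat.ble_eq]
    omega
  | succ n ih =>
    rw [Finset.sum_range_succ, map_add, ih, rr, map_add, map_add, PowerSeries.coeff_X_pow, PowerSeries.coeff_X_pow,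
      PowerSeries.coeff_X_pow]
    have : isPt m = true ↔ 15 ≤ m ∧ (m % 16 = 15 ∨ m % 16 = 0 ∨ m % 16 = 1) := by
      simp only [isPt, Bool.and_eq_true, Nat.ble_eq, Bool.or_eq_true, Nat.beq_eq]
      tauto
    simp only [this]
    split_ifs <;> omega

lemma R_coeff (n m : ℕ) (hm : m < 16 * n + 15) : PowerSeries.coeff m ((∑ i ∈ Finset.range n, rr i) + X ^ (16 * n + 15) + X ^ (16 * n + 16)) =
    (ptn m : ℤ) := by
  rw [map_add, map_add, PowerSeries.coeff_X_pow, PowerSeries.coeff_X_pow, rr_coeff, ptn]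
  have h1 : m ≠ 16 * n + 15 := by omega
  have h2 : m ≠ 16 * n + 16 := by omega
  cases h : isPt m <;> simp [hm, h1, h2]

lemma neg_zero_val : negN 0 = 1 ∧ posN 0 = 0 := by decide +kernel

/-- convolution bound on an initial segment -/
lemma conv_le (Q Y : PowerSeries ℤ) (hQ : Nn Q) (K : ℕ) (hY : ∀ j ≤ K, 0 ≤ PowerSeries.coeff j Y) (j : ℕ) (hj : j ≤ K) :
    PowerSeries.coeff j Q * PowerSeries.coeff (K - j) Y ≤ PowerSeries.coeff K (Q * Y) := by
  rw [PowerSeries.coeff_mul]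
  refine Finset.single_le_sum (f := fun p : ℕ × ℕ => PowerSeries.coeff p.1 Q * PowerSeries.coeff p.2 Y)
    (s := Finset.HasAntidiagonal.antidiagonal K) (fun p hp => ?_) (a := (j, K - j)) ?_
  · rw [Finset.HasAntidiagonal.mem_antidiagonal] at hp
    exact mul_nonneg (hQ _) (hY _ (by omega))
  · rw [Finset.HasAntidiagonal.mem_antidiagonal]; simp; omega

lemma pos0 (K : ℕ) (hK : K % 2 = 0) (hK12 : 12 ≤ K) : PowerSeries.coeff K (gg 0) < 0 := by
  set n := K with hn
  have e := gg_coeff 0 (n + 1) K (by omega)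
  have e4 : 4 * ((0 : Fin 4) : ℕ) + 1 = 1 := rfl
  rw [e4, wf_tr] at e
  set Q := (∏ i ∈ Finset.range n, tr i) * geo (16 * n + 15) * geo (16 * n + 16) with hQ
  set R := (∑ i ∈ Finset.range n, rr i) + X ^ (16 * n + 15) + X ^ (16 * n + 16) with hR
  have hI : PInv Q R := ((PInv.prod n).step (16 * n + 15) (by omega)).step (16 * n + 16) (by omega)
  obtain ⟨i1, i2, i3⟩ := hI
  set S := geo 1 * ((sgo (0 : Fin 4) : PowerSeries ℤ) * (jt (0 : Fin 4) * gg (0 : Fin 4))) with hS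
  have hsg : (sgo (0 : Fin 4) : PowerSeries ℤ) = -1 := by simp [sgo]
  have e2 : PowerSeries.coeff K (gg 0) = - PowerSeries.coeff K (Q * S) := by
    rw [← map_neg]
    have : -(Q * S) = geo 1 * Q * (jt (0 : Fin 4) * gg (0 : Fin 4)) := by rw [hS, hsg]; ring
    rw [this]; exact e
  set Y := S - (R - 1) with hY
  have hRc : ∀ m ≤ K, PowerSeries.coeff m R = ptn m := fun m hm => R_coeff n m (by omega)
  have hYc : ∀ m ≤ K, (posN m : ℤ) - negN m - ptn m + (if m = 0 then 1 else 0) ≤ PowerSeries.coeff m Y := by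
    intro m hm
    have := S0_lower m
    rw [hY, map_sub, map_sub, hRc m hm, PowerSeries.coeff_one]
    linarith
  have hYn : ∀ m ≤ K, 0 ≤ PowerSeries.coeff m Y := by
    intro m hm
    have h1 := hYc m hm
    by_cases h0 : m = 0
    · subst h0
      have h2 := neg_zero_val
      have h3 : ptn 0 = 0 := rfl
      rw [h2.1, h2.2, h3] at h1
      simpa using h1
    · have h2 := (pn_all m).1 h0
      simp only [h0, if_false] at h1
      omega
  have hQn : Nn Q := by
    have := (i2.add i1).add Nn.one
    convert this using 1
    ring
  have hQc : ∀ m ≤ K, ptn m ≤ PowerSeries.coeff m Q := by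
    intro m hm
    have h1 := i2 m
    rw [map_sub, map_sub, hRc m hm] at h1
    have h2 := Nn.one m
    linarith
  have hQ0 : 1 ≤ PowerSeries.coeff 0 Q := by
    have h1 := i2 0
    have h3 : ptn 0 = 0 := rfl
    rw [map_sub, map_sub, hRc 0 (by omega), h3, PowerSeries.coeff_one] at h1
    simp at h1
    simpa using h1
  have key : 0 < PowerSeries.coeff K (Q * Y) := by
    by_cases h16 : K = 16
    · have h1 := conv_le Q Y hQn K hYn 15 (by omega)
      have h2 := hQc 15 (by omega)
      have h3 := hYc 1 (by omega)
      have h4 : (posN 1 : ℤ) - negN 1 - ptn 1 + (if 1 = 0 then 1 else 0) = 1 := by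
        have : posN 1 = negN 1 + ptn 1 + 1 := by decide +kernel
        rw [this]; push_cast; simp; ring
      have h5 : ptn 15 = 1 := rfl
      have h6 : K - 15 = 1 := by omega
      rw [h4] at h3
      rw [h5] at h2
      rw [h6] at h1
      push_cast at h2
      nlinarith
    by_cases h18 : K = 18
    · have h1 := conv_le Q Y hQn K hYn 17 (by omega)
      have h2 := hQc 17 (by omega)
      have h3 := hYc 1 (by omega)
      have h4 : (posN 1 : ℤ) - negN 1 - ptn 1 + (if 1 = 0 then 1 else 0) = 1 := by
        have : posN 1 = negN 1 + ptn 1 + 1 := by decide +kernel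
        rw [this]; push_cast; simp; ring
      have h5 : ptn 17 = 1 := rfl
      have h6 : K - 17 = 1 := by omega
      rw [h4] at h3
      rw [h5] at h2
      rw [h6] at h1
      push_cast at h2
      nlinarith
    · have h1 := conv_le Q Y hQn K hYn 0 (by omega)
      rw [Nat.sub_zero] at h1
      have h2 := (pn_all K).2 hK hK12 h16 h18
      have h3 := hYc K le_rfl
      have h4 : K ≠ 0 := by omega
      simp only [h4, if_false] at h3
      have h5 : 1 ≤ PowerSeries.coeff K Y := by omega
      nlinarith
  have h7 := i3 K
  rw [map_add, PowerSeries.coeff_one] at h7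
  have h4 : K ≠ 0 := by omega
  simp only [h4, if_false] at h7
  have h8 : Q * S = Q * (R - 1) + Q * Y := by rw [hY]; ring
  rw [e2, h8, map_add]
  linarith

lemma gg_odd (s K : ℕ) (hK : K % 2 = 1) (h : 0 < PowerSeries.coeff K (gg s)) : N2 2 4 (4 * K + s) > N2 0 4 (4 * K + s) := by
  rw [coeff_gg, Odd.neg_one_pow (Nat.odd_iff.2 hK)] at h
  omega

lemma gg_even (s K : ℕ) (hK : K % 2 = 0) (h : PowerSeries.coeff K (gg s) < 0) : N2 2 4 (4 * K + s) > N2 0 4 (4 * K + s) := by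
  rw [coeff_gg, Even.neg_one_pow (Nat.even_iff.2 hK)] at h
  omega

end helpers

theorem N2_mod4_inequalities_two_gt_zero :
    (∀ m : ℕ, m % 8 = 6 → N2 2 4 m > N2 0 4 m) ∧
    (∀ m : ℕ, 48 ≤ m → m % 8 = 0 → N2 2 4 m > N2 0 4 m) ∧
    (∀ m : ℕ, 27 ≤ m → m % 8 = 3 → N2 2 4 m > N2 0 4 m) ∧
    (∀ m : ℕ, 13 ≤ m → m % 8 = 5 → N2 2 4 m > N2 0 4 m) := by
  refine ⟨fun m hm => ?_, fun m h hm => ?_, fun m h hm => ?_, fun m h hm => ?_⟩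
  · have e : m = 4 * (m / 4) + 2 := by omega
    rw [e]
    exact gg_odd 2 _ (by omega) (pos2 _ (by omega))
  · have e : m = 4 * (m / 4) + 0 := by omega
    rw [e]
    exact gg_even 0 _ (by omega) (pos0 _ (by omega) (by omega))
  · have e : m = 4 * (m / 4) + 3 := by omega
    rw [e]
    exact gg_even 3 _ (by omega) (pos3 _ (by omega) (by omega))
  · have e : m = 4 * (m / 4) + 1 := by omega
    rw [e]
    exact gg_odd 1 _ (by omega) (pos1 _ (by omega) (by omega))
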